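/- A countable group G has a computable left order with respect to some enumerated generating sequence x : ℕ → G if and only if there exists an embedding (injective homomorphism) φ of G into a finitely generated simple group H (with a surjection π from the free group on a finite set Y onto H) such that H has a computable left order and the membership problem for φ(G) in H is decidable. -/

import Mathlib

-- The sign (−1, 0, or 1) of a group element relative to the identity,
-- with respect to a linear order `l`.
open Classical in
noncomputable def orderSign {H : Type*} [Group H] (l : LinearOrder H) (h : H) : ℤ :=
  if l.lt h 1 then -1 else if h = 1 then 0 else 1

/-- A group is left-orderable if it carries a left-invariant linear order. -/
def IsLeftOrderable (G : Type*) [Group G] : Prop :=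
  ∃ l : LinearOrder G, ∀ a b c : G, l.le b c → l.le (a * b) (a * c)

/-- A Frattini embedding: an injective homomorphism preserving and reflecting conjugacy. -/
def IsFrattini {G H : Type*} [Group G] [Group H] (φ : G →* H) : Prop :=
  Function.Injective φ ∧ ∀ a b : G, IsConj a b ↔ IsConj (φ a) (φ b)

/-- `X` is a (finite) generating set of the group. -/
def Generates {G : Type*} [Group G] (X : Finset G) : Prop :=
  Subgroup.closure (X : Set G) = ⊤

/-- Word length of `g` with respect to the finite set `X`: the least length of a word
over `X ∪ X⁻¹` representing `g`. -/
noncomputable def wordLength {G : Type*} [Group G] (X : Finset G) (g : G) : ℕ :=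
  sInf {n | ∃ w : List G, w.length = n ∧ (∀ a ∈ w, a ∈ X ∨ a⁻¹ ∈ X) ∧ w.prod = g}

/-- Quasi-isometric embedding with respect to finite generating sets `X` and `Y`. -/
noncomputable def IsQIEmbedding {G H : Type*} [Group G] [Group H]
    (X : Finset G) (Y : Finset H) (φ : G →* H) : Prop :=
  Function.Injective φ ∧ ∃ C k : ℝ, 0 < C ∧ 0 < k ∧ ∀ g : G,
    (1 / C) * (wordLength X g : ℝ) - k ≤ (wordLength Y (φ g) : ℝ) ∧
    (wordLength Y (φ g) : ℝ) ≤ C * (wordLength X g : ℝ) + k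

/-- Evaluation of a formal word (list of pairs (index, sign)) over the
enumerated sequence `x : ℕ → G`. -/
def evalWord {G : Type*} [Group G] (x : ℕ → G) (w : List (ℕ × Bool)) : G :=
  (w.map (fun p => if p.2 then x p.1 else (x p.1)⁻¹)).prod

/-- A computable left order on a countable group with respect to an enumerated
generating sequence `x : ℕ → G`. -/
def ComputableLeftOrderWrt {G : Type*} [Group G] (x : ℕ → G) : Prop :=
  ∃ l : LinearOrder G, (∀ a b c : G, l.le b c → l.le (a * b) (a * c)) ∧
    Computable (fun w : List (ℕ × Bool) => orderSign l (evalWord x w))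

/-- A computable left order on a finitely generated group, presented by
a surjection `π` from a free group of finite rank. -/
def ComputableLeftOrderVia {H : Type*} [Group H] {m : ℕ}
    (π : FreeGroup (Fin m) →* H) : Prop :=
  ∃ l : LinearOrder H, (∀ a b c : H, l.le b c → l.le (a * b) (a * c)) ∧
    Computable (fun w : List (Fin m × Bool) => orderSign l (π (FreeGroup.mk w)))

/-- The embedding `φ` is computable: one can compute, for each `i`, a word over the
generators of `H` representing `φ (x i)`. -/
def ComputableEmbedding {G H : Type*} [Group G] [Group H] (x : ℕ → G) {m : ℕ}
    (π : FreeGroup (Fin m) →* H) (φ : G →* H) : Prop :=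
  ∃ f : ℕ → List (Fin m × Bool), Computable f ∧ ∀ i, π (FreeGroup.mk (f i)) = φ (x i)

/-- Decidable membership problem for the image of `φ` in `H`, presented via `π`. -/
def DecidableMembership {G H : Type*} [Group G] [Group H] {m : ℕ}
    (π : FreeGroup (Fin m) →* H) (φ : G →* H) : Prop :=
  ComputablePred (fun w : List (Fin m × Bool) => π (FreeGroup.mk w) ∈ φ.range)

/-- Decidable word problem for `H`, presented via `π`. -/
def DecidableWordProblemVia {H : Type*} [Group H] {m : ℕ}
    (π : FreeGroup (Fin m) →* H) : Prop :=
  ComputablePred (fun w : List (Fin m × Bool) => π (FreeGroup.mk w) = 1)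

/-- A group is finitely presented: quotient of a finite-rank free group by the
normal closure of finitely many relators. -/
def IsFinitelyPresented (K : Type*) [Group K] : Prop :=
  ∃ (m : ℕ) (π : FreeGroup (Fin m) →* K) (R : Finset (FreeGroup (Fin m))),
    Function.Surjective π ∧ π.ker = Subgroup.normalClosure (R : Set (FreeGroup (Fin m)))
section Toolbox

set_option linter.unusedSectionVars false

namespace CT

variable {α β γ σ : Type*} [Primcodable α] [Primcodable β] [Primcodable γ] [Primcodable σ]

theorem foldl_eq_rec (l : List β) (s : σ) (h : σ × β → σ) (n : ℕ) :
    (Nat.rec s (fun n t => ((l[n]?).map (fun b => h (t, b))).getD t) n : σ)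
      = (l.take n).foldl (fun s b => h (s, b)) s := by
  induction n with
  | zero => simp
  | succ n ih =>
    simp only [ih, List.take_add_one, List.foldl_append]
    cases l[n]? <;> simp

theorem list_foldl {f : α → List β} {g : α → σ} {h : α → σ × β → σ}
    (hf : Computable f) (hg : Computable g) (hh : Computable₂ h) :
    Computable fun a => (f a).foldl (fun s b => h a (s, b)) (g a) := by
  have : Computable fun a => (Nat.rec (g a)
      (fun n t => (((f a)[n]?).map (fun b => h a (t, b))).getD t) (f a).length : σ) := by
    refine Computable.nat_rec (h := fun a (p : ℕ × σ) =>
      (((f a)[p.1]?).map (fun b => h a (p.2, b))).getD p.2)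
      (Computable.list_length.comp hf) hg ?_
    refine Computable.option_getD (Computable.option_map
      (Computable.list_getElem?.comp (hf.comp Computable.fst)
        (Computable.fst.comp Computable.snd)) ?_) (Computable.snd.comp Computable.snd)
    exact hh.comp (Computable.fst.comp Computable.fst)
      (Computable.pair (Computable.snd.comp (Computable.snd.comp Computable.fst)) Computable.snd)
  refine this.of_eq fun a => ?_
  rw [foldl_eq_rec]; simp

theorem list_foldr {f : α → List β} {g : α → σ} {h : α → β × σ → σ}
    (hf : Computable f) (hg : Computable g) (hh : Computable₂ h) :
    Computable fun a => (f a).foldr (fun b s => h a (b, s)) (g a) := by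
  have := list_foldl (h := fun a (p : σ × β) => h a (p.2, p.1))
    (Computable.list_reverse.comp hf) hg
    (hh.comp Computable.fst (Computable.pair (Computable.snd.comp Computable.snd)
      (Computable.fst.comp Computable.snd)))
  refine this.of_eq fun a => ?_
  simp [List.foldl_reverse]

theorem list_map {f : α → List β} {g : α → β → σ}
    (hf : Computable f) (hg : Computable₂ g) :
    Computable fun a => (f a).map (g a) := by
  have := list_foldr (h := fun a (p : β × List σ) => g a p.1 :: p.2) hf (Computable.const [])
    (Computable.list_cons.comp (hg.comp Computable.fst (Computable.fst.comp Computable.snd))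
      (Computable.snd.comp Computable.snd))
  refine this.of_eq fun a => ?_
  induction f a with
  | nil => rfl
  | cons b l ih => rw [List.map_cons, ← ih]; rfl

theorem list_flatMap {f : α → List β} {g : α → β → List σ}
    (hf : Computable f) (hg : Computable₂ g) :
    Computable fun a => (f a).flatMap (g a) := by
  have := list_foldr (h := fun a (p : β × List σ) => g a p.1 ++ p.2) hf (Computable.const [])
    (Computable.list_append.comp (hg.comp Computable.fst (Computable.fst.comp Computable.snd))
      (Computable.snd.comp Computable.snd))
  refine this.of_eq fun a => ?_
  induction f a with
  | nil => rfl
  | cons b l ih => simp [← ih]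

theorem band {f g : α → Bool} (hf : Computable f) (hg : Computable g) :
    Computable fun a => f a && g a := by
  refine (Computable.cond hf hg (Computable.const false)).of_eq fun a => ?_
  cases f a <;> rfl

theorem bor {f g : α → Bool} (hf : Computable f) (hg : Computable g) :
    Computable fun a => f a || g a := by
  refine (Computable.cond hf (Computable.const true) hg).of_eq fun a => ?_
  cases f a <;> rfl

theorem bnot {f : α → Bool} (hf : Computable f) :
    Computable fun a => !f a := by
  refine (Computable.cond hf (Computable.const false) (Computable.const true)).of_eq fun a => ?_
  cases f a <;> rfl

theorem list_any {f : α → List β} {g : α → β → Bool}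
    (hf : Computable f) (hg : Computable₂ g) :
    Computable fun a => (f a).any (g a) := by
  have := list_foldr (h := fun a (p : β × Bool) => g a p.1 || p.2) hf (Computable.const false)
    (bor (hg.comp Computable.fst (Computable.fst.comp Computable.snd))
      (Computable.snd.comp Computable.snd))
  refine this.of_eq fun a => ?_
  induction f a with
  | nil => rfl
  | cons b l ih => simp [← ih]

theorem list_all {f : α → List β} {g : α → β → Bool}
    (hf : Computable f) (hg : Computable₂ g) :
    Computable fun a => (f a).all (g a) := by
  have := list_foldr (h := fun a (p : β × Bool) => g a p.1 && p.2) hf (Computable.const true)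
    (band (hg.comp Computable.fst (Computable.fst.comp Computable.snd))
      (Computable.snd.comp Computable.snd))
  refine this.of_eq fun a => ?_
  induction f a with
  | nil => rfl
  | cons b l ih => simp [← ih]

theorem list_countP {f : α → List β} {g : α → β → Bool}
    (hf : Computable f) (hg : Computable₂ g) :
    Computable fun a => (f a).countP (g a) := by
  have := list_foldr (h := fun a (p : β × ℕ) => cond (g a p.1) (p.2 + 1) p.2) hf
    (Computable.const 0)
    (Computable.cond (hg.comp Computable.fst (Computable.fst.comp Computable.snd))
      (Computable.succ.comp (Computable.snd.comp Computable.snd))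
      (Computable.snd.comp Computable.snd))
  refine this.of_eq fun a => ?_
  induction f a with
  | nil => rfl
  | cons b l ih =>
    rw [List.countP_cons, ← ih]
    simp only [List.foldr_cons]
    cases g a b <;> simp

theorem natLt {f g : α → ℕ} (hf : Computable f) (hg : Computable g) :
    Computable fun a => decide (f a < g a) :=
  (Primrec.nat_lt.decide.to_comp).comp hf hg

theorem natLe {f g : α → ℕ} (hf : Computable f) (hg : Computable g) :
    Computable fun a => decide (f a ≤ g a) :=
  (Primrec.nat_le.decide.to_comp).comp hf hg

theorem natEq {f g : α → ℕ} (hf : Computable f) (hg : Computable g) :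
    Computable fun a => decide (f a = g a) :=
  (Primrec.eq.decide.to_comp).comp hf hg

theorem natAdd {f g : α → ℕ} (hf : Computable f) (hg : Computable g) :
    Computable fun a => f a + g a :=
  (Primrec.nat_add.to_comp).comp hf hg

theorem natSub {f g : α → ℕ} (hf : Computable f) (hg : Computable g) :
    Computable fun a => f a - g a :=
  (Primrec.nat_sub.to_comp).comp hf hg

theorem natMul {f g : α → ℕ} (hf : Computable f) (hg : Computable g) :
    Computable fun a => f a * g a :=
  (Primrec.nat_mul.to_comp).comp hf hg

theorem natPow {f g : α → ℕ} (hf : Computable f) (hg : Computable g) :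
    Computable fun a => f a ^ g a := by
  have : Computable fun a => (Nat.rec 1 (fun _ t => t * f a) (g a) : ℕ) :=
    Computable.nat_rec (h := fun a (p : ℕ × ℕ) => p.2 * f a) hg (Computable.const 1)
      (natMul (Computable.snd.comp Computable.snd) (hf.comp Computable.fst))
  refine this.of_eq fun a => ?_
  induction g a with
  | zero => rfl
  | succ n ih => simp only [ih, pow_succ]

theorem list_range {f : α → ℕ} (hf : Computable f) :
    Computable fun a => List.range (f a) :=
  (Primrec.list_range.to_comp).comp hf

theorem list_replicate {f : α → ℕ} {g : α → β} (hf : Computable f) (hg : Computable g) :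
    Computable fun a => List.replicate (f a) (g a) := by
  have := list_map (g := fun a (_ : ℕ) => g a) (list_range hf) (hg.comp Computable.fst)
  refine this.of_eq fun a => ?_
  rw [List.map_const']; simp

theorem ite_bool {p : α → Prop} [DecidablePred p] {f g : α → σ}
    (hp : Computable fun a => decide (p a)) (hf : Computable f) (hg : Computable g) :
    Computable fun a => if p a then f a else g a := by
  refine (Computable.cond hp hf hg).of_eq fun a => ?_
  by_cases h : p a <;> simp [h]

theorem app {f : α → β} {g : β → σ} (hg : Computable g) (hf : Computable f) :
    Computable fun a => g (f a) := hg.comp hf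

/-- inverse word -/
def winv {ι : Type*} (w : List (ι × Bool)) : List (ι × Bool) :=
  (w.map fun p => (p.1, !p.2)).reverse

theorem winv_eq {ι : Type*} (w : List (ι × Bool)) : winv w = FreeGroup.invRev w := rfl

theorem comp_winv {f : α → List (β × Bool)} (hf : Computable f) :
    Computable fun a => winv (f a) := by
  refine Computable.list_reverse.comp (list_map (g := fun _ (p : β × Bool) => (p.1, !p.2)) hf ?_)
  exact Computable.pair (Computable.fst.comp Computable.snd)
    (bnot (Computable.snd.comp Computable.snd))

end CT

theorem evalWord_append {G : Type*} [Group G] (x : ℕ → G) (v w : List (ℕ × Bool)) :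
    evalWord x (v ++ w) = evalWord x v * evalWord x w := by
  simp [evalWord]

theorem evalWord_winv {G : Type*} [Group G] (x : ℕ → G) (w : List (ℕ × Bool)) :
    evalWord x (CT.winv w) = (evalWord x w)⁻¹ := by
  induction w with
  | nil => simp [evalWord, CT.winv]
  | cons p w ih =>
    have : CT.winv (p :: w) = CT.winv w ++ [(p.1, !p.2)] := by simp [CT.winv]
    rw [this, evalWord_append, ih]
    rcases p with ⟨i, b⟩
    cases b <;> simp [evalWord]

end Toolbox

theorem mk_winv {ι : Type*} (w : List (ι × Bool)) :
    FreeGroup.mk (CT.winv w) = (FreeGroup.mk w)⁻¹ := by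
  rw [FreeGroup.inv_mk]; rfl

theorem orderSign_of_inj {G H : Type*} [Group G] [Group H] (l : LinearOrder G) (l' : LinearOrder H)
    (φ : G →* H) (hφ : Function.Injective φ) (h : ∀ a b, l.lt a b ↔ l'.lt (φ a) (φ b)) (g : G) :
    orderSign l g = orderSign l' (φ g) := by
  unfold orderSign
  have h1 : l.lt g 1 ↔ l'.lt (φ g) 1 := by rw [h]; simp
  have h2 : g = 1 ↔ φ g = 1 := by
    constructor
    · rintro rfl; simp
    · intro h; apply hφ; simpa using h
  simp only [h1, h2]

theorem subst_word {G H : Type*} [Group G] [Group H] {m : ℕ} (π : FreeGroup (Fin m) →* H)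
    (φ : G →* H) (x : ℕ → G) (W : ℕ → List (Fin m × Bool))
    (hW : ∀ n, π (FreeGroup.mk (W n)) = φ (x n)) (v : List (ℕ × Bool)) :
    π (FreeGroup.mk (v.flatMap fun p => cond p.2 (W p.1) (CT.winv (W p.1))))
      = φ (evalWord x v) := by
  induction v with
  | nil => simp [evalWord, ← FreeGroup.one_eq_mk]
  | cons p v ih =>
    rw [List.flatMap_cons, ← FreeGroup.mul_mk, map_mul, ih]
    rcases p with ⟨i, b⟩
    cases b
    · rw [cond_false, mk_winv, map_inv, hW]; simp [evalWord]
    · rw [cond_true, hW]; simp [evalWord]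

theorem comp_subst_word {m : ℕ} (W : ℕ → List (Fin m × Bool)) (hW : Computable W) :
    Computable fun v : List (ℕ × Bool) =>
      v.flatMap fun p => cond p.2 (W p.1) (CT.winv (W p.1)) := by
  have h1 : Computable fun p : List (ℕ × Bool) × (ℕ × Bool) => W p.2.1 :=
    hW.comp (Computable.fst.comp Computable.snd)
  exact CT.list_flatMap (g := fun _ (p : ℕ × Bool) => cond p.2 (W p.1) (CT.winv (W p.1)))
    Computable.id
    (Computable.cond (Computable.snd.comp Computable.snd) h1 (CT.comp_winv h1))

theorem reverse_direction (G : Type) [Group G] (H : Type) [Group H] (m : ℕ)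
    (π : FreeGroup (Fin m) →* H) (φ : G →* H) (hπ : Function.Surjective π)
    (hord : ComputableLeftOrderVia π) (hφ : Function.Injective φ)
    (hmem : DecidableMembership π φ) :
    ∃ x : ℕ → G, Subgroup.closure (Set.range x) = ⊤ ∧ ComputableLeftOrderWrt x := by
  classical
  obtain ⟨l, hl, hc⟩ := hord
  obtain ⟨hd, hmem⟩ := hmem
  let D : ℕ → List (Fin m × Bool) := fun n => (Encodable.decode n).getD []
  have hD : Computable D := Computable.option_getD Computable.decode (Computable.const [])
  let W : ℕ → List (Fin m × Bool) := fun n =>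
    cond (decide (π (FreeGroup.mk (D n)) ∈ φ.range)) (D n) []
  have hW : Computable W := by
    refine Computable.cond ?_ hD (Computable.const [])
    exact (hmem.comp hD).of_eq fun n => by simp
  have hWr : ∀ n, ∃ g, φ g = π (FreeGroup.mk (W n)) := by
    intro n
    by_cases h : π (FreeGroup.mk (D n)) ∈ φ.range
    · obtain ⟨g, hg⟩ := h
      have h' : π (FreeGroup.mk (D n)) ∈ φ.range := ⟨g, hg⟩
      exact ⟨g, by simp only [W, h', decide_true, cond_true, hg]⟩
    · exact ⟨1, by simp only [W, h, decide_false, cond_false, ← FreeGroup.one_eq_mk, map_one]⟩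
  choose x hx using hWr
  refine ⟨x, ?_, ?_⟩
  · rw [eq_top_iff]
    intro g _
    apply Subgroup.subset_closure
    obtain ⟨F, hF⟩ := hπ (φ g)
    refine ⟨Encodable.encode F.toWord, ?_⟩
    apply hφ
    rw [hx]
    simp [W, D, FreeGroup.mk_toWord, hF]
  · refine ⟨@LinearOrder.lift' _ _ l φ hφ, ?_, ?_⟩
    · intro a b c h
      change l.le (φ (a * b)) (φ (a * c))
      rw [map_mul, map_mul]
      exact hl _ _ _ h
    · refine (hc.comp (comp_subst_word W hW)).of_eq fun v => ?_
      rw [subst_word π φ x W (fun n => (hx n).symm)]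
      symm
      apply orderSign_of_inj _ _ φ hφ
      intro a b
      rfl

theorem computable_find {α : Type*} [Primcodable α] {P : α → ℕ → Bool} (hP : Computable₂ P)
    (ex : ∀ a, ∃ n, P a n = true) :
    ∃ F : α → ℕ, Computable F ∧ ∀ a, P a (F a) = true ∧ ∀ k < F a, P a k = false := by
  classical
  refine ⟨fun a => Nat.find (ex a), ?_, fun a => ⟨Nat.find_spec (ex a), fun k hk => ?_⟩⟩
  · have h : Partrec fun a => Nat.rfind fun n => (Part.some (P a n) : Part Bool) :=
      Partrec.rfind hP.partrec₂
    refine h.of_eq fun a => ?_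
    refine Part.eq_some_iff.2 (Nat.mem_rfind.2 ?_)
    refine ⟨by simpa using (Nat.find_spec (ex a)).symm, fun {k} hk => ?_⟩
    have := Nat.find_min (ex a) hk
    simp only [Part.mem_some_iff]
    simpa using this
  · have := Nat.find_min (ex a) hk
    simpa using this

/-- A computable coding of a linear order. -/
structure CO (A : Type*) [LinearOrder A] (C : Type*) [Primcodable C] where
  ev : C → A
  surj : Function.Surjective ev
  ltb : C → C → Bool
  comp : Computable₂ ltb
  spec : ∀ c d, ltb c d = true ↔ ev c < ev d

namespace CO

variable {A C α : Type*} [LinearOrder A] [Primcodable C] [Primcodable α] (K : CO A C)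

def eqb (c d : C) : Bool := !K.ltb c d && !K.ltb d c

def leb (c d : C) : Bool := !K.ltb d c

theorem eqb_iff (c d : C) : K.eqb c d = true ↔ K.ev c = K.ev d := by
  unfold eqb
  rw [Bool.and_eq_true, Bool.not_eq_true', Bool.not_eq_true', ← Bool.not_eq_true,
    ← Bool.not_eq_true, K.spec, K.spec, not_lt, not_lt]
  exact ⟨fun h => le_antisymm h.2 h.1, fun h => ⟨h.ge, h.le⟩⟩

theorem leb_iff (c d : C) : K.leb c d = true ↔ K.ev c ≤ K.ev d := by
  unfold leb
  rw [Bool.not_eq_true', ← Bool.not_eq_true, K.spec, not_lt]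

theorem comp_lt {f g : α → C} (hf : Computable f) (hg : Computable g) :
    Computable fun a => K.ltb (f a) (g a) := K.comp.comp hf hg

theorem comp_eq {f g : α → C} (hf : Computable f) (hg : Computable g) :
    Computable fun a => K.eqb (f a) (g a) :=
  CT.band (CT.bnot (K.comp_lt hf hg)) (CT.bnot (K.comp_lt hg hf))

theorem comp_le {f g : α → C} (hf : Computable f) (hg : Computable g) :
    Computable fun a => K.leb (f a) (g a) := CT.bnot (K.comp_lt hg hf)

end CO

/-- action of a word, from a letter action -/
def actW {m : ℕ} {C : Type*} (act1 : Fin m × Bool → C → C) (w : List (Fin m × Bool)) (c : C) : C :=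
  w.foldr act1 c

theorem comp_actW {α : Type*} [Primcodable α] {m : ℕ} {C : Type*} [Primcodable C]
    {act1 : Fin m × Bool → C → C} (h : Computable₂ act1) {f : α → List (Fin m × Bool)} {g : α → C}
    (hf : Computable f) (hg : Computable g) : Computable fun a => actW act1 (f a) (g a) :=
  CT.list_foldr (h := fun _ (p : (Fin m × Bool) × C) => act1 p.1 p.2) hf hg
    (h.comp (Computable.fst.comp Computable.snd) (Computable.snd.comp Computable.snd))

/-- element of a letter -/
def letr {m : ℕ} {Q : Type*} [Group Q] (gen : Fin m → Q) (p : Fin m × Bool) : Q :=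
  cond p.2 (gen p.1) (gen p.1)⁻¹

theorem lift_mk_cons {m : ℕ} {Q : Type*} [Group Q] (gen : Fin m → Q) (p : Fin m × Bool)
    (w : List (Fin m × Bool)) :
    FreeGroup.lift gen (FreeGroup.mk (p :: w))
      = letr gen p * FreeGroup.lift gen (FreeGroup.mk w) := by
  simp [FreeGroup.lift_mk, letr]

theorem actW_spec {m : ℕ} {A : Type*} [LinearOrder A] {C : Type*} [Primcodable C] (K : CO A C)
    (gen : Fin m → (A ≃o A)) (act1 : Fin m × Bool → C → C)
    (hact : ∀ p c, K.ev (act1 p c) = letr gen p (K.ev c)) (w : List (Fin m × Bool)) (c : C) :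
    K.ev (actW act1 w c) = FreeGroup.lift gen (FreeGroup.mk w) (K.ev c) := by
  induction w with
  | nil => simp [actW]
  | cons p w ih =>
    rw [lift_mk_cons, RelIso.mul_apply, ← ih, ← hact]
    rfl

section GenOrder

variable {A : Type*} [LinearOrder A]

@[reducible]
noncomputable def seqOrder (Q : Subgroup (A ≃o A)) (pt : ℕ → A) (hpt : Function.Surjective pt) :
    LinearOrder Q :=
  LinearOrder.lift' (fun q : Q => (toLex fun n => q.1 (pt n) : Lex (ℕ → A))) (by
    intro p q h
    apply Subtype.ext
    apply RelIso.ext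
    intro a
    obtain ⟨n, rfl⟩ := hpt a
    exact congrFun (toLex.injective h) n)

theorem seqOrder_lt (Q : Subgroup (A ≃o A)) (pt : ℕ → A) (hpt : Function.Surjective pt) (p q : Q) :
    (seqOrder Q pt hpt).lt p q ↔
      ∃ n, (∀ k < n, p.1 (pt k) = q.1 (pt k)) ∧ p.1 (pt n) < q.1 (pt n) := Iff.rfl

theorem seqOrder_left (Q : Subgroup (A ≃o A)) (pt : ℕ → A) (hpt : Function.Surjective pt)
    (a b c : Q) (h : (seqOrder Q pt hpt).le b c) : (seqOrder Q pt hpt).le (a * b) (a * c) := by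
  letI := seqOrder Q pt hpt
  rcases (show b ≤ c from h).eq_or_lt with rfl | h
  · exact le_refl _
  · apply le_of_lt
    obtain ⟨n, h1, h2⟩ := (seqOrder_lt Q pt hpt b c).1 h
    refine (seqOrder_lt Q pt hpt _ _).2 ⟨n, fun k hk => ?_, ?_⟩
    · change a.1 (b.1 _) = a.1 (c.1 _)
      rw [h1 k hk]
    · change a.1 (b.1 _) < a.1 (c.1 _)
      exact a.1.strictMono h2

theorem genOrder {m : ℕ} {C : Type*} [Primcodable C] [Inhabited C] (K : CO A C)
    (gen : Fin m → (A ≃o A)) (act1 : Fin m × Bool → C → C) (hc : Computable₂ act1)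
    (hact : ∀ p c, K.ev (act1 p c) = letr gen p (K.ev c))
    (triv : List (Fin m × Bool) → Bool) (htc : Computable triv)
    (ht : ∀ w, triv w = true ↔ FreeGroup.lift gen (FreeGroup.mk w) = 1) :
    ComputableLeftOrderVia (FreeGroup.lift gen).rangeRestrict := by
  let cd : ℕ → C := fun n => (Encodable.decode n).getD default
  have hcd : Computable cd := Computable.option_getD Computable.decode (Computable.const default)
  have hpt : Function.Surjective fun n => K.ev (cd n) := by
    intro a
    obtain ⟨c, rfl⟩ := K.surj a
    exact ⟨Encodable.encode c, by simp [cd]⟩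
  refine ⟨seqOrder _ (fun n => K.ev (cd n)) hpt, seqOrder_left _ _ hpt, ?_⟩
  have hP : Computable₂ fun (w : List (Fin m × Bool)) (n : ℕ) =>
      triv w || !K.eqb (actW act1 w (cd n)) (cd n) := by
    refine CT.bor (htc.comp Computable.fst) (CT.bnot (K.comp_eq ?_ (hcd.comp Computable.snd)))
    exact comp_actW hc Computable.fst (hcd.comp Computable.snd)
  obtain ⟨F, hF, hF2⟩ := computable_find hP (by
    intro w
    by_cases hw : triv w = true
    · exact ⟨0, by simp [hw]⟩
    · have h1 : FreeGroup.lift gen (FreeGroup.mk w) ≠ 1 := fun h => hw ((ht w).2 h)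
      by_contra hcon
      push Not at hcon
      apply h1
      apply RelIso.ext
      intro a
      obtain ⟨n, rfl⟩ := hpt a
      have := hcon n
      rw [Ne, Bool.or_eq_true, not_or, Bool.not_eq_true', Bool.not_eq_false, K.eqb_iff,
        actW_spec K gen act1 hact] at this
      exact this.2)
  have hres : Computable fun w => cond (triv w) (0 : ℤ)
      (cond (K.ltb (actW act1 w (cd (F w))) (cd (F w))) (-1) 1) := by
    refine Computable.cond htc (Computable.const 0) (Computable.cond (K.comp_lt ?_ (hcd.comp hF))
      (Computable.const _) (Computable.const _))
    exact comp_actW hc Computable.id (hcd.comp hF)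
  refine hres.of_eq fun w => ?_
  set q := (FreeGroup.lift gen).rangeRestrict (FreeGroup.mk w) with hq
  have hqv : q.1 = FreeGroup.lift gen (FreeGroup.mk w) := rfl
  obtain ⟨hF3, hF4⟩ := hF2 w
  unfold orderSign
  by_cases hw : triv w = true
  · have h1 : q = 1 := Subtype.ext ((ht w).1 hw)
    rw [hw, cond_true, h1, if_neg, if_pos rfl]
    exact @lt_irrefl _ (seqOrder _ (fun n => K.ev (cd n)) hpt).toPreorder 1
  · have h1 : q ≠ 1 := fun h => hw ((ht w).2 (by rw [← hqv, h]; rfl))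
    have hw' : triv w = false := by simpa using hw
    rw [hw', cond_false]
    have hlow : ∀ k < F w, q.1 (K.ev (cd k)) = K.ev (cd k) := by
      intro k hk
      have := hF4 k hk
      rw [Bool.or_eq_false_iff, Bool.not_eq_false', K.eqb_iff, actW_spec K gen act1 hact] at this
      exact this.2
    have hne : q.1 (K.ev (cd (F w))) ≠ K.ev (cd (F w)) := by
      intro h
      rw [hw', Bool.false_or, Bool.not_eq_true', ← Bool.not_eq_true, K.eqb_iff,
        actW_spec K gen act1 hact] at hF3
      exact hF3 h
    rw [if_neg h1]
    by_cases hlt : q.1 (K.ev (cd (F w))) < K.ev (cd (F w))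
    · have : K.ltb (actW act1 w (cd (F w))) (cd (F w)) = true := by
        rw [K.spec, actW_spec K gen act1 hact]; exact hlt
      rw [this, cond_true, if_pos]
      exact (seqOrder_lt _ _ hpt q 1).2 ⟨F w, hlow, hlt⟩
    · have : K.ltb (actW act1 w (cd (F w))) (cd (F w)) = false := by
        rw [← Bool.not_eq_true, K.spec, actW_spec K gen act1 hact]; exact hlt
      rw [this, cond_false, if_neg]
      rintro ⟨n, h2, h3⟩
      have h3' : q.1 (K.ev (cd n)) < K.ev (cd n) := h3
      have h2' : ∀ k < n, q.1 (K.ev (cd k)) = K.ev (cd k) := h2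
      rcases lt_trichotomy n (F w) with h | h | h
      · exact h3'.ne (hlow n h)
      · rw [h] at h3'; exact hlt h3'
      · exact hne (h2' _ h)

end GenOrder

namespace CT

theorem int_encode_ofNat (n : ℕ) : Encodable.encode (n : ℤ) = 2 * n := rfl

theorem int_encode_negSucc (n : ℕ) : Encodable.encode (Int.negSucc n) = 2 * n + 1 := rfl

variable {α : Type*} [Primcodable α]

theorem intToNat {f : α → ℤ} (hf : Computable f) : Computable fun a => (f a).toNat := by
  have h1 : Computable fun a => Encodable.encode (f a) := Computable.encode.comp hf
  have h2 : Computable fun a => cond (Encodable.encode (f a)).bodd 0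
      (Encodable.encode (f a)).div2 :=
    Computable.cond (Computable.nat_bodd.comp h1) (Computable.const 0)
      (Computable.nat_div2.comp h1)
  refine h2.of_eq fun a => ?_
  rcases f a with n | n
  · rw [Int.ofNat_eq_natCast, int_encode_ofNat]; simp [Nat.bodd_mul, Nat.div2_val]
  · rw [int_encode_negSucc]; simp [Nat.bodd_mul]

theorem intToNatNeg {f : α → ℤ} (hf : Computable f) : Computable fun a => (-f a).toNat := by
  have h1 : Computable fun a => Encodable.encode (f a) := Computable.encode.comp hf
  have h2 : Computable fun a => cond (Encodable.encode (f a)).bodd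
      ((Encodable.encode (f a)).div2 + 1) 0 :=
    Computable.cond (Computable.nat_bodd.comp h1)
      (Computable.succ.comp (Computable.nat_div2.comp h1)) (Computable.const 0)
  refine h2.of_eq fun a => ?_
  rcases f a with n | n
  · rw [Int.ofNat_eq_natCast, int_encode_ofNat]; simp [Nat.bodd_mul]
  · rw [int_encode_negSucc]; simp [Nat.bodd_mul, Nat.div2_val, Int.neg_negSucc]

theorem natCastSub {f g : α → ℕ} (hf : Computable f) (hg : Computable g) :
    Computable fun a => ((f a : ℤ) - (g a : ℤ)) := by
  have h2 : Computable fun a => cond (decide (g a ≤ f a))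
      (Denumerable.ofNat ℤ (2 * (f a - g a))) (Denumerable.ofNat ℤ (2 * (g a - f a) - 1)) := by
    have hd : Computable (Denumerable.ofNat ℤ) := Computable.ofNat ℤ
    exact Computable.cond (natLe hg hf)
      (hd.comp (natMul (Computable.const 2) (natSub hf hg)))
      (hd.comp (natSub (natMul (Computable.const 2) (natSub hg hf)) (Computable.const 1)))
  refine h2.of_eq fun a => ?_
  by_cases h : g a ≤ f a
  · have h3 : ((f a : ℤ) - (g a : ℤ)) = ((f a - g a : ℕ) : ℤ) := by omega
    rw [h3]
    simp only [h, decide_true, cond_true]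
    rw [← int_encode_ofNat, Denumerable.ofNat_encode]
  · have h3 : ((f a : ℤ) - (g a : ℤ)) = Int.negSucc (g a - f a - 1) := by omega
    rw [h3]
    simp only [h, decide_false, cond_false]
    have h4 : 2 * (g a - f a) - 1 = 2 * (g a - f a - 1) + 1 := by omega
    rw [h4, ← int_encode_negSucc, Denumerable.ofNat_encode]

theorem natCast {f : α → ℕ} (hf : Computable f) : Computable fun a => (f a : ℤ) :=
  (natCastSub hf (Computable.const 0)).of_eq fun a => by simp

theorem intAdd {f g : α → ℤ} (hf : Computable f) (hg : Computable g) :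
    Computable fun a => f a + g a :=
  (natCastSub (natAdd (intToNat hf) (intToNat hg)) (natAdd (intToNatNeg hf) (intToNatNeg hg))).of_eq
    fun a => by push_cast; omega

theorem intSub {f g : α → ℤ} (hf : Computable f) (hg : Computable g) :
    Computable fun a => f a - g a :=
  (natCastSub (natAdd (intToNat hf) (intToNatNeg hg)) (natAdd (intToNatNeg hf) (intToNat hg))).of_eq
    fun a => by push_cast; omega

theorem intNeg {f : α → ℤ} (hf : Computable f) : Computable fun a => -f a :=
  (intSub (Computable.const 0) hf).of_eq fun a => by simp

theorem intLt {f g : α → ℤ} (hf : Computable f) (hg : Computable g) :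
    Computable fun a => decide (f a < g a) :=
  (natLt (natAdd (intToNat hf) (intToNatNeg hg)) (natAdd (intToNatNeg hf) (intToNat hg))).of_eq
    fun a => by
      rw [decide_eq_decide]; omega

theorem intLe {f g : α → ℤ} (hf : Computable f) (hg : Computable g) :
    Computable fun a => decide (f a ≤ g a) :=
  (bnot (intLt hg hf)).of_eq fun a => by
    rw [← decide_not, decide_eq_decide]; exact not_lt

theorem intEq {f g : α → ℤ} (hf : Computable f) (hg : Computable g) :
    Computable fun a => decide (f a = g a) :=
  (Primrec.eq.decide.to_comp).comp hf hg

/-- integers `-n, …, n` -/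
def irange (n : ℕ) : List ℤ := (List.range (2 * n + 1)).map fun k : ℕ => (k : ℤ) - n

theorem mem_irange (n : ℕ) (k : ℤ) : k ∈ irange n ↔ -n ≤ k ∧ k ≤ n := by
  unfold irange
  rw [List.mem_map]
  constructor
  · rintro ⟨a, ha, rfl⟩
    rw [List.mem_range] at ha
    omega
  · intro h
    exact ⟨(k + n).toNat, by rw [List.mem_range]; omega, by omega⟩

theorem comp_irange {f : α → ℕ} (hf : Computable f) : Computable fun a => irange (f a) :=
  list_map (g := fun a (k : ℕ) => (k : ℤ) - (f a : ℤ))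
    (list_range (natAdd (natMul (Computable.const 2) hf) (Computable.const 1)))
    (natCastSub Computable.snd (hf.comp Computable.fst))

end CT

section Tw

variable {B : Type*} [LinearOrder B]

theorem lexZ_le (p q : ℤ ×ₗ B) : p ≤ q ↔
    (ofLex p).1 < (ofLex q).1 ∨ (ofLex p).1 = (ofLex q).1 ∧ (ofLex p).2 ≤ (ofLex q).2 :=
  Prod.Lex.le_iff

/-- twisted shift of `ℤ ×ₗ B` -/
def tw (β : ℤ) (F : ℤ → (B ≃o B)) : (ℤ ×ₗ B) ≃o (ℤ ×ₗ B) where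
  toFun p := toLex ((ofLex p).1 + β, F (ofLex p).1 (ofLex p).2)
  invFun p := toLex ((ofLex p).1 - β, (F ((ofLex p).1 - β)).symm (ofLex p).2)
  left_inv p := by
    rw [← toLex_ofLex p]
    simp
  right_inv p := by
    rw [← toLex_ofLex p]
    simp
  map_rel_iff' := by
    intro p q
    simp only [Equiv.coe_fn_mk, lexZ_le, ofLex_toLex, add_lt_add_iff_right, add_left_inj]
    constructor
    · rintro (h | ⟨h1, h2⟩)
      · exact Or.inl h
      · rw [h1] at h2
        exact Or.inr ⟨h1, by simpa using h2⟩
    · rintro (h | ⟨h1, h2⟩)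
      · exact Or.inl h
      · refine Or.inr ⟨h1, ?_⟩
        rw [h1]
        simpa using h2

theorem tw_apply (β : ℤ) (F : ℤ → (B ≃o B)) (m : ℤ) (b : B) :
    tw β F (toLex (m, b)) = toLex (m + β, F m b) := rfl

theorem tw_mul (β β' : ℤ) (F F' : ℤ → (B ≃o B)) :
    tw β F * tw β' F' = tw (β' + β) (fun m => F (m + β') * F' m) := by
  apply RelIso.ext
  intro p
  obtain ⟨m, b⟩ := p
  change tw β F (tw β' F' (toLex (m, b))) = tw (β' + β) _ (toLex (m, b))
  simp only [tw_apply, add_assoc]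
  rfl

theorem tw_one : tw 0 (fun _ => (1 : B ≃o B)) = 1 := by
  apply RelIso.ext
  intro p
  obtain ⟨m, b⟩ := p
  change tw 0 _ (toLex (m, b)) = toLex (m, b)
  rw [tw_apply]; simp

theorem tw_inv (β : ℤ) (F : ℤ → (B ≃o B)) :
    (tw β F)⁻¹ = tw (-β) (fun m => (F (m - β))⁻¹) := by
  rw [inv_eq_iff_mul_eq_one, tw_mul, ← tw_one]
  congr 1
  · ring
  · funext m
    rw [← sub_eq_add_neg, mul_inv_cancel]

theorem tw_inj {β β' : ℤ} {F F' : ℤ → (B ≃o B)} (h : β = β') (h' : ∀ m, F m = F' m) :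
    tw β F = tw β' F' := by
  subst h
  rw [funext h']

theorem tw_pow_nat (F : ℤ → (B ≃o B)) (n : ℕ) : (tw 0 F) ^ n = tw 0 (fun m => F m ^ n) := by
  induction n with
  | zero => simp [tw_one]
  | succ n ih => rw [pow_succ, ih, tw_mul]; exact tw_inj (by simp) (fun m => by simp [pow_succ])

theorem tw_shift_pow (n : ℕ) : (tw 1 (fun _ => (1 : B ≃o B))) ^ n = tw n (fun _ => 1) := by
  induction n with
  | zero => simp [tw_one]
  | succ n ih => rw [pow_succ, ih, tw_mul]; exact tw_inj (by push_cast; ring) (fun m => by simp)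

end Tw

section StepA

variable {G : Type} [Group G] [LinearOrder G] [MulLeftMono G]

/-- left multiplication as an order automorphism -/
def lmul (k : G) : G ≃o G := OrderIso.mulLeft k

theorem lmul_apply (k g : G) : lmul k g = k * g := rfl

theorem lmul_mul (k k' : G) : lmul (k * k') = lmul k * lmul k' := by
  apply RelIso.ext; intro g; simp [lmul_apply, mul_assoc]

theorem lmul_one : lmul (1 : G) = 1 := by
  apply RelIso.ext; intro g; simp [lmul_apply]

theorem lmul_inv (k : G) : lmul k⁻¹ = (lmul k)⁻¹ := by
  rw [eq_comm, inv_eq_iff_mul_eq_one, ← lmul_mul]; simp [lmul_one]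

theorem lmul_inj {k k' : G} (h : lmul k = lmul k') : k = k' := by
  have := congrArg (fun f : G ≃o G => f 1) h
  simpa [lmul_apply] using this

/-- inner shift with cocycle -/
def ish (δ : ℤ) (h : ℤ → G) : (ℤ ×ₗ G) ≃o (ℤ ×ₗ G) := tw δ (fun j => lmul (h j))

theorem ish_apply (δ : ℤ) (h : ℤ → G) (j : ℤ) (g : G) :
    ish δ h (toLex (j, g)) = toLex (j + δ, h j * g) := rfl

theorem ish_mul (β β' : ℤ) (F F' : ℤ → G) :
    ish β F * ish β' F' = ish (β' + β) (fun m => F (m + β') * F' m) := by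
  unfold ish; rw [tw_mul]; exact tw_inj rfl (fun m => by rw [lmul_mul])

theorem ish_one : ish 0 (fun _ => (1 : G)) = 1 := by
  unfold ish; rw [← tw_one]; exact tw_inj rfl (fun m => lmul_one)

theorem ish_inv (β : ℤ) (F : ℤ → G) : (ish β F)⁻¹ = ish (-β) (fun m => (F (m - β))⁻¹) := by
  unfold ish; rw [tw_inv]; exact tw_inj rfl (fun m => by rw [lmul_inv])

theorem ish_congr {β β' : ℤ} {F F' : ℤ → G} (h : β = β') (h' : ∀ m, F m = F' m) :
    ish β F = ish β' F' := by
  subst h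
  rw [funext h']

theorem ish_one_iff (δ : ℤ) (h : ℤ → G) : ish δ h = 1 ↔ δ = 0 ∧ ∀ j, h j = 1 := by
  constructor
  · intro hh
    have h1 : ∀ j, (toLex (j + δ, h j * 1) : ℤ ×ₗ G) = toLex (j, 1) := fun j => by
      rw [← ish_apply, hh]; rfl
    have h2 : ∀ j, j + δ = j ∧ h j * 1 = 1 := fun j => by
      have := toLex.injective (h1 j)
      simpa using this
    exact ⟨by have := (h2 0).1; omega, fun j => by simpa using (h2 j).2⟩
  · rintro ⟨rfl, h2⟩
    rw [← ish_one]
    exact ish_congr rfl h2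

variable (x : ℕ → G)

def Ai (i : ℕ) : (ℤ ×ₗ G) ≃o (ℤ ×ₗ G) := ish 1 (fun j => if 0 ≤ j then x i else 1)

def isq (m : ℤ) : Prop := 0 ≤ m ∧ (Nat.unpair m.toNat).1 = 0

instance (m : ℤ) : Decidable (isq m) := inferInstanceAs (Decidable (_ ∧ _))

def sqi (m : ℤ) : ℕ := (Nat.unpair m.toNat).2

theorem isq_sq (i : ℕ) : isq ((i : ℤ) ^ 2) ∧ sqi ((i : ℤ) ^ 2) = i := by
  have h : ((i : ℤ) ^ 2).toNat = Nat.pair 0 i := by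
    have : ((i : ℤ) ^ 2) = ((i ^ 2 : ℕ) : ℤ) := by push_cast; rfl
    rw [this, Int.toNat_natCast, Nat.pair]
    split_ifs with h
    · ring
    · have : i = 0 := by omega
      subst this; rfl
  refine ⟨⟨by positivity, ?_⟩, ?_⟩
  · rw [h]; simp
  · rw [sqi, h]; simp

theorem isq_eq (m : ℤ) (h : isq m) : m = (sqi m : ℤ) ^ 2 := by
  obtain ⟨h1, h2⟩ := h
  have h3 : m.toNat = Nat.pair 0 (sqi m) := by
    rw [← Nat.pair_unpair m.toNat, h2]; rfl
  have h4 : Nat.pair 0 (sqi m) = sqi m ^ 2 := by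
    rw [Nat.pair]
    split_ifs with h
    · ring
    · have : sqi m = 0 := by omega
      rw [this]; rfl
  have h5 : m = (m.toNat : ℤ) := by omega
  rw [h5, h3, h4]
  push_cast
  have : sqi ((sqi m : ℤ) ^ 2) = sqi m := (isq_sq (sqi m)).2
  rw [this]

abbrev Lam (G : Type) := ℤ ×ₗ (ℤ ×ₗ G)

/-- layer maps of the three generators, `0 = a`, `1 = b`, `2 = σ` -/
def lay (k : Fin 3) (m : ℤ) : (ℤ ×ₗ G) ≃o (ℤ ×ₗ G) :=
  if k = 0 then (if isq m then Ai x (sqi m) else 1)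
  else if k = 1 then 1 else (if m = 0 then ish 1 (fun _ => 1) else 1)

def lsh (k : Fin 3) : ℤ := if k = 1 then 1 else 0

def genA (k : Fin 3) : Lam G ≃o Lam G := tw (lsh k) (lay x k)

/-- embedding of `G` -/
def psi0 (k : G) : (ℤ ×ₗ G) ≃o (ℤ ×ₗ G) := ish 0 (fun j => if j = 1 then k else 1)

def psi : G →* (Lam G ≃o Lam G) where
  toFun k := tw 0 (fun m => if m = 0 then psi0 k else 1)
  map_one' := by
    refine Eq.trans (tw_inj rfl ?_) tw_one
    intro m
    split_ifs
    · exact (ish_one_iff _ _).2 ⟨rfl, fun j => by simp⟩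
    · rfl
  map_mul' k k' := by
    rw [tw_mul]
    apply tw_inj rfl
    intro m
    simp only [add_zero]
    split_ifs
    · unfold psi0
      rw [ish_mul]
      exact ish_congr rfl (fun j => by simp only [add_zero]; split_ifs <;> simp)
    · simp

theorem psi_def (k : G) : psi k = tw 0 (fun m => if m = 0 then psi0 k else 1) := rfl

theorem psi_apply (k : G) :
    psi k (toLex (0, toLex (1, 1))) = toLex (0, toLex (1, k)) := by
  change tw 0 _ _ = _
  rw [tw_apply]
  simp [psi0, ish_apply]

theorem psi_inj : Function.Injective (psi (G := G)) := by
  intro k k' h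
  have h2 : (toLex (0, toLex (1, k)) : Lam G) = toLex (0, toLex (1, k')) := by
    rw [← psi_apply k, h, psi_apply]
  have h3 := toLex.injective h2
  simp only [Prod.mk.injEq, true_and] at h3
  have h4 := toLex.injective h3
  simpa using h4

theorem Ai_comm (i : ℕ) :
    Ai x i * ish 1 (fun _ => 1) * (Ai x i)⁻¹ * (ish 1 (fun _ => 1))⁻¹ = psi0 (x i) := by
  unfold Ai psi0
  rw [ish_inv, ish_inv, ish_mul, ish_mul, ish_mul]
  apply ish_congr (by ring)
  intro j
  by_cases h1 : j = 1
  · subst h1; simp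
  · rcases lt_or_gt_of_ne h1 with h | h
    · simp [h1, show ¬ (1 ≤ j) by omega, show ¬ (2 ≤ j) by omega]
    · simp [h1, show (1 ≤ j) by omega, show (2 ≤ j) by omega]

theorem psi_comm (i : ℕ) :
    psi (x i) =
      (genA x 1 ^ (i ^ 2))⁻¹ * genA x 0 * genA x 1 ^ (i ^ 2) * genA x 2 *
      ((genA x 1 ^ (i ^ 2))⁻¹ * genA x 0 * genA x 1 ^ (i ^ 2))⁻¹ * (genA x 2)⁻¹ := by
  have hb : genA x 1 = tw 1 (fun _ => 1) := tw_inj (by simp [lsh]) (fun m => by simp [lay])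
  have ha : genA x 0 = tw 0 (lay x 0) := tw_inj (by simp [lsh]) (fun m => rfl)
  have hs : genA x 2 = tw 0 (lay x 2) := tw_inj (by simp [lsh]) (fun m => rfl)
  rw [hb, ha, hs, tw_shift_pow]
  have hc : (tw ((i ^ 2 : ℕ) : ℤ) (fun _ => (1 : (ℤ ×ₗ G) ≃o (ℤ ×ₗ G))))⁻¹ * tw 0 (lay x 0) *
      tw ((i ^ 2 : ℕ) : ℤ) (fun _ => 1) = tw 0 (fun m => lay x 0 (m + (i : ℤ) ^ 2)) := by
    rw [tw_inv, tw_mul, tw_mul]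
    apply tw_inj (by ring)
    intro m
    simp
  rw [hc, tw_inv, tw_inv, tw_mul, tw_mul, tw_mul]
  rw [psi_def]
  refine tw_inj (by simp) ?_
  intro m
  simp only [neg_zero, add_zero, sub_zero]
  split_ifs with h
  · subst h
    have h1 := isq_sq i
    rw [← Ai_comm]
    simp [lay, h1]
  · simp [lay, h]

end StepA

section WordA

variable {G : Type} [Group G] [LinearOrder G] [MulLeftMono G] (x : ℕ → G)

def lb (p : Fin 3 × Bool) : ℤ := cond p.2 (lsh p.1) (-lsh p.1)

def lF (p : Fin 3 × Bool) (m : ℤ) : (ℤ ×ₗ G) ≃o (ℤ ×ₗ G) :=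
  cond p.2 (lay x p.1 m) (lay x p.1 (m - lsh p.1))⁻¹

theorem letr_genA (p : Fin 3 × Bool) : letr (genA x) p = tw (lb p) (lF x p) := by
  obtain ⟨k, b⟩ := p
  cases b
  · simp only [letr, cond_false, genA, tw_inv]; rfl
  · rfl

def bW : List (Fin 3 × Bool) → ℤ
  | [] => 0
  | p :: w => bW w + lb p

def FW : List (Fin 3 × Bool) → ℤ → (ℤ ×ₗ G) ≃o (ℤ ×ₗ G)
  | [] => fun _ => 1
  | p :: w => fun m => lF x p (m + bW w) * FW w m

theorem lift_genA (w : List (Fin 3 × Bool)) :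
    FreeGroup.lift (genA x) (FreeGroup.mk w) = tw (bW w) (FW x w) := by
  induction w with
  | nil => rw [← FreeGroup.one_eq_mk, map_one]; exact tw_one.symm
  | cons p w ih => rw [lift_mk_cons, ih, letr_genA, tw_mul]; rfl

theorem lb_abs (p : Fin 3 × Bool) : |lb p| ≤ 1 := by
  obtain ⟨k, b⟩ := p
  fin_cases k <;> cases b <;> simp [lb, lsh]

theorem bW_abs (w : List (Fin 3 × Bool)) : |bW w| ≤ w.length := by
  induction w with
  | nil => simp [bW]
  | cons p w ih =>
    have := lb_abs p
    simp only [bW, List.length_cons]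
    push_cast
    exact (abs_add_le _ _).trans (by omega)

def Tame (n : ℕ) (f : (ℤ ×ₗ G) ≃o (ℤ ×ₗ G)) : Prop :=
  ∃ (δ : ℤ) (h : ℤ → G), f = ish δ h ∧ |δ| ≤ n ∧ (∀ j < (-n : ℤ), h j = 1) ∧
    ∀ j, (n : ℤ) ≤ j → h j = h n

theorem tame_one (n : ℕ) : Tame n (1 : (ℤ ×ₗ G) ≃o (ℤ ×ₗ G)) :=
  ⟨0, fun _ => 1, ish_one.symm, by simp, by simp, by simp⟩

theorem Tame.mul {n : ℕ} {f g : (ℤ ×ₗ G) ≃o (ℤ ×ₗ G)} (hf : Tame 1 f) (hg : Tame n g) :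
    Tame (n + 1) (f * g) := by
  obtain ⟨δ, h, rfl, h1, h2, h3⟩ := hf
  obtain ⟨δ', h', rfl, h1', h2', h3'⟩ := hg
  refine ⟨_, _, ish_mul _ _ _ _, ?_, ?_, ?_⟩
  · push_cast at h1 ⊢
    exact (abs_add_le _ _).trans (by omega)
  · intro j hj
    rw [abs_le] at h1'
    push_cast at *
    rw [h2 _ (by omega), h2' _ (by omega), one_mul]
  · intro j hj
    rw [abs_le] at h1'
    push_cast at *
    rw [h3 (j + δ') (by omega), h3 (n + 1 + δ') (by omega), h3' j (by omega), h3' (n + 1) (by omega)]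

theorem tame_lF (p : Fin 3 × Bool) (m : ℤ) : Tame 1 (lF x p m) := by
  have hA : ∀ i, Tame 1 (Ai x i) := by
    intro i
    refine ⟨1, _, rfl, by simp, ?_, ?_⟩
    · intro j hj; push_cast at hj; rw [if_neg (by omega)]
    · intro j hj; push_cast at *; simp [show (0 : ℤ) ≤ j by omega, hj]
  have hA' : ∀ i, Tame 1 (Ai x i)⁻¹ := by
    intro i
    refine ⟨-1, _, ish_inv _ _, by simp, ?_, ?_⟩
    · intro j hj; push_cast at hj; rw [if_neg (by omega)]; simp
    · intro j hj; push_cast at *; simp [show (0 : ℤ) ≤ j by omega, hj]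
  have hS : Tame 1 (ish 1 (fun _ => (1 : G))) := ⟨1, _, rfl, by simp, by simp, by simp⟩
  have hS' : Tame 1 (ish 1 (fun _ => (1 : G)))⁻¹ := ⟨-1, _, ish_inv _ _, by simp, by simp, by simp⟩
  have h1 := tame_one (G := G) 1
  have h1' : Tame 1 (1 : (ℤ ×ₗ G) ≃o (ℤ ×ₗ G))⁻¹ := by rw [inv_one]; exact h1
  obtain ⟨k, b⟩ := p
  unfold lF lay
  cases b <;> simp only [cond_true, cond_false] <;> split_ifs <;> first | exact h1 | exact h1' | exact hS | exact hS' | exact hA _ | exact hA' _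

theorem tame_FW (w : List (Fin 3 × Bool)) (m : ℤ) : Tame w.length (FW x w m) := by
  induction w with
  | nil => exact tame_one 0
  | cons p w ih => exact Tame.mul (tame_lF x p _) ih

open Classical in
noncomputable def eW : List (Fin 3 × Bool) → ℤ → ℤ
  | [] => fun _ => 0
  | p :: w => fun c => (if p.1 = 0 ∧ bW w = c then cond p.2 1 (-1) else 0) + eW w c

theorem FW_far (n : ℕ) (m c0 : ℤ) (A : (ℤ ×ₗ G) ≃o (ℤ ×ₗ G)) (hm : ∀ c : ℤ, |c| ≤ n → m + c ≠ 0)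
    (hA : ∀ c : ℤ, |c| ≤ n → lay x 0 (m + c) = if c = c0 then A else 1)
    (w : List (Fin 3 × Bool)) (hw : w.length ≤ n) : FW x w m = A ^ eW w c0 := by
  induction w with
  | nil => simp [FW, eW]
  | cons p w ih =>
    have hl : w.length ≤ n := by simp only [List.length_cons] at hw; omega
    have hb : |bW w| ≤ n := (bW_abs w).trans (by exact_mod_cast hl)
    simp only [FW, eW]
    rw [ih hl, zpow_add]
    congr 1
    obtain ⟨k, b⟩ := p
    fin_cases k
    · simp only [lF, Fin.zero_eta, lsh]
      have := hA _ hb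
      cases b
      · by_cases h : bW w = c0
        · rw [if_pos h, h] at this
          simp [this, h]
        · rw [if_neg h] at this
          simp [this, h]
      · by_cases h : bW w = c0
        · rw [if_pos h, h] at this
          simp [this, h]
        · rw [if_neg h] at this
          simp [this, h]
    · cases b <;> simp [lF, lay]
    · have := hm _ hb
      cases b <;> simp [lF, lay, lsh, this]

theorem Ai_zpow (i : ℕ) (e : ℤ) : ∃ h, Ai x i ^ e = ish e h := by
  induction e with
  | zero => exact ⟨fun _ => 1, by rw [ish_one]; simp⟩
  | succ n ih =>
    obtain ⟨h, hh⟩ := ih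
    exact ⟨_, by rw [add_comm, zpow_add, hh, zpow_one, Ai, ish_mul, add_comm]⟩
  | pred n ih =>
    obtain ⟨h, hh⟩ := ih
    exact ⟨_, by rw [sub_eq_add_neg, add_comm, zpow_add, hh, zpow_neg_one, Ai, ish_inv, ish_mul, add_comm]⟩

def testA (n : ℕ) : Set (Lam G) :=
  {p | ∃ m j : ℤ, |m| ≤ ((n + 1) ^ 2 + n : ℕ) ∧ |j| ≤ (n + 1 : ℕ) ∧ p = toLex (m, toLex (j, 1))}

theorem lay_window (n : ℕ) (m c0 : ℤ) (i : ℕ) (hm : (n : ℤ) ^ 2 ≤ m - n) (hi : m + c0 = (i : ℤ) ^ 2)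
    (hc0 : |c0| ≤ n) (c : ℤ) (hc : |c| ≤ n) :
    lay x 0 (m + c) = if c = c0 then Ai x i else 1 := by
  split_ifs with h
  · subst h
    rw [hi]
    simp [lay, isq_sq i]
  · have : ¬ isq (m + c) := by
      intro hs
      have h1 := isq_eq _ hs
      set i' := sqi (m + c) with hi'
      rw [abs_le] at hc hc0
      have hne : i ≠ i' := by
        rintro hii
        rw [← hii] at h1; omega
      have hn1 : n ≤ i := by
        by_contra hcon
        push Not at hcon
        have : (i : ℤ) < n := by exact_mod_cast hcon
        nlinarith
      have hn2 : n ≤ i' := by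
        by_contra hcon
        push Not at hcon
        have : (i' : ℤ) < n := by exact_mod_cast hcon
        nlinarith
      have hn1' : (n : ℤ) ≤ i := by exact_mod_cast hn1
      have hn2' : (n : ℤ) ≤ i' := by exact_mod_cast hn2
      rcases lt_or_gt_of_ne hne with hlt | hlt
      · have : (i : ℤ) + 1 ≤ i' := by exact_mod_cast hlt
        nlinarith
      · have : (i' : ℤ) + 1 ≤ i := by exact_mod_cast hlt
        nlinarith
    simp [lay, this]

theorem testA_triv (w : List (Fin 3 × Bool))
    (h : ∀ p ∈ testA (G := G) w.length, FreeGroup.lift (genA x) (FreeGroup.mk w) p = p) :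
    FreeGroup.lift (genA x) (FreeGroup.mk w) = 1 := by
  rw [lift_genA] at h ⊢
  set n := w.length with hn
  have h1 : ∀ m j : ℤ, |m| ≤ ((n + 1) ^ 2 + n : ℕ) → |j| ≤ (n + 1 : ℕ) →
      m + bW w = m ∧ FW x w m (toLex (j, 1)) = toLex (j, 1) := by
    intro m j hm hj
    have := h _ ⟨m, j, hm, hj, rfl⟩
    rw [tw_apply] at this
    have := toLex.injective this
    simpa using this
  have hb : bW w = 0 := by
    have := (h1 0 0 (by positivity) (by positivity)).1
    omega
  have hnear : ∀ m : ℤ, |m| ≤ ((n + 1) ^ 2 + n : ℕ) → FW x w m = 1 := by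
    intro m hm
    obtain ⟨δ, hh, he, h2, h3, h4⟩ := tame_FW x w m
    rw [he, ish_one_iff]
    have h5 : ∀ j : ℤ, |j| ≤ (n + 1 : ℕ) → j + δ = j ∧ hh j = 1 := by
      intro j hj
      have := (h1 m j hm hj).2
      rw [he, ish_apply] at this
      have := toLex.injective this
      simpa using this
    refine ⟨by have := (h5 0 (by positivity)).1; omega, fun j => ?_⟩
    rw [← hn] at h3 h4
    rcases lt_or_ge j (-n : ℤ) with hj | hj
    · exact h3 j hj
    · rcases le_or_gt (n : ℤ) j with hj' | hj'
      · rw [h4 j hj']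
        exact (h5 n (by rw [abs_le]; push_cast; omega)).2
      · exact (h5 j (by rw [abs_le]; push_cast; omega)).2
  rw [hb, ← tw_one]
  apply tw_inj rfl
  intro m
  by_cases hm : |m| ≤ ((n + 1) ^ 2 + n : ℕ)
  · exact hnear m hm
  · have hM : 0 ≤ ((n : ℤ) + 1) ^ 2 := by positivity
    have hM2 : (n : ℤ) ^ 2 ≤ ((n : ℤ) + 1) ^ 2 := by nlinarith
    push_cast at hm
    rw [abs_le] at hm
    have hne : ∀ c : ℤ, |c| ≤ n → m + c ≠ 0 := by
      intro c hc h0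
      rw [abs_le] at hc
      apply hm
      constructor <;> linarith [hc.1, hc.2]
    by_cases hsq : ∃ c0 : ℤ, |c0| ≤ n ∧ isq (m + c0)
    · obtain ⟨c0, hc0, hs⟩ := hsq
      have hi := isq_eq _ hs
      have hc0' := abs_le.1 hc0
      have hmpos : (n : ℤ) ^ 2 ≤ m - n := by
        by_contra hcon
        apply hm
        constructor
        · have : 0 ≤ m + c0 := hs.1
          linarith [hc0'.2]
        · linarith
      have key := FW_far x n m c0 _ hne (fun c hc => lay_window x n m c0 _ hmpos hi hc0 c hc) w le_rfl
      have key2 := FW_far x n (((n + 1 : ℕ) : ℤ) ^ 2 - c0) c0 (Ai x (n + 1)) (by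
        intro c hc h0
        rw [abs_le] at hc
        push_cast at h0
        nlinarith [hc.1, hc.2, hc0'.1, hc0'.2]) (fun c hc =>
          lay_window x n _ c0 _ (by push_cast; nlinarith [hc0'.2]) (by ring) hc0 c hc) w le_rfl
      rw [hnear _ (by
        rw [abs_le]; push_cast
        constructor <;> nlinarith [hc0'.1, hc0'.2])] at key2
      obtain ⟨hh, hhe⟩ := Ai_zpow x (n + 1) (eW w c0)
      rw [hhe] at key2
      have := ((ish_one_iff _ _).1 key2.symm).1
      rw [key, this, zpow_zero]
    · push Not at hsq
      have key := FW_far x n m 0 1 hne (fun c hc => by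
        have := hsq c hc
        simp [lay, this]) w le_rfl
      rw [key, one_zpow]

end WordA

section Codes

def coInt : CO ℤ ℤ where
  ev := id
  surj := Function.surjective_id
  ltb a b := decide (a < b)
  comp := CT.intLt Computable.fst Computable.snd
  spec c d := by simp

def coLex {A B C D : Type*} [LinearOrder A] [LinearOrder B] [Primcodable C] [Primcodable D]
    (K : CO A C) (L : CO B D) : CO (A ×ₗ B) (C × D) where
  ev p := toLex (K.ev p.1, L.ev p.2)
  surj := by
    rintro ⟨a, b⟩
    obtain ⟨c, rfl⟩ := K.surj a
    obtain ⟨d, rfl⟩ := L.surj b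
    exact ⟨(c, d), rfl⟩
  ltb p q := K.ltb p.1 q.1 || (K.eqb p.1 q.1 && L.ltb p.2 q.2)
  comp := by
    have h1 : Computable fun p : (C × D) × (C × D) => p.1.1 := Computable.fst.comp Computable.fst
    have h2 : Computable fun p : (C × D) × (C × D) => p.1.2 := Computable.snd.comp Computable.fst
    have h3 : Computable fun p : (C × D) × (C × D) => p.2.1 := Computable.fst.comp Computable.snd
    have h4 : Computable fun p : (C × D) × (C × D) => p.2.2 := Computable.snd.comp Computable.snd
    exact CT.bor (K.comp_lt h1 h3) (CT.band (K.comp_eq h1 h3) (L.comp_lt h2 h4))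
  spec p q := by
    rw [Bool.or_eq_true, Bool.and_eq_true, K.spec, K.eqb_iff, L.spec, Prod.Lex.lt_iff]
    rfl

def coBot {A C : Type*} [LinearOrder A] [Primcodable C] (K : CO A C) :
    CO (WithBot A) (Option C) where
  ev o := o.elim ⊥ (fun c => (K.ev c : WithBot A))
  surj := by
    intro a
    induction a with
    | bot => exact ⟨none, rfl⟩
    | coe a =>
      obtain ⟨c, rfl⟩ := K.surj a
      exact ⟨some c, rfl⟩
  ltb o p := (p.map fun d => (o.map fun c => K.ltb c d).getD true).getD false
  comp := by
    refine Computable.option_getD (Computable.option_map Computable.snd ?_) (Computable.const false)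
    refine Computable.option_getD (Computable.option_map
      (Computable.fst.comp Computable.fst) ?_) (Computable.const true)
    exact K.comp_lt Computable.snd (Computable.snd.comp Computable.fst)
  spec o p := by
    cases o <;> cases p <;> simp [K.spec]

noncomputable def coWord {G ι : Type*} [Group G] [l : LinearOrder G] [MulLeftMono G] [Primcodable ι]
    (ev : List (ι × Bool) → G)
    (hs : Function.Surjective ev) (happ : ∀ v w, ev (v ++ w) = ev v * ev w)
    (hinv : ∀ w, ev (CT.winv w) = (ev w)⁻¹)
    (hc : Computable fun w => orderSign l (ev w)) : CO G (List (ι × Bool)) where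
  ev := ev
  surj := hs
  ltb v w := decide (orderSign l (ev (CT.winv w ++ v)) = -1)
  comp := CT.intEq (hc.comp (Computable.list_append.comp (CT.comp_winv Computable.snd)
      Computable.fst)) (Computable.const _)
  spec v w := by
    rw [decide_eq_true_iff, happ, hinv]
    have : ev v < ev w ↔ (ev w)⁻¹ * ev v < 1 := by
      rw [inv_mul_lt_iff_lt_mul, mul_one]
    rw [this]
    unfold orderSign
    change ((if (ev w)⁻¹ * ev v < 1 then (-1 : ℤ) else _) = -1) ↔ _
    split_ifs with h1 h2
    · simp [h1]
    · simp [h1]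
    · simp [h1]

end Codes

theorem evalWord_surj {G : Type*} [Group G] (x : ℕ → G) (hx : Subgroup.closure (Set.range x) = ⊤) :
    Function.Surjective (evalWord x) := by
  intro g
  have hg : g ∈ Subgroup.closure (Set.range x) := by rw [hx]; trivial
  induction hg using Subgroup.closure_induction with
  | mem y hy =>
    obtain ⟨n, rfl⟩ := hy
    exact ⟨[(n, true)], by simp [evalWord]⟩
  | one => exact ⟨[], by simp [evalWord]⟩
  | mul y z _ _ hy hz =>
    obtain ⟨v, rfl⟩ := hy
    obtain ⟨w, rfl⟩ := hz
    exact ⟨v ++ w, evalWord_append x v w⟩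
  | inv y _ hy =>
    obtain ⟨v, rfl⟩ := hy
    exact ⟨CT.winv v, evalWord_winv x v⟩

abbrev LCode := ℤ × ℤ × List (ℕ × Bool)

def actA (p : Fin 3 × Bool) (c : LCode) : LCode :=
  if p.1 = 0 then
    if isq c.1 then
      cond p.2 (c.1, c.2.1 + 1, if 0 ≤ c.2.1 then (sqi c.1, true) :: c.2.2 else c.2.2)
        (c.1, c.2.1 - 1, if 0 ≤ c.2.1 - 1 then (sqi c.1, false) :: c.2.2 else c.2.2)
    else c
  else if p.1 = 1 then cond p.2 (c.1 + 1, c.2) (c.1 - 1, c.2)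
  else if c.1 = 0 then cond p.2 (c.1, c.2.1 + 1, c.2.2) (c.1, c.2.1 - 1, c.2.2) else c

theorem comp_actA : Computable₂ actA := by
  have p1 : Computable fun q : (Fin 3 × Bool) × LCode => q.1.1 := Computable.fst.comp Computable.fst
  have p2 : Computable fun q : (Fin 3 × Bool) × LCode => q.1.2 := Computable.snd.comp Computable.fst
  have cc : Computable fun q : (Fin 3 × Bool) × LCode => q.2 := Computable.snd
  have c1 : Computable fun q : (Fin 3 × Bool) × LCode => q.2.1 := Computable.fst.comp cc
  have c2 : Computable fun q : (Fin 3 × Bool) × LCode => q.2.2 := Computable.snd.comp cc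
  have c21 : Computable fun q : (Fin 3 × Bool) × LCode => q.2.2.1 := Computable.fst.comp c2
  have c22 : Computable fun q : (Fin 3 × Bool) × LCode => q.2.2.2 := Computable.snd.comp c2
  have un : Computable fun q : (Fin 3 × Bool) × LCode => Nat.unpair q.2.1.toNat :=
    (Primrec.unpair.to_comp).comp (CT.intToNat c1)
  have sq : Computable fun q : (Fin 3 × Bool) × LCode => sqi q.2.1 := Computable.snd.comp un
  have hisq : Computable fun q : (Fin 3 × Bool) × LCode => decide (isq q.2.1) := by
    refine (CT.band (CT.intLe (Computable.const 0) c1)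
      (CT.natEq (Computable.fst.comp un) (Computable.const 0))).of_eq fun q => ?_
    rw [Bool.eq_iff_iff, decide_eq_true_iff]; simp [isq]
  have heq : ∀ k : Fin 3, Computable fun q : (Fin 3 × Bool) × LCode => decide (q.1.1 = k) :=
    fun k => (Primrec.eq.decide.to_comp).comp p1 (Computable.const k)
  have up := CT.intAdd c21 (Computable.const 1)
  have dn := CT.intSub c21 (Computable.const 1)
  refine CT.ite_bool (heq 0) (CT.ite_bool hisq (Computable.cond p2 ?_ ?_) cc)
    (CT.ite_bool (heq 1) (Computable.cond p2 ?_ ?_)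
      (CT.ite_bool (CT.intEq c1 (Computable.const 0)) (Computable.cond p2 ?_ ?_) cc))
  · exact Computable.pair c1 (Computable.pair up (CT.ite_bool (CT.intLe (Computable.const 0) c21)
      (Computable.list_cons.comp (Computable.pair sq (Computable.const true)) c22) c22))
  · exact Computable.pair c1 (Computable.pair dn (CT.ite_bool (CT.intLe (Computable.const 0) dn)
      (Computable.list_cons.comp (Computable.pair sq (Computable.const false)) c22) c22))
  · exact Computable.pair (CT.intAdd c1 (Computable.const 1)) c2
  · exact Computable.pair (CT.intSub c1 (Computable.const 1)) c2
  · exact Computable.pair c1 (Computable.pair up c22)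
  · exact Computable.pair c1 (Computable.pair dn c22)

section

variable {G : Type} [Group G] [LinearOrder G] [MulLeftMono G] (x : ℕ → G)

def evL (c : LCode) : Lam G := toLex (c.1, toLex (c.2.1, evalWord x c.2.2))

theorem actA_spec (p : Fin 3 × Bool) (c : LCode) : evL x (actA p c) = letr (genA x) p (evL x c) := by
  obtain ⟨k, b⟩ := p
  obtain ⟨m, j, v⟩ := c
  have ht : ∀ i, evalWord x ((i, true) :: v) = x i * evalWord x v := fun i => by simp [evalWord]
  have hf : ∀ i, evalWord x ((i, false) :: v) = (x i)⁻¹ * evalWord x v := fun i => by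
    simp [evalWord]
  rw [letr_genA]
  change _ = tw (lb (k, b)) (lF x (k, b)) (toLex (m, toLex (j, evalWord x v)))
  rw [tw_apply]
  fin_cases k
  · by_cases hs : isq m
    · cases b
      · simp only [actA, lb, lF, lsh, lay, Ai, ish_inv, evL]
        by_cases hj : 0 ≤ j - 1
        · simp [hs, ish_apply, hj, hf, sub_eq_add_neg]
          have : 1 ≤ j := by omega
          rw [ish_inv, ish_apply]; simp [this, hf, sub_eq_add_neg]
        · simp [hs, ish_apply, sub_eq_add_neg]
          have : ¬ 1 ≤ j := by omega
          rw [ish_inv, ish_apply]; simp [this, sub_eq_add_neg]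
      · simp only [actA, lb, lF, lsh, lay, Ai, evL]
        by_cases hj : 0 ≤ j
        · simp [hs, ish_apply, hj, ht]
        · simp [hs, ish_apply, hj]
    · cases b <;> simp [actA, lb, lF, lsh, lay, evL, hs]
  · cases b <;> simp [actA, lb, lF, lsh, lay, evL, sub_eq_add_neg]
  · by_cases hm : m = 0
    · cases b <;> simp [actA, lb, lF, lsh, lay, evL, hm, ish_inv, ish_apply, sub_eq_add_neg]
    · cases b <;> simp [actA, lb, lF, lsh, lay, evL, hm]

end

def testListA (n : ℕ) : List LCode :=
  (CT.irange ((n + 1) * (n + 1) + n)).flatMap fun m =>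
    (CT.irange (n + 1)).map fun j => (m, j, [])

theorem comp_testListA : Computable testListA := by
  have hs : Computable fun n : ℕ => n + 1 := Computable.succ
  refine CT.list_flatMap (g := fun n (m : ℤ) =>
    (CT.irange (n + 1)).map fun j => ((m, j, []) : LCode))
    (CT.comp_irange (CT.natAdd (CT.natMul hs hs) Computable.id)) ?_
  refine CT.list_map (g := fun (p : ℕ × ℤ) (j : ℤ) => ((p.2, j, []) : LCode))
    (CT.comp_irange (hs.comp Computable.fst)) ?_
  exact Computable.pair (Computable.snd.comp Computable.fst)
    (Computable.pair Computable.snd (Computable.const []))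

/-- first half of the commutator word of the embedding of `x i` -/
def wordC (i : ℕ) : List (Fin 3 × Bool) :=
  CT.winv (List.replicate (i * i) (1, true)) ++ [(0, true)] ++ List.replicate (i * i) (1, true)

/-- word of the embedding of `x i` -/
def wordA (i : ℕ) : List (Fin 3 × Bool) :=
  wordC i ++ [(2, true)] ++ CT.winv (wordC i) ++ CT.winv [(2, true)]

theorem comp_wordC : Computable wordC := by
  have hr : Computable fun i : ℕ => List.replicate (i * i) ((1, true) : Fin 3 × Bool) :=
    CT.list_replicate (CT.natMul Computable.id Computable.id) (Computable.const _)
  exact Computable.list_append.comp (Computable.list_append.comp (CT.comp_winv hr)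
      (Computable.const _)) hr

theorem comp_wordA : Computable wordA := by
  exact Computable.list_append.comp (Computable.list_append.comp
    (Computable.list_append.comp comp_wordC (Computable.const _)) (CT.comp_winv comp_wordC))
    (Computable.const _)

theorem lift_replicate {m : ℕ} {Q : Type*} [Group Q] (gen : Fin m → Q) (k : Fin m) (n : ℕ) :
    FreeGroup.lift gen (FreeGroup.mk (List.replicate n (k, true))) = gen k ^ n := by
  simp [FreeGroup.lift_mk]

theorem lift_mk_append {m : ℕ} {Q : Type*} [Group Q] (gen : Fin m → Q)
    (v w : List (Fin m × Bool)) : FreeGroup.lift gen (FreeGroup.mk (v ++ w))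
      = FreeGroup.lift gen (FreeGroup.mk v) * FreeGroup.lift gen (FreeGroup.mk w) := by
  rw [← FreeGroup.mul_mk, map_mul]

theorem lift_mk_winv {m : ℕ} {Q : Type*} [Group Q] (gen : Fin m → Q)
    (v : List (Fin m × Bool)) : FreeGroup.lift gen (FreeGroup.mk (CT.winv v))
      = (FreeGroup.lift gen (FreeGroup.mk v))⁻¹ := by
  rw [mk_winv, map_inv]

theorem lift_mk_single {m : ℕ} {Q : Type*} [Group Q] (gen : Fin m → Q) (k : Fin m) :
    FreeGroup.lift gen (FreeGroup.mk [(k, true)]) = gen k := by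
  simp [FreeGroup.lift_mk]

theorem wordA_spec {G : Type} [Group G] [LinearOrder G] [MulLeftMono G] (x : ℕ → G) (i : ℕ) :
    FreeGroup.lift (genA x) (FreeGroup.mk (wordA i)) = psi (x i) := by
  rw [psi_comm]
  simp only [wordA, wordC, lift_mk_append, lift_mk_winv, lift_replicate, lift_mk_single, sq, mul_inv_rev]

theorem stepA (G : Type) [Group G] (x : ℕ → G) (hx : Subgroup.closure (Set.range x) = ⊤)
    (hc : ComputableLeftOrderWrt x) :
    ∃ (Γ : Type) (_ : Group Γ) (γ : Fin 3 → Γ) (ψ : G →* Γ),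
      Function.Surjective (FreeGroup.lift γ) ∧ ComputableLeftOrderVia (FreeGroup.lift γ) ∧
      Function.Injective ψ ∧
      (∃ C : ℕ → List (Fin 3 × Bool), Computable C ∧ ∀ i, ψ (x i) =
        FreeGroup.lift γ (FreeGroup.mk (C i)) * γ 2 * (FreeGroup.lift γ (FreeGroup.mk (C i)))⁻¹ *
          (γ 2)⁻¹) ∧
      ∃ e : List (Fin 3 × Bool) → List (ℕ × Bool), Computable e ∧ ∀ v g,
        FreeGroup.lift γ (FreeGroup.mk v) = ψ g → evalWord x (e v) = g := by
  classical
  obtain ⟨l, hl, hc⟩ := hc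
  letI := l
  haveI : MulLeftMono G := ⟨fun a b c h => hl a b c h⟩
  let KG : CO G (List (ℕ × Bool)) := coWord (evalWord x) (evalWord_surj x hx) (evalWord_append x)
    (evalWord_winv x) hc
  let K : CO (Lam G) LCode := coLex coInt (coLex coInt KG)
  have hact : ∀ p c, K.ev (actA p c) = letr (genA x) p (K.ev c) := actA_spec x
  let triv : List (Fin 3 × Bool) → Bool := fun w =>
    (testListA w.length).all fun c => K.eqb (actW actA w c) c
  have htriv : Computable triv := by
    refine CT.list_all (g := fun (w : List (Fin 3 × Bool)) c => K.eqb (actW actA w c) c)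
      (comp_testListA.comp Computable.list_length) ?_
    exact K.comp_eq (comp_actW comp_actA Computable.fst Computable.snd) Computable.snd
  have ht : ∀ w, triv w = true ↔ FreeGroup.lift (genA x) (FreeGroup.mk w) = 1 := by
    intro w
    rw [List.all_eq_true]
    constructor
    · intro h
      apply testA_triv
      rintro p ⟨m, j, hm, hj, rfl⟩
      have := h (m, j, []) (by
        unfold testListA
        rw [List.mem_flatMap]
        refine ⟨m, ?_, ?_⟩
        · rw [CT.mem_irange]; rw [abs_le] at hm
          rw [← sq]; exact hm
        · rw [List.mem_map]
          refine ⟨j, ?_, rfl⟩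
          rw [CT.mem_irange]; rw [abs_le] at hj; exact hj)
      rw [K.eqb_iff, actW_spec K _ _ hact] at this
      exact this
    · intro h c _
      rw [K.eqb_iff, actW_spec K _ _ hact, h]; rfl
  let γ : Fin 3 → (FreeGroup.lift (genA x)).range := fun i =>
    (FreeGroup.lift (genA x)).rangeRestrict (FreeGroup.of i)
  have hγ : FreeGroup.lift γ = (FreeGroup.lift (genA x)).rangeRestrict := by
    ext i; simp [γ]
  have hψr : ∀ g : G, ∃ w, FreeGroup.lift (genA x) (FreeGroup.mk w) = psi g := by
    intro g
    obtain ⟨v, rfl⟩ := evalWord_surj x hx g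
    exact ⟨_, subst_word (FreeGroup.lift (genA x)) psi x wordA (wordA_spec x) v⟩
  let ψ : G →* (FreeGroup.lift (genA x)).range := psi.codRestrict _ (fun g => by
    obtain ⟨w, hw⟩ := hψr g
    exact ⟨_, hw⟩)
  refine ⟨_, inferInstance, γ, ψ, ?_, ?_, ?_, ?_, ?_⟩
  · rw [hγ]; exact MonoidHom.rangeRestrict_surjective _
  · rw [hγ]
    exact genOrder K (genA x) actA comp_actA hact triv htriv ht
  · intro a b h
    apply psi_inj
    exact congrArg Subtype.val h
  · refine ⟨wordC, comp_wordC, fun i => ?_⟩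
    rw [hγ]
    apply Subtype.ext
    change psi (x i) = _
    rw [← wordA_spec]
    simp only [wordA, lift_mk_append, lift_mk_winv, lift_mk_single, γ]
    simp only [Subgroup.coe_mul, Subgroup.coe_inv, MonoidHom.coe_rangeRestrict,
      FreeGroup.lift_apply_of]
  · refine ⟨fun w => (actW actA w (0, 1, [])).2.2, Computable.snd.comp (Computable.snd.comp
      (comp_actW comp_actA Computable.id (Computable.const _))), fun w g hg => ?_⟩
    rw [hγ] at hg
    have hg' : psi g = FreeGroup.lift (genA x) (FreeGroup.mk w) := (congrArg Subtype.val hg).symm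
    have h1 : K.ev (actW actA w (0, 1, [])) = toLex (0, toLex (1, g)) := by
      rw [actW_spec K _ _ hact, ← hg']
      have : K.ev (0, 1, []) = (toLex (0, toLex (1, 1)) : Lam G) := by
        simp [K, coLex, coInt, KG, coWord, evalWord]
      rw [this, psi_apply]
    have h3 := toLex.injective h1
    have h4 := (Prod.mk.inj h3).2
    have h5 := toLex.injective h4
    exact (Prod.mk.inj h5).2

section Glue

variable {R : Type*} [LinearOrder R]

open Classical in
/-- glue two order automorphisms which agree at `c` -/
noncomputable def glue (c : R) (f g : R ≃o R) (h : f c = g c) : R ≃o R where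
  toFun r := if r ≤ c then f r else g r
  invFun r := if r ≤ f c then f.symm r else g.symm r
  left_inv r := by
    by_cases h1 : r ≤ c
    · simp [h1]
    · have h2 : ¬ g r ≤ f c := by rw [h]; simpa using h1
      simp [h1, h2]
  right_inv r := by
    by_cases h1 : r ≤ f c
    · have h2 : f.symm r ≤ c := by rw [OrderIso.symm_apply_le]; exact h1
      simp [h1, h2]
    · have h2 : ¬ g.symm r ≤ c := by
        rw [OrderIso.symm_apply_le, ← h]; exact h1
      simp [h1, h2]
  map_rel_iff' := by
    intro a b
    change (if a ≤ c then f a else g a) ≤ (if b ≤ c then f b else g b) ↔ a ≤ b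
    by_cases ha : a ≤ c <;> by_cases hb : b ≤ c
    · simp [ha, hb]
    · simp only [ha, hb, if_true, if_false]
      have h1 : f a ≤ f c := f.le_iff_le.2 ha
      have h2 : g c < g b := g.lt_iff_lt.2 (not_le.1 hb)
      constructor
      · intro _; exact ha.trans (not_le.1 hb).le
      · intro _; exact h1.trans (h ▸ h2.le)
    · simp only [ha, hb, if_true, if_false]
      have h1 : f b ≤ f c := f.le_iff_le.2 hb
      have h2 : g c < g a := g.lt_iff_lt.2 (not_le.1 ha)
      constructor
      · intro h3; exact absurd (h2.trans_le (h3.trans h1)) (by rw [h]; exact lt_irrefl _)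
      · intro h3; exact absurd (h3.trans hb) ha
    · simp [ha, hb]

theorem glue_le {c : R} {f g : R ≃o R} (h : f c = g c) {r : R} (hr : r ≤ c) :
    glue c f g h r = f r := by
  change (if r ≤ c then f r else g r) = _
  simp [hr]

theorem glue_ge {c : R} {f g : R ≃o R} (h : f c = g c) {r : R} (hr : c ≤ r) :
    glue c f g h r = g r := by
  change (if r ≤ c then f r else g r) = _
  split_ifs with h1
  · rw [le_antisymm h1 hr, h]
  · rfl

end Glue

section Sup

variable {R : Type*} [LinearOrder R]

theorem aut_mul (f g : R ≃o R) (r : R) : (f * g) r = f (g r) := rfl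

theorem aut_one (r : R) : (1 : R ≃o R) r = r := rfl

theorem aut_inv_eq {f : R ≃o R} {r s : R} : f⁻¹ r = s ↔ r = f s := by
  constructor
  · rintro rfl; exact (RelIso.apply_inv_self f r).symm
  · rintro rfl; exact RelIso.inv_apply_self f s

theorem aut_inv_apply (f : R ≃o R) (r : R) : f (f⁻¹ r) = r := RelIso.apply_inv_self f r

theorem aut_apply_inv (f : R ≃o R) (r : R) : f⁻¹ (f r) = r := RelIso.inv_apply_self f r

theorem aut_le (f : R ≃o R) {r s : R} : f r ≤ f s ↔ r ≤ s := f.le_iff_le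

theorem aut_lt (f : R ≃o R) {r s : R} : f r < f s ↔ r < s := f.lt_iff_lt

/-- `k` is the identity outside the open interval `(a,b)` -/
def Sup (k : R ≃o R) (a b : R) : Prop := ∀ r, r ≤ a ∨ b ≤ r → k r = r

theorem Sup.one (a b : R) : Sup (1 : R ≃o R) a b := fun _ _ => rfl

theorem Sup.mul {k l : R ≃o R} {a b : R} (hk : Sup k a b) (hl : Sup l a b) : Sup (k * l) a b := by
  intro r hr
  rw [aut_mul, hl r hr, hk r hr]

theorem Sup.inv {k : R ≃o R} {a b : R} (hk : Sup k a b) : Sup k⁻¹ a b := by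
  intro r hr
  rw [aut_inv_eq, hk r hr]

theorem Sup.mono {k : R ≃o R} {a b a' b' : R} (hk : Sup k a b) (ha : a' ≤ a) (hb : b ≤ b') :
    Sup k a' b' := fun r hr => hk r (hr.imp (fun h => h.trans ha) (fun h => hb.trans h))

theorem Sup.maps {k : R ≃o R} {a b : R} (hk : Sup k a b) {r : R} (h1 : a ≤ r) (h2 : r ≤ b) :
    a ≤ k r ∧ k r ≤ b := by
  have ha := hk a (Or.inl le_rfl)
  have hb := hk b (Or.inr le_rfl)
  constructor
  · rw [← ha]; exact (aut_le k).2 h1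
  · rw [← hb]; exact (aut_le k).2 h2

theorem Sup.maps' {k : R ≃o R} {a b : R} (hk : Sup k a b) {r : R} (h1 : a ≤ r) (h2 : r < b) :
    a ≤ k r ∧ k r < b := by
  have ha := hk a (Or.inl le_rfl)
  have hb := hk b (Or.inr le_rfl)
  constructor
  · rw [← ha]; exact (aut_le k).2 h1
  · nth_rw 1 [← hb]; exact (aut_lt k).2 h2

/-- conjugation only sees the action on the support -/
theorem conj_eq {k f τ : R ≃o R} {a b : R} (hk : Sup k a b)
    (hf : ∀ r, a ≤ r → r ≤ b → f r = τ r) : f * k * f⁻¹ = τ * k * τ⁻¹ := by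
  have key : ∀ f τ : R ≃o R, (∀ r, a ≤ r → r ≤ b → f r = τ r) → ∀ r, a ≤ r → r ≤ b →
      (f * k * f⁻¹) (f r) = (τ * k * τ⁻¹) (f r) := by
    intro f τ hf r h1 h2
    rw [aut_mul, aut_mul, aut_mul, aut_mul, aut_apply_inv, hf r h1 h2, aut_apply_inv]
    exact hf _ (hk.maps h1 h2).1 (hk.maps h1 h2).2
  apply RelIso.ext
  intro s
  obtain ⟨r, rfl⟩ : ∃ r, f r = s := ⟨f⁻¹ s, aut_inv_apply f s⟩
  by_cases h1 : a ≤ r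
  · by_cases h2 : r ≤ b
    · exact key f τ hf r h1 h2
    · rcases le_or_gt a b with hab | hab
      · have e1 : (f * k * f⁻¹) (f r) = f r := by
          rw [aut_mul, aut_mul, aut_apply_inv, hk r (Or.inr (not_le.1 h2).le)]
        have h3 : b ≤ τ⁻¹ (f r) := by
          have : f b ≤ f r := (aut_le f).2 (not_le.1 h2).le
          rw [hf b hab le_rfl] at this
          rw [← aut_le τ, aut_inv_apply]; exact this
        rw [e1, aut_mul, aut_mul, hk _ (Or.inr h3), aut_inv_apply]
      · rw [aut_mul, aut_mul, aut_mul, aut_mul, hk _ (le_or_gt (f⁻¹ (f r)) a |>.imp id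
          fun h => (hab.trans h).le), hk _ (le_or_gt (τ⁻¹ (f r)) a |>.imp id
          fun h => (hab.trans h).le), aut_inv_apply, aut_inv_apply]
  · have h1 := (not_le.1 h1).le
    rcases le_or_gt a b with hab | hab
    · have e1 : (f * k * f⁻¹) (f r) = f r := by
        rw [aut_mul, aut_mul, aut_apply_inv, hk r (Or.inl h1)]
      have h3 : τ⁻¹ (f r) ≤ a := by
        have : f r ≤ f a := (aut_le f).2 h1
        rw [hf a le_rfl hab] at this
        rw [← aut_le τ, aut_inv_apply]; exact this
      rw [e1, aut_mul, aut_mul, hk _ (Or.inl h3), aut_inv_apply]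
    · rw [aut_mul, aut_mul, aut_mul, aut_mul, hk _ (le_or_gt (f⁻¹ (f r)) a |>.imp id
          fun h => (hab.trans h).le), hk _ (le_or_gt (τ⁻¹ (f r)) a |>.imp id
          fun h => (hab.trans h).le), aut_inv_apply, aut_inv_apply]

theorem conj_id {k f : R ≃o R} {a b : R} (hk : Sup k a b)
    (hf : ∀ r, a ≤ r → r ≤ b → f r = r) : f * k * f⁻¹ = k := by
  rw [conj_eq (τ := 1) hk hf]; simp

theorem Sup.comm {k l : R ≃o R} {a b c d : R} (hk : Sup k a b) (hl : Sup l c d) (h : b ≤ c) :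
    k * l = l * k := by
  have : k * l * k⁻¹ = l := conj_id hl (fun r h1 _ => hk r (Or.inr (h.trans h1)))
  rwa [mul_inv_eq_iff_eq_mul] at this

theorem Sup.conj {k f : R ≃o R} {a b : R} (hk : Sup k a b) : Sup (f * k * f⁻¹) (f a) (f b) := by
  intro r hr
  rw [aut_mul, aut_mul, hk, aut_inv_apply]
  refine hr.imp (fun h => ?_) (fun h => ?_)
  · rw [← aut_le f, aut_inv_apply]; exact h
  · rw [← aut_le f, aut_inv_apply]; exact h

end Sup

section Tr

variable {R : Type*} [AddCommGroup R] [LinearOrder R] [IsOrderedAddMonoid R]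

/-- translation -/
def tr (c : R) : R ≃o R := OrderIso.addRight c

theorem tr_apply (c r : R) : tr c r = r + c := rfl

theorem tr_mul (c d : R) : tr c * tr d = tr (c + d) := by
  apply RelIso.ext; intro r
  rw [aut_mul, tr_apply, tr_apply, tr_apply]; abel

theorem tr_zero : tr (0 : R) = 1 := by
  apply RelIso.ext; intro r
  rw [tr_apply]; simp

theorem tr_inv (c : R) : (tr c)⁻¹ = tr (-c) := by
  rw [inv_eq_iff_mul_eq_one, tr_mul]; simp [tr_zero]

theorem tr_inv_apply (c r : R) : (tr c)⁻¹ r = r - c := by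
  rw [tr_inv, tr_apply]; abel

/-- conjugate by a translation -/
def tcj (c : R) : (R ≃o R) →* (R ≃o R) := (MulAut.conj (tr c)).toMonoidHom

theorem tcj_def (c : R) (k : R ≃o R) : tcj c k = tr c * k * (tr c)⁻¹ := rfl

theorem tcj_apply (c : R) (k : R ≃o R) (r : R) : tcj c k r = k (r - c) + c := by
  rw [tcj_def, aut_mul, aut_mul, tr_inv_apply, tr_apply]

theorem tcj_tcj (c d : R) (k : R ≃o R) : tcj c (tcj d k) = tcj (c + d) k := by
  apply RelIso.ext; intro r
  simp only [tcj_apply]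
  rw [show r - c - d = r - (c + d) by abel]; abel

theorem tcj_zero (k : R ≃o R) : tcj 0 k = k := by
  apply RelIso.ext; intro r
  simp [tcj_apply]

theorem Sup.tcj {k : R ≃o R} {a b : R} (hk : Sup k a b) (c : R) :
    Sup (tcj c k) (a + c) (b + c) := by
  have := hk.conj (f := tr c)
  exact this

end Tr

section Placement

variable {R : Type*} [AddCommGroup R] [LinearOrder R] [IsOrderedAddMonoid R]

def KS (a b : R) : Subgroup (R ≃o R) where
  carrier := {k | Sup k a b}
  one_mem' := Sup.one a b
  mul_mem' h1 h2 := h1.mul h2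
  inv_mem' h := h.inv

theorem mem_KS {a b : R} {k : R ≃o R} : k ∈ KS a b ↔ Sup k a b := Iff.rfl

def inCell (a v : R) (m : ℤ) (r : R) : Prop := a + m • v ≤ r ∧ r < a + m • v + v

theorem inCell_unique {a v : R} (hv : 0 < v) {m n : ℤ} {r : R} (h1 : inCell a v m r)
    (h2 : inCell a v n r) : m = n := by
  have key : ∀ {m n : ℤ}, inCell a v m r → inCell a v n r → ¬ m < n := by
    intro m n h1 h2 h
    have h3 : (m + 1) • v ≤ n • v := zsmul_le_zsmul_left hv.le h
    rw [add_zsmul, one_zsmul] at h3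
    have h4 := h1.2
    have h5 := h2.1
    have : a + m • v + v ≤ a + n • v := by rw [add_assoc]; gcongr
    exact absurd (h4.trans_le (this.trans h5)) (lt_irrefl _)
  exact le_antisymm (not_lt.1 (key h2 h1)) (not_lt.1 (key h1 h2))

theorem inCell_shift {a v : R} {m : ℤ} {r : R} (d : ℤ) :
    inCell a v (m + d) (r + d • v) ↔ inCell a v m r := by
  unfold inCell
  rw [add_zsmul]
  constructor
  · rintro ⟨h1, h2⟩
    constructor
    · have := sub_le_sub_right h1 (d • v)
      simpa [← add_assoc] using this
    · have := sub_lt_sub_right h2 (d • v)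
      rw [add_sub_cancel_right] at this
      refine this.trans_eq ?_
      abel
  · rintro ⟨h1, h2⟩
    constructor
    · rw [← add_assoc]; gcongr
    · have := add_lt_add_left h2 (d • v)
      refine this.trans_eq ?_
      abel

open Classical in
noncomputable def plf (a v : R) (f : ℤ → (R ≃o R)) (r : R) : R :=
  if h : ∃ m, inCell a v m r then tcj (h.choose • v) (f h.choose) r else r

theorem plf_in {a v : R} (hv : 0 < v) (f : ℤ → (R ≃o R)) {m : ℤ} {r : R} (h : inCell a v m r) :
    plf a v f r = tcj (m • v) (f m) r := by
  have h' : ∃ m, inCell a v m r := ⟨m, h⟩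
  rw [plf, dif_pos h', inCell_unique hv h'.choose_spec h]

theorem plf_out {a v : R} (f : ℤ → (R ≃o R)) {r : R} (h : ¬ ∃ m, inCell a v m r) :
    plf a v f r = r := by
  rw [plf, dif_neg h]

theorem inCell_tcj {a v : R} {k : R ≃o R} (hk : Sup k a (a + v)) {m : ℤ} {r : R}
    (h : inCell a v m r) : inCell a v m (tcj (m • v) k r) := by
  have h1 := (hk.tcj (m • v)).maps' h.1 (h.2.trans_eq (by abel))
  exact ⟨h1.1, h1.2.trans_eq (by abel)⟩

theorem plf_mul {a v : R} (hv : 0 < v) (f g : ℤ → (R ≃o R)) (hg : ∀ m, Sup (g m) a (a + v))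
    (r : R) : plf a v (fun m => f m * g m) r = plf a v f (plf a v g r) := by
  by_cases h : ∃ m, inCell a v m r
  · obtain ⟨m, h⟩ := h
    rw [plf_in hv _ h, plf_in hv g h, plf_in hv f (inCell_tcj (hg m) h), map_mul]; rfl
  · rw [plf_out _ h, plf_out _ h, plf_out _ h]

theorem plf_one {a v : R} (r : R) : plf a v (fun _ => 1) r = r := by
  unfold plf
  split_ifs <;> simp [aut_one]

theorem plf_strictMono {a v : R} (hv : 0 < v) (f : ℤ → (R ≃o R)) (hf : ∀ m, Sup (f m) a (a + v)) :
    StrictMono (plf a v f) := by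
  have aux : ∀ {m : ℤ} {x y : R}, inCell a v m x → ¬ inCell a v m y → x < y →
      ∀ z, inCell a v m z → z < y := by
    intro m x y hx hy hxy z hz
    by_contra hzy
    exact hy ⟨hx.1.trans hxy.le, (not_lt.1 hzy).trans_lt hz.2⟩
  have aux' : ∀ {m : ℤ} {x y : R}, inCell a v m x → ¬ inCell a v m y → y < x →
      ∀ z, inCell a v m z → y < z := by
    intro m x y hx hy hxy z hz
    by_contra hzy
    exact hy ⟨hz.1.trans (not_lt.1 hzy), hxy.trans hx.2⟩
  intro r s hrs
  by_cases hr : ∃ m, inCell a v m r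
  · obtain ⟨m, hr⟩ := hr
    by_cases hsm : inCell a v m s
    · rw [plf_in hv f hr, plf_in hv f hsm]
      exact (aut_lt _).2 hrs
    · have h1 := inCell_tcj (hf m) hr
      have h2 := aux hr hsm hrs _ h1
      rw [plf_in hv f hr]
      by_cases hs : ∃ n, inCell a v n s
      · obtain ⟨n, hs⟩ := hs
        have hn : ¬ inCell a v n (tcj (m • v) (f m) r) := by
          intro h3
          exact hsm (inCell_unique hv h3 h1 ▸ hs)
        rw [plf_in hv f hs]
        exact aux' hs hn h2 _ (inCell_tcj (hf n) hs)
      · rw [plf_out f hs]; exact h2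
  · rw [plf_out f hr]
    by_cases hs : ∃ n, inCell a v n s
    · obtain ⟨n, hs⟩ := hs
      rw [plf_in hv f hs]
      exact aux' hs (fun h => hr ⟨n, h⟩) hrs _ (inCell_tcj (hf n) hs)
    · rw [plf_out f hs]; exact hrs

/-- the placement as an order isomorphism -/
noncomputable def PlO (a v : R) (hv : 0 < v) (f : ℤ → (R ≃o R))
    (hf : ∀ m, Sup (f m) a (a + v)) : R ≃o R where
  toFun := plf a v f
  invFun := plf a v fun m => (f m)⁻¹
  left_inv := fun r => by
    rw [← plf_mul hv _ _ hf]
    simp only [inv_mul_cancel, plf_one]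
  right_inv := fun r => by
    rw [← plf_mul hv _ _ (fun m => (hf m).inv)]
    simp only [mul_inv_cancel, plf_one]
  map_rel_iff' := fun {r s} => (plf_strictMono hv f hf).le_iff_le

theorem PlO_apply (a v : R) (hv : 0 < v) (f : ℤ → (R ≃o R))
    (hf : ∀ m, Sup (f m) a (a + v)) (r : R) : PlO a v hv f hf r = plf a v f r := rfl

/-- the placement homomorphism -/
noncomputable def Pl (a v : R) (hv : 0 < v) : (ℤ → KS a (a + v)) →* (R ≃o R) where
  toFun f := PlO a v hv (fun m => (f m).1) (fun m => mem_KS.1 (f m).2)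
  map_one' := by
    apply RelIso.ext; intro r
    rw [PlO_apply]; exact plf_one r
  map_mul' f g := by
    apply RelIso.ext; intro r
    rw [aut_mul, PlO_apply, PlO_apply, PlO_apply]
    exact plf_mul hv _ _ (fun m => (g m).2) r

variable {a v : R} {hv : 0 < v}

theorem Pl_in (f : ℤ → KS a (a + v)) {m : ℤ} {r : R} (h : inCell a v m r) :
    Pl a v hv f r = tcj (m • v) (f m).1 r := by
  rw [← plf_in hv (fun m => (f m).1) h]; rfl

theorem Pl_out (f : ℤ → KS a (a + v)) {r : R} (h : ¬ ∃ m, inCell a v m r) :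
    Pl a v hv f r = r := by
  nth_rw 2 [← plf_out (fun m => (f m).1) h]; rfl

theorem inCell_Pl (f : ℤ → KS a (a + v)) {m : ℤ} {r : R} (h : inCell a v m r) :
    inCell a v m (Pl a v hv f r) := by
  rw [Pl_in f h]; exact inCell_tcj (f m).2 h

/-- pattern: `k` on the cells in `C`, identity elsewhere -/
def pat (C : ℤ → Bool) : KS a (a + v) →* (ℤ → KS a (a + v)) where
  toFun k m := if C m then k else 1
  map_one' := by funext m; simp
  map_mul' k l := by
    funext m
    by_cases h : C m <;> simp [h]

theorem pat_apply (C : ℤ → Bool) (k : KS a (a + v)) (m : ℤ) :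
    pat C k m = if C m then k else 1 := rfl

/-- `k` placed according to the pattern `C` -/
noncomputable def PP (hv : 0 < v) (C : ℤ → Bool) : KS a (a + v) →* (R ≃o R) :=
  (Pl a v hv).comp (pat C)

theorem PP_in (C : ℤ → Bool) (k : KS a (a + v)) {m : ℤ} {r : R} (h : inCell a v m r)
    (hC : C m = true) : PP hv C k r = k.1 (r - m • v) + m • v := by
  rw [PP, MonoidHom.comp_apply, Pl_in _ h, pat_apply, if_pos hC, tcj_apply]

theorem PP_off (C : ℤ → Bool) (k : KS a (a + v)) {m : ℤ} {r : R} (h : inCell a v m r)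
    (hC : C m = false) : PP hv C k r = r := by
  rw [PP, MonoidHom.comp_apply, Pl_in _ h, pat_apply, hC]; simp [aut_one]

theorem PP_out (C : ℤ → Bool) (k : KS a (a + v)) {r : R} (h : ¬ ∃ m, inCell a v m r) :
    PP hv C k r = r := by
  rw [PP, MonoidHom.comp_apply, Pl_out _ h]

theorem inCell_PP (C : ℤ → Bool) (k : KS a (a + v)) {m : ℤ} {r : R} (h : inCell a v m r) :
    inCell a v m (PP hv C k r) := inCell_Pl (hv := hv) _ h

/-- translating by `v` shifts the pattern -/
theorem PP_shift (C : ℤ → Bool) (k : KS a (a + v)) (d : ℤ) :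
    tcj (d • v) (PP hv C k) = PP hv (fun m => C (m - d)) k := by
  apply RelIso.ext; intro r
  rw [tcj_apply]
  by_cases h : ∃ m, inCell a v m r
  · obtain ⟨m, h⟩ := h
    have h' : inCell a v (m - d) (r - d • v) := by
      have := (inCell_shift (a := a) (v := v) (m := m) (r := r) (-d)).2 h
      simpa [sub_eq_add_neg] using this
    cases hC : C (m - d)
    · rw [PP_off _ _ h' hC, PP_off _ _ h hC]; abel
    · rw [PP_in _ _ h' hC, PP_in _ _ h hC, sub_zsmul, ← sub_eq_add_neg]
      rw [show r - d • v - (m • v - d • v) = r - m • v by abel]; abel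
  · have h' : ¬ ∃ m, inCell a v m (r - d • v) := by
      rintro ⟨m, hm⟩
      exact h ⟨m + d, by simpa using (inCell_shift d).2 hm⟩
    rw [PP_out _ _ h, PP_out _ _ h']; abel

/-- a translation of a small element inside the cell -/
theorem PP_tcj (C : ℤ → Bool) (k l : KS a (a + v)) (c : R) (b b' : R)
    (hk : Sup k.1 b b') (hb : a ≤ b) (hb' : b' ≤ a + v) (hc : a ≤ b + c) (hc' : b' + c ≤ a + v)
    (hl : l.1 = tcj c k.1) : PP hv C l = tcj c (PP hv C k) := by
  have hin : ∀ {m : ℤ} {r : R}, b + m • v ≤ r → r < b' + m • v → inCell a v m r := by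
    intro m r h1 h2
    constructor
    · refine le_trans ?_ h1; gcongr
    · refine h2.trans_le ?_
      calc b' + m • v ≤ a + v + m • v := by gcongr
        _ = _ := by abel
  have hin' : ∀ {m : ℤ} {r : R}, b + m • v + c ≤ r → r < b' + m • v + c → inCell a v m r := by
    intro m r h1 h2
    constructor
    · refine le_trans ?_ h1
      calc a + m • v ≤ b + c + m • v := by gcongr
        _ = _ := by abel
    · refine h2.trans_le ?_
      calc b' + m • v + c = b' + c + m • v := by abel
        _ ≤ a + v + m • v := by gcongr
        _ = _ := by abel
  have off1 : ∀ (s : R), (¬ ∃ m : ℤ, C m = true ∧ b + m • v ≤ s ∧ s < b' + m • v) →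
      PP hv C k s = s := by
    intro s hs
    by_cases h : ∃ m, inCell a v m s
    · obtain ⟨m, h⟩ := h
      cases hC : C m
      · exact PP_off _ _ h hC
      · rw [PP_in _ _ h hC, hk, sub_add_cancel]
        by_contra hcon
        push Not at hcon
        exact hs ⟨m, hC, by grind, by grind⟩
    · exact PP_out _ _ h
  have off2 : ∀ (s : R), (¬ ∃ m : ℤ, C m = true ∧ b + m • v + c ≤ s ∧ s < b' + m • v + c) →
      PP hv C l s = s := by
    intro s hs
    by_cases h : ∃ m, inCell a v m s
    · obtain ⟨m, h⟩ := h
      cases hC : C m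
      · exact PP_off _ _ h hC
      · rw [PP_in _ _ h hC, hl, hk.tcj, sub_add_cancel]
        by_contra hcon
        push Not at hcon
        exact hs ⟨m, hC, by grind, by grind⟩
    · exact PP_out _ _ h
  apply RelIso.ext; intro r
  rw [tcj_apply]
  by_cases h : ∃ m : ℤ, C m = true ∧ b + m • v + c ≤ r ∧ r < b' + m • v + c
  · obtain ⟨m, hC, h1, h2⟩ := h
    rw [PP_in _ _ (hin' h1 h2) hC, PP_in C k (hin (m := m) (by grind) (by grind)) hC, hl, tcj_apply,
      show r - m • v - c = r - c - m • v by abel]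
    abel
  · rw [off2 r h, off1, sub_add_cancel]
    rintro ⟨m, hC, h1, h2⟩
    exact h ⟨m, hC, by grind, by grind⟩

end Placement

section Chi

/-- parity of the 2-adic valuation of `3 * n + 1` -/
def chi (n : ℤ) : Bool :=
  (List.range ((3 * n + 1).natAbs + 1)).any fun k =>
    decide (k % 2 = 0) && (decide ((3 * n + 1).natAbs % 2 ^ k = 0) &&
      !decide ((3 * n + 1).natAbs % 2 ^ (k + 1) = 0))

theorem dvd_iff_natAbs_mod (k : ℕ) (x : ℤ) : x.natAbs % 2 ^ k = 0 ↔ (2 : ℤ) ^ k ∣ x := by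
  rw [← Nat.dvd_iff_mod_eq_zero, ← Int.natCast_dvd]
  push_cast; rfl

theorem val_unique {x : ℤ} {k l : ℕ} (h1 : (2 : ℤ) ^ k ∣ x) (h2 : ¬ (2 : ℤ) ^ (k + 1) ∣ x)
    (h3 : (2 : ℤ) ^ l ∣ x) (h4 : ¬ (2 : ℤ) ^ (l + 1) ∣ x) : k = l := by
  by_contra h
  rcases lt_or_gt_of_ne h with h | h
  · exact h2 ((pow_dvd_pow 2 h).trans h3)
  · exact h4 ((pow_dvd_pow 2 h).trans h1)

theorem chi_spec {n : ℤ} {k : ℕ} (h1 : (2 : ℤ) ^ k ∣ 3 * n + 1)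
    (h2 : ¬ (2 : ℤ) ^ (k + 1) ∣ 3 * n + 1) : chi n = decide (k % 2 = 0) := by
  have h0 : 3 * n + 1 ≠ 0 := by omega
  rw [Bool.eq_iff_iff, chi, List.any_eq_true, decide_eq_true_iff]
  constructor
  · rintro ⟨l, _, hl⟩
    simp only [Bool.and_eq_true, Bool.not_eq_true', decide_eq_true_iff, decide_eq_false_iff_not,
      dvd_iff_natAbs_mod] at hl
    rw [val_unique h1 h2 hl.2.1 hl.2.2]; exact hl.1
  · intro h
    refine ⟨k, ?_, ?_⟩
    · rw [List.mem_range]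
      have := Int.natAbs_dvd_natAbs.2 h1
      have h3 := Nat.le_of_dvd (Int.natAbs_pos.2 h0) this
      rw [Int.natAbs_pow] at h3
      have h4 : k < 2 ^ k := Nat.lt_two_pow_self
      change 2 ^ k ≤ _ at h3
      omega
    · simp only [Bool.and_eq_true, Bool.not_eq_true', decide_eq_true_iff, decide_eq_false_iff_not,
        dvd_iff_natAbs_mod]
      exact ⟨h, h1, h2⟩

theorem val_exists (n : ℤ) : ∃ k : ℕ, (2 : ℤ) ^ k ∣ 3 * n + 1 ∧ ¬ (2 : ℤ) ^ (k + 1) ∣ 3 * n + 1 := by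
  classical
  have h0 : 3 * n + 1 ≠ 0 := by omega
  have hex : ∃ k : ℕ, ¬ (2 : ℤ) ^ k ∣ 3 * n + 1 := by
    refine ⟨(3 * n + 1).natAbs, fun h => ?_⟩
    have h3 := Nat.le_of_dvd (Int.natAbs_pos.2 h0) (Int.natAbs_dvd_natAbs.2 h)
    rw [Int.natAbs_pow] at h3
    exact absurd h3 (not_le.2 Nat.lt_two_pow_self)
  obtain ⟨j, hj⟩ : ∃ j, Nat.find hex = j + 1 := by
    apply Nat.exists_eq_succ_of_ne_zero
    intro h
    have := Nat.find_spec hex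
    rw [h] at this; simp at this
  refine ⟨j, ?_, ?_⟩
  · by_contra h
    have := Nat.find_min' hex h
    omega
  · rw [← hj]; exact Nat.find_spec hex

/-- local recurrence of `chi` -/
theorem chi_rec (n : ℤ) : ∃ k : ℕ, ∀ m : ℤ, (2 : ℤ) ^ k ∣ m → chi (n + m) = chi n := by
  obtain ⟨k, h1, h2⟩ := val_exists n
  refine ⟨k + 1, fun m hm => ?_⟩
  have e : 3 * (n + m) + 1 = (3 * n + 1) + 3 * m := by ring
  have hm3 : (2 : ℤ) ^ (k + 1) ∣ 3 * m := Dvd.dvd.mul_left hm 3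
  rw [chi_spec h1 h2, chi_spec (k := k)]
  · rw [e]; exact dvd_add h1 ((pow_dvd_pow 2 (Nat.le_succ k)).trans hm3)
  · rw [e]; intro h; exact h2 ((dvd_add_left hm3).1 h)

def Rk (k : ℕ) (n : ℤ) : Bool := decide ((2 : ℤ) ^ k ∣ 3 * n + 1)

theorem Rk_succ (k : ℕ) (n : ℤ) : Rk (k + 1) n = (Rk k n &&
    (if k % 2 = 0 then !(chi n && chi (n + 2 ^ (k + 1))) else (chi n || chi (n + 2 ^ (k + 1))))) := by
  have e : 3 * (n + 2 ^ (k + 1)) + 1 = (3 * n + 1) + 3 * 2 ^ (k + 1) := by ring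
  have d1 : (2 : ℤ) ^ (k + 1) ∣ 3 * 2 ^ (k + 1) := Dvd.intro_left 3 rfl
  have d2 : ¬ (2 : ℤ) ^ (k + 1 + 1) ∣ 3 * 2 ^ (k + 1) := by
    rw [pow_succ, mul_comm 3]
    intro h
    have := Int.dvd_of_mul_dvd_mul_left (pow_ne_zero _ (by norm_num)) h
    omega
  by_cases hk : (2 : ℤ) ^ k ∣ 3 * n + 1
  · by_cases hk1 : (2 : ℤ) ^ (k + 1) ∣ 3 * n + 1
    · have hR : Rk (k + 1) n = true := by simp [Rk, hk1]
      have hR' : Rk k n = true := by simp [Rk, hk]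
      rw [hR, hR']
      by_cases hk2 : (2 : ℤ) ^ (k + 1 + 1) ∣ 3 * n + 1
      · have h3 : chi (n + 2 ^ (k + 1)) = decide ((k + 1) % 2 = 0) := by
          apply chi_spec
          · rw [e]; exact dvd_add hk1 d1
          · rw [e]; intro h; exact d2 ((dvd_add_right hk2).1 h)
        rw [h3]
        by_cases hp : k % 2 = 0
        · have : ¬ (k + 1) % 2 = 0 := by omega
          simp [hp, this]
        · have : (k + 1) % 2 = 0 := by omega
          simp [hp, this]
      · rw [chi_spec hk1 hk2]
        by_cases hp : k % 2 = 0
        · have : ¬ (k + 1) % 2 = 0 := by omega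
          simp [hp, this]
        · have : (k + 1) % 2 = 0 := by omega
          simp [hp, this]
    · have hR : Rk (k + 1) n = false := by simp [Rk, hk1]
      have h3 : chi (n + 2 ^ (k + 1)) = decide (k % 2 = 0) := by
        apply chi_spec
        · rw [e]; exact dvd_add hk ((pow_dvd_pow 2 (Nat.le_succ k)).trans d1)
        · rw [e]; intro h; exact hk1 ((dvd_add_left d1).1 h)
      rw [hR, chi_spec hk hk1, h3]
      by_cases hp : k % 2 = 0 <;> simp [hp]
  · have hR : Rk k n = false := by simp [Rk, hk]
    have hR' : Rk (k + 1) n = false := by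
      simp only [Rk, decide_eq_false_iff_not]
      exact fun h => hk ((pow_dvd_pow 2 (Nat.le_succ k)).trans h)
    rw [hR, hR']; simp

/-- residue class of `c` -/
def cls (k : ℕ) (c n : ℤ) : Bool := decide ((2 : ℤ) ^ k ∣ n - c)

theorem cls_Rk (k : ℕ) (c : ℤ) : ∃ d, ∀ n, cls k c n = Rk k (n - d) := by
  have hco : IsCoprime ((2 : ℤ) ^ k) 3 := by
    apply IsCoprime.pow_left
    exact ⟨-1, 1, by norm_num⟩
  obtain ⟨p, q, h⟩ := hco
  refine ⟨c + q, fun n => ?_⟩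
  rw [Bool.eq_iff_iff, cls, Rk, decide_eq_true_iff, decide_eq_true_iff]
  have : 3 * (n - (c + q)) + 1 = 3 * (n - c) + p * 2 ^ k := by linarith
  rw [this, Int.dvd_add_mul_self]
  constructor
  · intro h; exact Dvd.dvd.mul_left h 3
  · intro h2
    have hco : IsCoprime ((2 : ℤ) ^ k) 3 := ⟨p, q, h⟩
    exact hco.dvd_of_dvd_mul_left h2

theorem cls_split (k : ℕ) (c n : ℤ) :
    cls k c n = (cls (k + 1) c n || cls (k + 1) (c + 2 ^ k) n) ∧
    (cls (k + 1) c n && cls (k + 1) (c + 2 ^ k) n) = false := by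
  have hpos : (2 : ℤ) ^ k ≠ 0 := pow_ne_zero _ (by norm_num)
  have e1 : ∀ x : ℤ, (2 : ℤ) ^ (k + 1) ∣ 2 ^ k * x ↔ 2 ∣ x := by
    intro x; rw [pow_succ]; exact mul_dvd_mul_iff_left hpos
  by_cases h : (2 : ℤ) ^ k ∣ n - c
  · obtain ⟨x, hx⟩ := h
    have h2 : n - (c + 2 ^ k) = 2 ^ k * (x - 1) := by linear_combination hx
    simp only [cls]
    rw [hx, h2]
    simp only [e1]
    have h3 : (2 : ℤ) ^ k ∣ 2 ^ k * x := Dvd.intro x rfl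
    simp only [h3, decide_true]
    rcases Int.emod_two_eq_zero_or_one x with hp | hp
    · have q1 : (2 : ℤ) ∣ x := by omega
      have q2 : ¬ (2 : ℤ) ∣ x - 1 := by omega
      simp [q1, q2]
    · have q1 : ¬ (2 : ℤ) ∣ x := by omega
      have q2 : (2 : ℤ) ∣ x - 1 := by omega
      simp [q1, q2]
  · have h1 : ¬ (2 : ℤ) ^ (k + 1) ∣ n - c := fun h' => h ((pow_dvd_pow 2 (Nat.le_succ k)).trans h')
    have h2 : ¬ (2 : ℤ) ^ (k + 1) ∣ n - (c + 2 ^ k) := fun h' => h (by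
      have := dvd_add ((pow_dvd_pow 2 (Nat.le_succ k)).trans h') (dvd_refl ((2 : ℤ) ^ k))
      rwa [show n - (c + 2 ^ k) + 2 ^ k = n - c by ring] at this)
    simp [cls, h, h1, h2]

/-- every window pattern occurs in a bounded range -/
theorem chi_window (ρ : ℕ) (n : ℤ) : ∃ n' : ℤ, 0 ≤ n' ∧ n' < 2 ^ (2 * ρ + 3) ∧
    ∀ i : ℤ, |i| ≤ ρ → chi (n' + i) = chi (n + i) := by
  set k := 2 * ρ + 1 with hk
  have hkpos : (0 : ℤ) < 2 ^ k := by positivity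
  have hbig : (2 * ρ + 1 : ℤ) < 2 ^ k := by
    have : k < 2 ^ k := Nat.lt_two_pow_self
    zify at this
    rw [hk] at this ⊢; push_cast at this; exact this
  -- congruent indices with small valuation have equal chi
  have small : ∀ x y : ℤ, (2 : ℤ) ^ k ∣ y - x → ¬ (2 : ℤ) ^ k ∣ 3 * x + 1 → chi y = chi x := by
    intro x y hxy hx
    obtain ⟨l, h1, h2⟩ := val_exists x
    have hl : l + 1 ≤ k := by
      by_contra h
      exact hx ((pow_dvd_pow 2 (by omega)).trans h1)
    have e : 3 * y + 1 = (3 * x + 1) + 3 * (y - x) := by ring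
    have d : (2 : ℤ) ^ (l + 1) ∣ 3 * (y - x) :=
      Dvd.dvd.mul_left ((pow_dvd_pow 2 hl).trans hxy) 3
    rw [chi_spec h1 h2, chi_spec (k := l)]
    · rw [e]; exact dvd_add h1 ((pow_dvd_pow 2 (Nat.le_succ l)).trans d)
    · rw [e]; intro h; exact h2 ((dvd_add_left d).1 h)
  have hpow : (2 : ℤ) ^ (2 * ρ + 3) = 4 * 2 ^ k := by rw [hk]; ring
  by_cases hsp : ∃ i : ℤ, |i| ≤ ρ ∧ (2 : ℤ) ^ k ∣ 3 * (n + i) + 1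
  · obtain ⟨i, hi, M, hM⟩ := hsp
    -- choose the parity wanted
    have hc : ∃ c : ℤ, ((2 : ℤ) ^ k ∣ 3 * (n + 2 ^ k * c + i) + 1) ∧
        chi (n + 2 ^ k * c + i) = chi (n + i) := by
      exact ⟨0, by rw [mul_zero, add_zero]; exact ⟨M, hM⟩, by simp⟩
    have hred : ∃ c : ℤ, (M + 3 * c) % 4 = (if chi (n + i) = decide (k % 2 = 0) then 1 else 2) ∧
        0 ≤ n % 2 ^ k + 2 ^ k * (c + n / 2 ^ k) ∧
        n % 2 ^ k + 2 ^ k * (c + n / 2 ^ k) < 2 ^ (2 * ρ + 3) := by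
      set t : ℤ := if chi (n + i) = decide (k % 2 = 0) then 1 else 2 with ht
      have ht4 : t = 1 ∨ t = 2 := by rw [ht]; split_ifs <;> simp
      -- c + n/2^k =: b in [0,4), M + 3(b - n/2^k) = t mod 4
      refine ⟨(M - 3 * (n / 2 ^ k) - t) % 4 - n / 2 ^ k, ?_, ?_, ?_⟩
      · omega
      · have h1 := Int.emod_nonneg n hkpos.ne'
        have h2 := Int.emod_nonneg (M - 3 * (n / 2 ^ k) - t) (show (4 : ℤ) ≠ 0 by norm_num)
        rw [sub_add_cancel]
        positivity
      · have h1 := Int.emod_lt_of_pos n hkpos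
        have h2 : (M - 3 * (n / 2 ^ k) - t) % 4 ≤ 3 := by omega
        rw [sub_add_cancel, hpow]
        nlinarith
    obtain ⟨c, hc1, hc2, hc3⟩ := hred
    have hn' : n % 2 ^ k + 2 ^ k * (c + n / 2 ^ k) = n + 2 ^ k * c := by
      have := Int.emod_add_mul_ediv n (2 ^ k)
      linear_combination this
    rw [hn'] at hc2 hc3
    refine ⟨n + 2 ^ k * c, hc2, hc3, fun j hj => ?_⟩
    by_cases hji : j = i
    · subst hji
      have e : 3 * (n + 2 ^ k * c + j) + 1 = 2 ^ k * (M + 3 * c) := by linear_combination hM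
      have dv : ∀ l : ℕ, ∀ x : ℤ, (2 : ℤ) ^ (k + l) ∣ 2 ^ k * x ↔ 2 ^ l ∣ x := by
        intro l x; rw [pow_add]; exact mul_dvd_mul_iff_left hkpos.ne'
      by_cases hch : chi (n + j) = decide (k % 2 = 0)
      · rw [if_pos hch] at hc1
        rw [hch]
        apply chi_spec
        · rw [e]; exact Dvd.intro _ rfl
        · rw [e, dv 1]; omega
      · rw [if_neg hch] at hc1
        have h3 : chi (n + 2 ^ k * c + j) = decide ((k + 1) % 2 = 0) := by
          apply chi_spec
          · rw [e, dv 1]; omega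
          · rw [e, add_assoc, dv 2]; norm_num; omega
        rw [h3]
        by_cases hp : k % 2 = 0
        · have : ¬ (k + 1) % 2 = 0 := by omega
          simp only [hp, this, decide_true, decide_false] at hch ⊢
          simpa using hch
        · have : (k + 1) % 2 = 0 := by omega
          simp only [hp, this, decide_true, decide_false] at hch ⊢
          simpa using hch
    · apply small
      · exact ⟨c, by ring⟩
      · intro hd
        have h1 : (2 : ℤ) ^ k ∣ 3 * (j - i) := by
          have := dvd_sub hd (⟨M, hM⟩ : (2 : ℤ) ^ k ∣ 3 * (n + i) + 1)
          have e : 3 * (n + j) + 1 - (3 * (n + i) + 1) = 3 * (j - i) := by ring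
          rwa [e] at this
        have hco : IsCoprime ((2 : ℤ) ^ k) 3 := by
          apply IsCoprime.pow_left
          exact ⟨-1, 1, by norm_num⟩
        have h2 := hco.dvd_of_dvd_mul_left h1
        have h3 : |j - i| < 2 ^ k := by
          rw [abs_le] at hi hj
          rw [abs_lt]
          constructor <;> linarith
        have := Int.eq_zero_of_abs_lt_dvd h2 h3
        omega
  · push Not at hsp
    refine ⟨n % 2 ^ k, Int.emod_nonneg n hkpos.ne', ?_, fun j hj => ?_⟩
    · have := Int.emod_lt_of_pos n hkpos
      rw [hpow]; linarith
    · apply small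
      · have := Int.emod_add_mul_ediv n (2 ^ k)
        exact ⟨-(n / 2 ^ k), by linear_combination this⟩
      · exact hsp j hj

end Chi

section Core

variable {R : Type*} [AddCommGroup R] [LinearOrder R] [IsOrderedAddMonoid R] {J : Type*}

/-- left end of the base cell -/
def la (u : R) : R := (-10 : ℤ) • u
/-- length of the cells -/
def lv (u : R) : R := (310 : ℤ) • u

theorem la_lv (u : R) : la u + lv u = (300 : ℤ) • u := by
  unfold la lv; rw [← add_zsmul]; norm_num

theorem lv_pos {u : R} (hu : 0 < u) : 0 < lv u := zsmul_pos hu (by norm_num)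

theorem zsm_le {u : R} (hu : 0 < u) {m n : ℤ} (h : m ≤ n) : m • u ≤ n • u :=
  zsmul_le_zsmul_left hu.le h

theorem zsm_lt {u : R} (hu : 0 < u) {m n : ℤ} (h : m < n) : m • u < n • u :=
  zsmul_lt_zsmul_left hu h

/-- the group of elements placed in a cell -/
abbrev KC (u : R) : Subgroup (R ≃o R) := KS (la u) (la u + lv u)

/-- elements generated by translates with support in a window -/
def At (u : R) (xt : J → (R ≃o R)) (A B : ℤ) : Subgroup (R ≃o R) :=
  Subgroup.closure {k | ∃ (o : ℤ) (j : J), A ≤ o ∧ o + 29 ≤ B ∧ k = tcj (o • u) (xt j)}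

structure Core (u : R) (xt : J → (R ≃o R)) : Prop where
  hu : 0 < u
  sup : ∀ j, Sup (xt j) 0 ((29 : ℤ) • u)
  perf : ∀ j, ∃ α ∈ At u xt (-1) 100, ∃ β ∈ At u xt (-1) 100, xt j = α * β * α⁻¹ * β⁻¹
  shift : ∃ s ∈ At u xt (-1) 100, ∀ r, 0 ≤ r → r ≤ (29 : ℤ) • u → s r = r + u
  contr : ∀ r, (∃ m, inCell (la u) (lv u) m r) → ∃ i : ℤ, ∀ q, r < q →
    ∃ c ∈ At u xt (-10) 300, ∀ x, (-1 : ℤ) • u ≤ x → x ≤ (100 : ℤ) • u →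
      r < c x + i • u ∧ c x + i • u < q
  ne : ∃ j, xt j ≠ 1

variable {u : R} {xt : J → (R ≃o R)}

theorem Core.hv (hC : Core u xt) : 0 < lv u := lv_pos hC.hu

theorem Core.At_sup (hC : Core u xt) {A B : ℤ} {k : R ≃o R} (h : k ∈ At u xt A B) : Sup k (A • u) (B • u) := by
  have : At u xt A B ≤ KS (A • u) (B • u) := by
    rw [At, Subgroup.closure_le]
    rintro _ ⟨o, j, h1, h2, rfl⟩
    refine ((hC.sup j).tcj (o • u)).mono ?_ ?_
    · rw [zero_add]; exact zsm_le hC.hu h1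
    · rw [← add_zsmul]; exact zsm_le hC.hu (by omega)
  exact this h

theorem Core.xt_KC (hC : Core u xt) (j : J) : xt j ∈ KC u := by
  refine (hC.sup j).mono ?_ ?_
  · have h : ((-10 : ℤ)) • u ≤ (0 : ℤ) • u := zsm_le hC.hu (by norm_num)
    rw [zero_zsmul] at h
    exact h
  · rw [la_lv]; exact zsm_le hC.hu (by norm_num)

theorem Core.At_KC (hC : Core u xt) {A B : ℤ} (hA : -10 ≤ A) (hB : B ≤ 300) {k : R ≃o R} (h : k ∈ At u xt A B) :
    k ∈ KC u :=
  (hC.At_sup h).mono (zsm_le hC.hu hA) (by rw [la_lv]; exact zsm_le hC.hu hB)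

/-- the `j`-th element as an element of the cell group -/
def Core.xk (hC : Core u xt) (j : J) : KC u := ⟨xt j, hC.xt_KC j⟩

/-- a generator -/
noncomputable def Core.hg (hC : Core u xt) (p : Fin 310 × J × Bool) : R ≃o R :=
  tcj ((p.1 : ℤ) • u) (PP hC.hv (if p.2.2 then chi else fun _ => true) (hC.xk p.2.1))

def Core.Hs (hC : Core u xt) : Subgroup (R ≃o R) := Subgroup.closure (Set.range hC.hg)

def Core.Good (hC : Core u xt) (N : Subgroup (R ≃o R)) (C : ℤ → Bool) : Prop :=
  ∀ j, ∀ i : ℤ, tcj (i • u) (PP hC.hv C (hC.xk j)) ∈ N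

theorem Core.good_At (hC : Core u xt) {N : Subgroup (R ≃o R)} {C : ℤ → Bool} (h : hC.Good N C) {A B : ℤ}
    (hA : -10 ≤ A) (hB : B ≤ 300) {k : R ≃o R} (hk : k ∈ At u xt A B) (i : ℤ) :
    ∀ hk' : k ∈ KC u, tcj (i • u) (PP hC.hv C ⟨k, hk'⟩) ∈ N := by
  have key : At u xt A B ≤
      (N.comap ((tcj (i • u)).comp (PP hC.hv C))).map (KC u).subtype := by
    rw [At, Subgroup.closure_le]
    rintro _ ⟨o, j, h1, h2, rfl⟩
    have hmem : tcj (o • u) (xt j) ∈ At u xt A B := Subgroup.subset_closure ⟨o, j, h1, h2, rfl⟩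
    refine ⟨⟨_, hC.At_KC hA hB hmem⟩, ?_, rfl⟩
    change tcj (i • u) (PP hC.hv C _) ∈ N
    rw [PP_tcj C (hC.xk j) _ (o • u) 0 ((29 : ℤ) • u) (hC.sup j) _ _ _ _ rfl, tcj_tcj, ← add_zsmul]
    · exact h j _
    · exact (zsm_le hC.hu (by norm_num : (-10 : ℤ) ≤ 0)).trans_eq (zero_zsmul u)
    · rw [la_lv]; exact zsm_le hC.hu (by norm_num)
    · rw [zero_add]; exact zsm_le hC.hu (by omega)
    · rw [la_lv, ← add_zsmul]; exact zsm_le hC.hu (by omega)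
  intro hk'
  obtain ⟨k', h1, h2⟩ := key hk
  have : k' = ⟨k, hk'⟩ := Subtype.ext h2
  rw [← this]; exact h1

theorem Core.PP_comm (hC : Core u xt) (C D : ℤ → Bool) (k l : KC u) :
    PP hC.hv C k * PP hC.hv D l * (PP hC.hv C k)⁻¹ * (PP hC.hv D l)⁻¹ =
      PP hC.hv (fun n => C n && D n) (k * l * k⁻¹ * l⁻¹) := by
  simp only [PP, MonoidHom.comp_apply, ← map_mul, ← map_inv]
  congr 1
  funext m
  simp only [pat_apply, Pi.mul_apply, Pi.inv_apply]
  cases C m <;> cases D m <;> simp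

theorem Core.PP_conj (hC : Core u xt) (D : ℤ → Bool) (k l : KC u) :
    PP hC.hv (fun _ => true) k * PP hC.hv D l * (PP hC.hv (fun _ => true) k)⁻¹ =
      PP hC.hv D (k * l * k⁻¹) := by
  simp only [PP, MonoidHom.comp_apply, ← map_mul, ← map_inv]
  congr 1
  funext m
  simp only [pat_apply, Pi.mul_apply, Pi.inv_apply]
  cases D m <;> simp

theorem Core.PP_union (hC : Core u xt) (C D : ℤ → Bool) (h : ∀ n, (C n && D n) = false) (k : KC u) :
    PP hC.hv C k * PP hC.hv D k = PP hC.hv (fun n => C n || D n) k := by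
  simp only [PP, MonoidHom.comp_apply, ← map_mul]
  congr 1
  funext m
  have := h m
  simp only [pat_apply, Pi.mul_apply]
  cases hc : C m <;> cases hd : D m <;> simp_all

theorem Core.PP_compl (hC : Core u xt) (C : ℤ → Bool) (k : KC u) :
    PP hC.hv (fun _ => true) k * (PP hC.hv C k)⁻¹ = PP hC.hv (fun n => !C n) k := by
  simp only [PP, MonoidHom.comp_apply, ← map_mul, ← map_inv]
  congr 1
  funext m
  simp only [pat_apply, Pi.mul_apply, Pi.inv_apply]
  cases C m <;> simp

theorem Core.good_univ_of (hC : Core u xt) (N : Subgroup (R ≃o R))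
    (h : ∀ j, ∀ i : Fin 310, tcj ((i : ℤ) • u) (PP hC.hv (fun _ => true) (hC.xk j)) ∈ N) :
    hC.Good N (fun _ => true) := by
  intro j i
  have hi : i • u = ((i % 310 : ℤ)) • u + (i / 310 : ℤ) • lv u := by
    unfold lv
    rw [smul_smul, ← add_zsmul]
    congr 1; omega
  rw [hi, ← tcj_tcj, PP_shift]
  have := h j ⟨(i % 310).toNat, by omega⟩
  have e : (((⟨(i % 310).toNat, by omega⟩ : Fin 310) : ℕ) : ℤ) = i % 310 := by
    simp only; omega
  rwa [e] at this

theorem Core.good_inter (hC : Core u xt) {H N : Subgroup (R ≃o R)}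
    (hn : ∀ h ∈ H, ∀ n ∈ N, h * n * h⁻¹ ∈ N) {C D : ℤ → Bool} (h1 : hC.Good H C)
    (h2 : hC.Good N D) : hC.Good N (fun n => C n && D n) := by
  intro j i
  obtain ⟨α, hα, β, hβ, e⟩ := hC.perf j
  have hα' := hC.At_KC (by norm_num) (by norm_num) hα
  have hβ' := hC.At_KC (by norm_num) (by norm_num) hβ
  have e' : hC.xk j = ⟨α, hα'⟩ * ⟨β, hβ'⟩ * ⟨α, hα'⟩⁻¹ * ⟨β, hβ'⟩⁻¹ := Subtype.ext e
  rw [e', ← hC.PP_comm]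
  have a1 := hC.good_At h1 (by norm_num) (by norm_num) hα i hα'
  have a2 := hC.good_At h2 (by norm_num) (by norm_num) hβ i hβ'
  rw [map_mul, map_mul, map_mul, map_inv, map_inv]
  exact N.mul_mem (hn _ a1 _ a2) (N.inv_mem a2)

/-- from one translate to all translates -/
theorem Core.good_all (hC : Core u xt) {H N : Subgroup (R ≃o R)}
    (hn : ∀ h ∈ H, ∀ n ∈ N, h * n * h⁻¹ ∈ N) (hu' : hC.Good H (fun _ => true)) {C : ℤ → Bool}
    (i₀ : ℤ) (h : ∀ j, tcj (i₀ • u) (PP hC.hv C (hC.xk j)) ∈ N) : hC.Good N C := by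
  obtain ⟨s, hs, hs'⟩ := hC.shift
  have hsK := hC.At_KC (by norm_num) (by norm_num) hs
  intro j
  -- conjugation moves the translate by one
  have key : ∀ i : ℤ, tcj ((i + 1) • u) (PP hC.hv C (hC.xk j)) =
      tcj (i • u) (PP hC.hv (fun _ => true) ⟨s, hsK⟩) * tcj (i • u) (PP hC.hv C (hC.xk j)) *
      (tcj (i • u) (PP hC.hv (fun _ => true) ⟨s, hsK⟩))⁻¹ := by
    intro i
    rw [← map_inv, ← map_mul, ← map_mul, hC.PP_conj, add_zsmul, one_zsmul, ← tcj_tcj]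
    congr 1
    symm
    apply PP_tcj C _ _ u 0 ((29 : ℤ) • u) (hC.sup j)
    · exact (zsm_le hC.hu (by norm_num : (-10 : ℤ) ≤ 0)).trans_eq (zero_zsmul u)
    · rw [la_lv]; exact zsm_le hC.hu (by norm_num)
    · rw [zero_add]; exact (zsm_le hC.hu (by norm_num : (-10 : ℤ) ≤ 1)).trans_eq (one_zsmul u)
    · have : (29 : ℤ) • u + u = (30 : ℤ) • u := by grind
      rw [la_lv, this]; exact zsm_le hC.hu (by norm_num)
    · change s * xt j * s⁻¹ = _
      rw [tcj_def]
      exact conj_eq (hC.sup j) (fun r h1 h2 => by rw [hs' r h1 h2]; rfl)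
  have hsH : ∀ i : ℤ, tcj (i • u) (PP hC.hv (fun _ => true) ⟨s, hsK⟩) ∈ H := fun i =>
    hC.good_At hu' (by norm_num) (by norm_num) hs i hsK
  intro i
  induction i using Int.inductionOn' (b := i₀) with
  | zero => exact h j
  | succ k _ ih => rw [key]; exact hn _ (hsH k) _ ih
  | pred k _ ih =>
    have := hn _ (H.inv_mem (hsH (k - 1))) _ ih
    have e := key (k - 1)
    rw [sub_add_cancel] at e
    rw [e] at this
    convert this using 1
    group

theorem Core.good_shift (hC : Core u xt) {N : Subgroup (R ≃o R)} {C : ℤ → Bool} (h : hC.Good N C) (d : ℤ) :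
    hC.Good N (fun n => C (n - d)) := by
  intro j i
  rw [← PP_shift, tcj_tcj]
  unfold lv
  rw [smul_smul, ← add_zsmul]
  exact h j _

theorem Core.good_compl (hC : Core u xt) {N : Subgroup (R ≃o R)} {C : ℤ → Bool} (h : hC.Good N C)
    (h0 : hC.Good N (fun _ => true)) : hC.Good N (fun n => !C n) := by
  intro j i
  rw [← hC.PP_compl, map_mul, map_inv]
  exact N.mul_mem (h0 j i) (N.inv_mem (h j i))

theorem Core.good_union (hC : Core u xt) {N : Subgroup (R ≃o R)} {C D : ℤ → Bool} (h : hC.Good N C)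
    (h' : hC.Good N D) (hd : ∀ n, (C n && D n) = false) : hC.Good N (fun n => C n || D n) := by
  intro j i
  rw [← hC.PP_union C D hd, map_mul]
  exact N.mul_mem (h j i) (h' j i)

theorem Core.H_normal (hC : Core u xt) : ∀ h ∈ hC.Hs, ∀ n ∈ hC.Hs, h * n * h⁻¹ ∈ hC.Hs := fun _ h1 _ h2 =>
  hC.Hs.mul_mem (hC.Hs.mul_mem h1 h2) (hC.Hs.inv_mem h1)

theorem Core.H_univ (hC : Core u xt) : hC.Good hC.Hs (fun _ => true) := by
  apply hC.good_univ_of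
  intro j i
  exact Subgroup.subset_closure ⟨(i, j, false), rfl⟩

theorem Core.H_chi (hC : Core u xt) : hC.Good hC.Hs chi := by
  apply hC.good_all hC.H_normal hC.H_univ 0
  intro j
  exact Subgroup.subset_closure ⟨(0, j, true), rfl⟩

theorem Core.H_Rk (hC : Core u xt) (k : ℕ) : hC.Good hC.Hs (Rk k) := by
  have inter := fun {C D : ℤ → Bool} => hC.good_inter (C := C) (D := D) hC.H_normal
  induction k with
  | zero =>
    have : Rk 0 = fun _ => true := by funext n; simp [Rk]
    rw [this]; exact hC.H_univ
  | succ k ih =>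
    have hs : hC.Good hC.Hs (fun n => chi (n + 2 ^ (k + 1))) := by
      have := hC.good_shift hC.H_chi (-2 ^ (k + 1))
      simpa using this
    by_cases hp : k % 2 = 0
    · have : Rk (k + 1) = fun n => Rk k n && !(chi n && chi (n + 2 ^ (k + 1))) := by
        funext n; rw [Rk_succ, if_pos hp]
      rw [this]
      exact inter ih (hC.good_compl (inter hC.H_chi hs) hC.H_univ)
    · have : Rk (k + 1) = fun n => Rk k n && !((!chi n) && (!chi (n + 2 ^ (k + 1)))) := by
        funext n; rw [Rk_succ, if_neg hp]; simp
      rw [this]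
      exact inter ih (hC.good_compl (inter (hC.good_compl hC.H_chi hC.H_univ)
        (hC.good_compl hs hC.H_univ)) hC.H_univ)

theorem Core.H_cls (hC : Core u xt) (k : ℕ) (c : ℤ) : hC.Good hC.Hs (cls k c) := by
  obtain ⟨d, hd⟩ := cls_Rk k c
  have : cls k c = fun n => Rk k (n - d) := funext hd
  rw [this]
  exact hC.good_shift (hC.H_Rk k) d

theorem Core.good_cls_univ (hC : Core u xt) {N : Subgroup (R ≃o R)} (k : ℕ) (h : hC.Good N (cls k 0)) :
    hC.Good N (fun _ => true) := by
  have h' : ∀ c, hC.Good N (cls k c) := by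
    intro c
    have := hC.good_shift h c
    have e : cls k c = fun n => cls k 0 (n - c) := by funext n; simp [cls]
    rw [e]; exact this
  clear h
  induction k with
  | zero =>
    have := h' 0
    have e : cls 0 0 = fun _ => true := by funext n; simp [cls]
    rwa [e] at this
  | succ k ih =>
    apply ih
    intro c
    have e : cls k c = fun n => cls (k + 1) c n || cls (k + 1) (c + 2 ^ k) n :=
      funext fun n => (cls_split k c n).1
    rw [e]
    exact hC.good_union (h' _) (h' _) (fun n => (cls_split k c n).2)

end Core

section Simp

variable {R : Type*} [AddCommGroup R] [LinearOrder R] [IsOrderedAddMonoid R] {J : Type*}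

theorem At_mono (u : R) (xt : J → (R ≃o R)) {A B A' B' : ℤ} (h1 : A' ≤ A) (h2 : B ≤ B') :
    At u xt A B ≤ At u xt A' B' := by
  apply Subgroup.closure_mono
  rintro _ ⟨o, j, h3, h4, rfl⟩
  exact ⟨o, j, h1.trans h3, h4.trans h2, rfl⟩

/-- translates of points in cells are in cells -/
theorem inCell_tr {u : R} (hu : 0 < u) {r : R} (h : ∃ m, inCell (la u) (lv u) m r) (i : ℤ) :
    ∃ m, inCell (la u) (lv u) m (r + i • u) := by
  obtain ⟨m, h1, h2⟩ := h
  have hi : i • u = ((i % 310 : ℤ)) • u + (i / 310 : ℤ) • lv u := by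
    unfold lv
    rw [smul_smul, ← add_zsmul]
    congr 1; omega
  have t1 : (0 : ℤ) • u ≤ (i % 310) • u := zsm_le hu (by omega)
  have t2 : (i % 310) • u ≤ (310 : ℤ) • u := zsm_le hu (by omega)
  rw [zero_zsmul] at t1
  have hmain : ∃ m', inCell (la u) (lv u) m' (r + (i % 310) • u) := by
    by_cases hc : r + (i % 310) • u < la u + m • lv u + lv u
    · exact ⟨m, by grind, hc⟩
    · refine ⟨m + 1, ?_, ?_⟩
      · rw [add_zsmul, one_zsmul]; grind
      · rw [add_zsmul, one_zsmul]
        have : lv u = (310 : ℤ) • u := rfl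
        grind
  obtain ⟨m', hm'⟩ := hmain
  refine ⟨m' + i / 310, ?_⟩
  rw [hi, ← add_assoc]
  exact (inCell_shift _).2 hm'

variable {u : R} {xt : J → (R ≃o R)} (hC : Core u xt)

/-- bounded displacement -/
theorem Core.disp {h : R ≃o R} (hh : h ∈ hC.Hs) :
    ∃ M : ℕ, ∀ r, h r ≤ r + (M : ℤ) • lv u ∧ r ≤ h r + (M : ℤ) • lv u := by
  have hv := hC.hv
  induction hh using Subgroup.closure_induction with
  | mem x hx =>
    obtain ⟨⟨i, j, b⟩, rfl⟩ := hx
    refine ⟨1, fun r => ?_⟩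
    rw [Nat.cast_one, one_zsmul]
    unfold Core.hg
    rw [tcj_apply]
    simp only
    generalize (if b then chi else fun _ => true) = C
    by_cases hc : ∃ m, inCell (la u) (lv u) m (r - (i : ℤ) • u)
    · obtain ⟨m, hm⟩ := hc
      have h2 := inCell_PP (hv := hv) C (hC.xk j) hm
      obtain ⟨h3, h4⟩ := hm
      obtain ⟨h5, h6⟩ := h2
      constructor <;> grind
    · rw [PP_out _ _ hc]
      constructor <;> grind
  | one => exact ⟨0, fun r => by simp [aut_one]⟩
  | mul x y _ _ hx hy =>
    obtain ⟨M, hM⟩ := hx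
    obtain ⟨M', hM'⟩ := hy
    refine ⟨M + M', fun r => ?_⟩
    rw [aut_mul]
    have h1 := hM (y r)
    have h2 := hM' r
    push_cast
    rw [add_zsmul]
    constructor <;> grind
  | inv x _ hx =>
    obtain ⟨M, hM⟩ := hx
    refine ⟨M, fun r => ?_⟩
    have h1 := hM (x⁻¹ r)
    rw [aut_inv_apply] at h1
    exact ⟨h1.2, h1.1⟩

theorem Core.fix_out {h : R ≃o R} (hh : h ∈ hC.Hs) {r : R}
    (hr : ¬ ∃ m, inCell (la u) (lv u) m r) : h r = r := by
  induction hh using Subgroup.closure_induction with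
  | mem x hx =>
    obtain ⟨⟨i, j, b⟩, rfl⟩ := hx
    unfold Core.hg
    rw [tcj_apply]
    simp only
    rw [PP_out _ _, sub_add_cancel]
    intro hc
    apply hr
    have := inCell_tr hC.hu hc (i : ℤ)
    rwa [sub_add_cancel] at this
  | one => rfl
  | mul x y _ _ hx hy => rw [aut_mul, hy, hx]
  | inv x _ hx => rw [aut_inv_eq, hx]

/-- almost periodicity -/
theorem Core.recur {h : R ≃o R} (hh : h ∈ hC.Hs) : ∀ x, ∃ k : ℕ, ∀ m : ℤ, (2 : ℤ) ^ k ∣ m →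
    h (x + m • lv u) = h x + m • lv u := by
  have hv := hC.hv
  induction hh using Subgroup.closure_induction with
  | mem x hx =>
    obtain ⟨⟨i, j, b⟩, rfl⟩ := hx
    intro r
    unfold Core.hg
    have hrec : ∀ n : ℤ, ∃ k : ℕ, ∀ m : ℤ, (2 : ℤ) ^ k ∣ m →
        (if b then chi else fun _ => true) (n + m) = (if b then chi else fun _ => true) n := by
      intro n
      cases b
      · exact ⟨0, fun _ _ => rfl⟩
      · exact chi_rec n
    simp only [tcj_apply]
    generalize (if b then chi else fun _ => true) = C at hrec ⊢
    by_cases hc : ∃ m, inCell (la u) (lv u) m (r - (i : ℤ) • u)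
    · obtain ⟨n, hn⟩ := hc
      obtain ⟨k, hk⟩ := hrec n
      refine ⟨k, fun m hm => ?_⟩
      have hn' := (inCell_shift m).2 hn
      have e : r + m • lv u - (i : ℤ) • u = r - (i : ℤ) • u + m • lv u := by abel
      rw [e]
      cases hCn : C n
      · rw [PP_off _ _ hn hCn, PP_off _ _ hn' (by rw [hk m hm, hCn])]; abel
      · rw [PP_in _ _ hn hCn, PP_in _ _ hn' (by rw [hk m hm, hCn]), add_zsmul]
        rw [show r - (i : ℤ) • u + m • lv u - (n • lv u + m • lv u) =
          r - (i : ℤ) • u - n • lv u by abel]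
        abel
    · refine ⟨0, fun m hm => ?_⟩
      rw [PP_out _ _ hc, PP_out]
      · abel
      · rintro ⟨n, hn⟩
        apply hc
        refine ⟨n - m, ?_⟩
        apply (inCell_shift m).1
        rw [sub_add_cancel]
        convert hn using 1
        abel
  | one => exact fun x => ⟨0, fun _ _ => rfl⟩
  | mul x y _ _ hx hy =>
    intro r
    obtain ⟨k, hk⟩ := hy r
    obtain ⟨k', hk'⟩ := hx (y r)
    refine ⟨max k k', fun m hm => ?_⟩
    rw [aut_mul, aut_mul, hk m ((pow_dvd_pow _ (le_max_left _ _)).trans hm),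
      hk' m ((pow_dvd_pow _ (le_max_right _ _)).trans hm)]
  | inv x _ hx =>
    intro r
    obtain ⟨k, hk⟩ := hx (x⁻¹ r)
    refine ⟨k, fun m hm => ?_⟩
    rw [aut_inv_eq, hk m hm, aut_inv_apply]

theorem disj_comm {A B : R ≃o R} (h : ∀ x, A x = x ∨ B x = x) : A * B = B * A := by
  apply RelIso.ext; intro x
  rw [aut_mul, aut_mul]
  by_cases hb : B x = x
  · rw [hb]
    by_cases ha : A x = x
    · rw [ha, hb]
    · have : A (A x) ≠ A x := fun e => ha (A.injective e)
      rcases h (A x) with h | h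
      · exact absurd h this
      · exact h.symm
  · have ha : A x = x := (h x).resolve_right hb
    rw [ha]
    have : B (B x) ≠ B x := fun e => hb (B.injective e)
    exact (h (B x)).resolve_right this

theorem Core.simple_aux {N : Subgroup (R ≃o R)} (hN : N ≤ hC.Hs)
    (hn : ∀ h ∈ hC.Hs, ∀ n ∈ N, h * n * h⁻¹ ∈ N) {h : R ≃o R} (hh : h ∈ N) {r : R}
    (hr : r < h r) : hC.Hs ≤ N := by
  have hv := hC.hv
  have hhH := hN hh
  have hcell : ∃ m, inCell (la u) (lv u) m r := by
    by_contra hcon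
    exact hr.ne' (hC.fix_out hhH hcon)
  obtain ⟨i, hi⟩ := hC.contr r hcell
  obtain ⟨c, hc, hcw⟩ := hi _ hr
  obtain ⟨M, hM⟩ := hC.disp hhH
  obtain ⟨k₀, hk₀⟩ := hC.recur hhH r
  obtain ⟨k, hk1, hk2⟩ : ∃ k, k₀ ≤ k ∧ (M : ℤ) + M ≤ 2 ^ k := by
    refine ⟨max k₀ (M + M), le_max_left _ _, ?_⟩
    have h1 : M + M < 2 ^ (M + M) := Nat.lt_two_pow_self
    have h2 : 2 ^ (M + M) ≤ 2 ^ (max k₀ (M + M)) :=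
      Nat.pow_le_pow_right (by norm_num) (le_max_right _ _)
    exact_mod_cast h1.le.trans h2
  have hrec : ∀ m : ℤ, (2 : ℤ) ^ k ∣ m → h (r + m • lv u) = h r + m • lv u := fun m hm =>
    hk₀ m ((pow_dvd_pow _ hk1).trans hm)
  have hcK := hC.At_KC le_rfl le_rfl hc
  -- supports
  have supp : ∀ (α : R ≃o R), α ∈ At u xt (-1) 100 → ∀ hα : c * α * c⁻¹ ∈ KC u, ∀ x,
      tcj (i • u) (PP hC.hv (cls k 0) ⟨c * α * c⁻¹, hα⟩) x ≠ x →
      ∃ n : ℤ, (2 : ℤ) ^ k ∣ n ∧ r + n • lv u < x ∧ x < h r + n • lv u := by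
    intro α hα hαK x hx
    rw [tcj_apply] at hx
    by_cases hcx : ∃ m, inCell (la u) (lv u) m (x - i • u)
    · obtain ⟨n, hnx⟩ := hcx
      cases hD : cls k 0 n
      · rw [PP_off _ _ hnx hD, sub_add_cancel] at hx
        exact absurd rfl hx
      · refine ⟨n, by simpa [cls] using hD, ?_⟩
        rw [PP_in _ _ hnx hD] at hx
        change (c * α * c⁻¹) (x - i • u - n • lv u) + n • lv u + i • u ≠ x at hx
        rw [aut_mul, aut_mul] at hx
        set y := c⁻¹ (x - i • u - n • lv u) with hy
        have hy' : c y = x - i • u - n • lv u := aut_inv_apply _ _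
        have hw : (-1 : ℤ) • u ≤ y ∧ y ≤ (100 : ℤ) • u := by
          by_contra hcon
          apply hx
          have : α y = y := by
            apply hC.At_sup hα
            by_contra h'
            exact hcon ⟨by grind, by grind⟩
          rw [this, hy']; abel
        have := hcw y hw.1 hw.2
        rw [hy'] at this
        constructor <;> grind
    · rw [PP_out _ _ hcx, sub_add_cancel] at hx
      exact absurd rfl hx
  have hgood : hC.Good N (cls k 0) := by
    apply hC.good_all hn hC.H_univ i
    intro j
    obtain ⟨α, hα, β, hβ, e⟩ := hC.perf j
    have hα' := At_mono u xt (by norm_num : (-10 : ℤ) ≤ -1) (by norm_num : (100 : ℤ) ≤ 300) hα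
    have hβ' := At_mono u xt (by norm_num : (-10 : ℤ) ≤ -1) (by norm_num : (100 : ℤ) ≤ 300) hβ
    have hcα : c * α * c⁻¹ ∈ At u xt (-10) 300 :=
      Subgroup.mul_mem _ (Subgroup.mul_mem _ hc hα') (Subgroup.inv_mem _ hc)
    have hcβ : c * β * c⁻¹ ∈ At u xt (-10) 300 :=
      Subgroup.mul_mem _ (Subgroup.mul_mem _ hc hβ') (Subgroup.inv_mem _ hc)
    have kα := hC.At_KC le_rfl le_rfl hcα
    have kβ := hC.At_KC le_rfl le_rfl hcβ
    have sA := supp α hα kα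
    have sB := supp β hβ kβ
    have mA := hC.good_At (hC.H_cls k 0) le_rfl le_rfl hcα i kα
    have mB := hC.good_At (hC.H_cls k 0) le_rfl le_rfl hcβ i kβ
    have mc := hC.good_At hC.H_univ le_rfl le_rfl hc i hcK
    have eAB : tcj (i • u) (PP hC.hv (cls k 0) (hC.xk j)) =
        (tcj (i • u) (PP hC.hv (fun _ => true) ⟨c, hcK⟩))⁻¹ *
        (tcj (i • u) (PP hC.hv (cls k 0) ⟨_, kα⟩) * tcj (i • u) (PP hC.hv (cls k 0) ⟨_, kβ⟩) *
        (tcj (i • u) (PP hC.hv (cls k 0) ⟨_, kα⟩))⁻¹ *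
        (tcj (i • u) (PP hC.hv (cls k 0) ⟨_, kβ⟩))⁻¹) *
        (tcj (i • u) (PP hC.hv (fun _ => true) ⟨c, hcK⟩)) := by
      rw [eq_comm, mul_assoc, inv_mul_eq_iff_eq_mul, ← eq_mul_inv_iff_mul_eq]
      simp only [← map_mul, ← map_inv]
      rw [map_inv (PP hC.hv (fun _ => true)), hC.PP_conj]
      congr 2
      apply Subtype.ext
      change c * α * c⁻¹ * (c * β * c⁻¹) * (c * α * c⁻¹)⁻¹ * (c * β * c⁻¹)⁻¹ = c * xt j * c⁻¹
      rw [e]; group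
    generalize tcj (i • u) (PP hC.hv (cls k 0) ⟨c * α * c⁻¹, kα⟩) = A at sA mA eAB
    generalize tcj (i • u) (PP hC.hv (cls k 0) ⟨c * β * c⁻¹, kβ⟩) = B at sB mB eAB
    rw [eAB]
    have hcomm : (h * A⁻¹ * h⁻¹) * B = B * (h * A⁻¹ * h⁻¹) := by
      apply disj_comm
      intro x
      by_contra hcon
      push Not at hcon
      obtain ⟨n, hn1, hn2, hn3⟩ := sA (h⁻¹ x) (by
        intro he
        apply hcon.1
        rw [aut_mul, aut_mul, aut_inv_eq.2 he.symm, aut_inv_apply])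
      obtain ⟨n', hn1', hn2', hn3'⟩ := sB x hcon.2
      have a1 := (aut_lt h).2 hn2
      have a2 := (aut_lt h).2 hn3
      rw [aut_inv_apply, hrec n hn1] at a1
      rw [aut_inv_apply] at a2
      have a3 := (hM (h r + n • lv u)).1
      have a4 := (hM r).1
      have hlt : n < n' := by
        by_contra hge
        have := zsmul_le_zsmul_left hv.le (not_lt.1 hge)
        grind
      have hge : n + ((M : ℤ) + M) ≤ n' := by
        have := Int.le_of_dvd (by omega) (dvd_sub hn1' hn1)
        omega
      have := zsmul_le_zsmul_left hv.le hge
      rw [add_zsmul, add_zsmul] at this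
      grind
    have hmem : A * B * A⁻¹ * B⁻¹ ∈ N := by
      have e1 : A * B * A⁻¹ * B⁻¹ =
          (A * h * A⁻¹ * h⁻¹) * (B * (A * h * A⁻¹ * h⁻¹)⁻¹ * B⁻¹) := by
        have : A * h * A⁻¹ * h⁻¹ = A * (h * A⁻¹ * h⁻¹) := by group
        rw [this]
        generalize h * A⁻¹ * h⁻¹ = X at hcomm
        calc A * B * A⁻¹ * B⁻¹ = A * (B * X) * X⁻¹ * A⁻¹ * B⁻¹ := by group
          _ = A * (X * B) * X⁻¹ * A⁻¹ * B⁻¹ := by rw [hcomm]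
          _ = _ := by group
      have m1 : A * h * A⁻¹ * h⁻¹ ∈ N := N.mul_mem (hn _ mA _ hh) (N.inv_mem hh)
      rw [e1]
      exact N.mul_mem m1 (hn _ mB _ (N.inv_mem m1))
    have := hn _ (hC.Hs.inv_mem mc) _ hmem
    rwa [inv_inv] at this
  have huniv := hC.good_cls_univ k hgood
  have hchi : hC.Good N chi := by
    have := hC.good_inter hn hC.H_chi huniv
    simpa using this
  rw [Core.Hs, Subgroup.closure_le]
  rintro _ ⟨⟨i, j, b⟩, rfl⟩
  unfold Core.hg
  cases b
  · exact huniv j i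
  · exact hchi j i

theorem Core.simple : IsSimpleGroup hC.Hs := by
  have hv := hC.hv
  haveI : Nontrivial hC.Hs := by
    obtain ⟨j, hj⟩ := hC.ne
    have hm := hC.H_univ j 0
    rw [zero_zsmul, tcj_zero] at hm
    refine ⟨⟨⟨_, hm⟩, 1, ?_⟩⟩
    intro he
    have he' : PP hC.hv (fun _ => true) (hC.xk j) = 1 := congrArg Subtype.val he
    apply hj
    apply RelIso.ext; intro r
    by_cases hr : inCell (la u) (lv u) 0 r
    · have h1 := PP_in (hv := hC.hv) (fun _ => true) (hC.xk j) hr rfl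
      rw [he', zero_zsmul, sub_zero, add_zero] at h1
      exact h1.symm
    · apply hC.xt_KC j
      unfold inCell at hr
      rw [zero_zsmul, add_zero] at hr
      by_contra hcon
      push Not at hcon
      exact hr ⟨hcon.1.le, hcon.2⟩
  refine ⟨fun N' hN' => ?_⟩
  by_cases hbot : N' = ⊥
  · exact Or.inl hbot
  right
  obtain ⟨h, hh, hne⟩ := N'.bot_or_exists_ne_one.resolve_left hbot
  set N := N'.map hC.Hs.subtype with hNdef
  have hN : N ≤ hC.Hs := by rintro _ ⟨x, _, rfl⟩; exact x.2
  have hn : ∀ h ∈ hC.Hs, ∀ n ∈ N, h * n * h⁻¹ ∈ N := by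
    rintro g hg _ ⟨x, hx, rfl⟩
    exact ⟨⟨g, hg⟩ * x * ⟨g, hg⟩⁻¹, hN'.conj_mem x hx _, rfl⟩
  have hhN : h.1 ∈ N := ⟨h, hh, rfl⟩
  have hle : hC.Hs ≤ N := by
    obtain ⟨r, hr⟩ : ∃ r, h.1 r ≠ r := by
      by_contra hcon
      push Not at hcon
      exact hne (Subtype.ext (RelIso.ext hcon))
    rcases lt_or_gt_of_ne hr with h1 | h1
    · refine hC.simple_aux hN hn (N.inv_mem hhN) (r := h.1 r) ?_
      rw [aut_apply_inv]; exact h1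
    · exact hC.simple_aux hN hn hhN h1
  rw [eq_top_iff]
  rintro x -
  obtain ⟨y, hy, e⟩ := hle x.2
  rwa [← Subtype.ext e]

end Simp

/-- the structure on `R` used in the construction -/
structure Scale (R Γ : Type*) [AddCommGroup R] [LinearOrder R] [IsOrderedAddMonoid R] [Group Γ] where
  Z : R ≃o R
  Z_add : ∀ a b, Z (a + b) = Z a + Z b
  act : Γ →* (R ≃o R)
  act_add : ∀ g a b, act g (a + b) = act g a + act g b
  act_Z : ∀ g a, act g (Z a) = Z (act g a)
  one : R
  eta : R
  one_pos : 0 < one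
  eta_pos : 0 < eta
  act_one : ∀ g, act g one = one
  Inf : AddSubgroup R
  inf_lt : ∀ w ∈ Inf, w < one
  eta_inf : eta ∈ Inf
  z_inf : Z one ∈ Inf
  act_inf : ∀ g, ∀ w ∈ Inf, act g w ∈ Inf
  Z_inf : ∀ w ∈ Inf, Z w ∈ Inf
  inf_conv : ∀ a ∈ Inf, ∀ b, 0 ≤ b → b ≤ a → b ∈ Inf
  dec : ∀ w ∈ Inf, ∃ v ∈ AddSubgroup.closure ({Z one} ∪ Set.range fun g => act g eta),
    ∃ w' ∈ Inf, w = v + Z w'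
  approx : ∀ d, 0 < d → ∃ K : ℕ, (3 : ℤ) • (Z ^ K) one ≤ d
  bdd : ∀ r, ∀ n : ℕ, -(n : ℤ) • one ≤ r → r ≤ (n : ℤ) • one → ∃ c : ℤ, r - c • one ∈ Inf

namespace Scale

variable {R Γ : Type*} [AddCommGroup R] [LinearOrder R] [IsOrderedAddMonoid R] [Group Γ]
  (S : Scale R Γ)

theorem Z_zero : S.Z 0 = 0 := by
  have := S.Z_add 0 0
  simpa using this

theorem Z_neg (a : R) : S.Z (-a) = - S.Z a := by
  have := S.Z_add a (-a)
  rw [add_neg_cancel, S.Z_zero] at this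
  exact (neg_eq_of_add_eq_zero_right this.symm).symm

theorem Z_sub (a b : R) : S.Z (a - b) = S.Z a - S.Z b := by
  rw [sub_eq_add_neg, S.Z_add, S.Z_neg, sub_eq_add_neg]

theorem Zi_add (a b : R) : S.Z⁻¹ (a + b) = S.Z⁻¹ a + S.Z⁻¹ b := by
  rw [aut_inv_eq, S.Z_add, aut_inv_apply, aut_inv_apply]

theorem Zi_zero : S.Z⁻¹ 0 = 0 := by rw [aut_inv_eq, S.Z_zero]

theorem Z_zsmul (n : ℤ) (a : R) : S.Z (n • a) = n • S.Z a :=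
  map_zsmul (AddMonoidHom.mk' S.Z S.Z_add) n a

theorem Zi_zsmul (n : ℤ) (a : R) : S.Z⁻¹ (n • a) = n • S.Z⁻¹ a := by
  rw [aut_inv_eq, S.Z_zsmul, aut_inv_apply]

theorem act_zero (g : Γ) : S.act g 0 = 0 := by
  have := S.act_add g 0 0
  simpa using this

theorem act_zsmul (g : Γ) (n : ℤ) (a : R) : S.act g (n • a) = n • S.act g a :=
  map_zsmul (AddMonoidHom.mk' (S.act g) (S.act_add g)) n a

theorem act_sub (g : Γ) (a b : R) : S.act g (a - b) = S.act g a - S.act g b :=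
  map_sub (AddMonoidHom.mk' (S.act g) (S.act_add g)) a b

theorem Z_nonneg {a : R} (h : 0 ≤ a) : 0 ≤ S.Z a := by
  have := (aut_le S.Z).2 h
  rwa [S.Z_zero] at this

theorem Z_pos {a : R} (h : 0 < a) : 0 < S.Z a := by
  have := (aut_lt S.Z).2 h
  rwa [S.Z_zero] at this

def z : R := S.Z S.one
def u : R := S.one - S.z

theorem z_pos : 0 < S.z := S.Z_pos S.one_pos

theorem z_lt : S.z < S.one := S.inf_lt _ S.z_inf

theorem zn_lt (n : ℤ) : n • S.z < S.one := S.inf_lt _ (S.Inf.zsmul_mem S.z_inf n)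

theorem u_pos : 0 < S.u := sub_pos.2 S.z_lt

theorem inf_gt {w : R} (h : w ∈ S.Inf) : -w < S.one := S.inf_lt _ (S.Inf.neg_mem h)

/-- the basic homeomorphism at `0` -/
noncomputable def X0 (e : R) (he : 0 ≤ e) : R ≃o R :=
  glue 0 1 (glue (S.Z e) S.Z⁻¹ (tr (e - S.Z e)) (by rw [aut_apply_inv, tr_apply]; abel))
    (by rw [glue_le _ (S.Z_nonneg he), S.Zi_zero]; rfl)

theorem X0_1 {e : R} (he : 0 ≤ e) {r : R} (h : r ≤ 0) : S.X0 e he r = r := by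
  rw [X0, glue_le _ h]; rfl

theorem X0_2 {e : R} (he : 0 ≤ e) {r : R} (h : 0 ≤ r) (h' : r ≤ S.Z e) :
    S.X0 e he r = S.Z⁻¹ r := by
  rw [X0, glue_ge _ h, glue_le _ h']

theorem X0_3 {e : R} (he : 0 ≤ e) {r : R} (h' : S.Z e ≤ r) :
    S.X0 e he r = r + (e - S.Z e) := by
  rw [X0, glue_ge _ ((S.Z_nonneg he).trans h'), glue_ge _ h', tr_apply]

noncomputable def X (a e : R) (he : 0 ≤ e) : R ≃o R := tcj a (S.X0 e he)

theorem X_1 {a e : R} (he : 0 ≤ e) {r : R} (h : r ≤ a) : S.X a e he r = r := by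
  rw [X, tcj_apply, X0_1 _ _ (sub_nonpos.2 h), sub_add_cancel]

theorem X_2 {a e : R} (he : 0 ≤ e) {r : R} (h : a ≤ r) (h' : r ≤ a + S.Z e) :
    S.X a e he r = S.Z⁻¹ (r - a) + a := by
  rw [X, tcj_apply, X0_2 _ _ (sub_nonneg.2 h) (by grind)]

theorem X_3 {a e : R} (he : 0 ≤ e) {r : R} (h' : a + S.Z e ≤ r) :
    S.X a e he r = r + (e - S.Z e) := by
  rw [X, tcj_apply, X0_3 _ _ (by grind)]; abel

theorem Xi_1 {a e : R} (he : 0 ≤ e) {r : R} (h : r ≤ a) : (S.X a e he)⁻¹ r = r := by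
  rw [aut_inv_eq, S.X_1 he h]

theorem Xi_2 {a e : R} (he : 0 ≤ e) {r : R} (h : a ≤ r) (h' : r ≤ a + e) :
    (S.X a e he)⁻¹ r = S.Z (r - a) + a := by
  have h1 := S.Z_nonneg (sub_nonneg.2 h)
  have h2 : S.Z (r - a) ≤ S.Z e := (aut_le _).2 (by grind)
  rw [aut_inv_eq, S.X_2 he (by grind) (by grind), add_sub_cancel_right, aut_apply_inv,
    sub_add_cancel]

theorem Xi_3 {a e : R} (he : 0 ≤ e) {r : R} (h : a + e ≤ r) :
    (S.X a e he)⁻¹ r = r - (e - S.Z e) := by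
  rw [aut_inv_eq, S.X_3 he (by grind), sub_add_cancel]

noncomputable def Y (a b e : R) (he : 0 ≤ e) : R ≃o R := S.X a e he * (S.X b e he)⁻¹

section
variable {S} {a b e : R} {he : 0 ≤ e} {r : R}

theorem Y_1 (hb : a ≤ b) (h : r ≤ a) : S.Y a b e he r = r := by
  rw [Y, aut_mul, S.Xi_1 he (h.trans hb), S.X_1 he h]

theorem Y_2 (hb : a + S.Z e ≤ b) (h : a ≤ r) (h' : r ≤ a + S.Z e) :
    S.Y a b e he r = S.Z⁻¹ (r - a) + a := by
  rw [Y, aut_mul, S.Xi_1 he (h'.trans hb), S.X_2 he h h']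

theorem Y_3 (h : a + S.Z e ≤ r) (h' : r ≤ b) : S.Y a b e he r = r + (e - S.Z e) := by
  rw [Y, aut_mul, S.Xi_1 he h', S.X_3 he h]

theorem Y_4 (hb : a ≤ b) (h : b + e ≤ r) : S.Y a b e he r = r := by
  rw [Y, aut_mul, S.Xi_3 he h, S.X_3 he (by grind), sub_add_cancel]

theorem Y_sup (hb : a ≤ b) : Sup (S.Y a b e he) a (b + e) := by
  rintro r (h | h)
  · exact Y_1 hb h
  · exact Y_4 hb h

theorem Y_tcj (c : R) : tcj c (S.Y a b e he) = S.Y (a + c) (b + c) e he := by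
  unfold Y X
  rw [map_mul, map_inv, tcj_tcj, tcj_tcj, add_comm c, add_comm c]

theorem Y_mul (c : R) : S.Y a b e he * S.Y b c e he = S.Y a c e he := by
  unfold Y; group
end

/-- the action of `g`, cut off -/
noncomputable def gJ (g : Γ) : R ≃o R :=
  glue 0 1 (glue ((8 : ℤ) • S.one) (S.act g) 1 (by rw [S.act_zsmul, S.act_one]; rfl))
    (by rw [glue_le _ (zsmul_nonneg S.one_pos.le (by norm_num)), S.act_zero]; rfl)

theorem gJ_1 (g : Γ) {r : R} (h : r ≤ 0) : S.gJ g r = r := by rw [gJ, glue_le _ h]; rfl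

theorem gJ_2 (g : Γ) {r : R} (h : 0 ≤ r) (h' : r ≤ (8 : ℤ) • S.one) : S.gJ g r = S.act g r := by
  rw [gJ, glue_ge _ h, glue_le _ h']

theorem gJ_3 (g : Γ) {r : R} (h' : (8 : ℤ) • S.one ≤ r) : S.gJ g r = r := by
  have h8 : 0 ≤ (8 : ℤ) • S.one := zsmul_nonneg S.one_pos.le (by norm_num)
  rw [gJ, glue_ge _ (h8.trans h'), glue_ge _ h']; rfl

theorem gJ_sup (g : Γ) : Sup (S.gJ g) 0 ((8 : ℤ) • S.one) := by
  rintro r (h | h)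
  · exact S.gJ_1 g h
  · exact S.gJ_3 g h

theorem act_nonneg (g : Γ) {r : R} (h : 0 ≤ r) : 0 ≤ S.act g r := by
  have := (aut_le (S.act g)).2 h
  rwa [S.act_zero] at this

theorem act_le8 (g : Γ) {r : R} (h : r ≤ (8 : ℤ) • S.one) : S.act g r ≤ (8 : ℤ) • S.one := by
  have := (aut_le (S.act g)).2 h
  rwa [S.act_zsmul, S.act_one] at this

theorem gJ_mul (g h : Γ) : S.gJ (g * h) = S.gJ g * S.gJ h := by
  apply RelIso.ext; intro r
  rw [aut_mul]
  rcases le_total r 0 with h1 | h1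
  · rw [S.gJ_1 _ h1, S.gJ_1 _ h1, S.gJ_1 _ h1]
  · rcases le_total r ((8 : ℤ) • S.one) with h2 | h2
    · rw [S.gJ_2 _ h1 h2, S.gJ_2 _ h1 h2, S.gJ_2 _ (S.act_nonneg h h1) (S.act_le8 h h2), map_mul,
        aut_mul]
    · rw [S.gJ_3 _ h2, S.gJ_3 _ h2, S.gJ_3 _ h2]

/-- the cut-off action as a homomorphism -/
noncomputable def gJh : Γ →* (R ≃o R) := MonoidHom.mk' S.gJ S.gJ_mul

theorem eta_nonneg : 0 ≤ S.eta := S.eta_pos.le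
theorem six_nonneg : 0 ≤ (6 : ℤ) • S.one := zsmul_nonneg S.one_pos.le (by norm_num)

variable {q : ℕ} (γ : Fin q → Γ)

abbrev JJ (q : ℕ) := Fin 4 ⊕ Fin q

/-- the basic family -/
noncomputable def xj : JJ q → (R ≃o R) :=
  Sum.elim ![S.Y 0 S.u S.one S.one_pos.le, S.Y 0 ((6 : ℤ) • S.z) ((6 : ℤ) • S.one) S.six_nonneg,
    S.Y 0 ((4 : ℤ) • S.one) S.z S.z_pos.le, S.Y 0 ((4 : ℤ) • S.one) S.eta S.eta_nonneg]
    (fun i => S.gJ (γ i))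

theorem xj_sup (j : JJ q) : Sup (S.xj γ j) 0 ((9 : ℤ) • S.u) := by
  have hz := S.z_pos
  have h1 := S.one_pos
  have h2 := S.zn_lt 100
  have h3 := S.inf_lt _ S.eta_inf
  rcases j with j | j
  · fin_cases j
    · exact (Y_sup S.u_pos.le).mono le_rfl (by unfold u; grind)
    · exact (Y_sup (by grind)).mono le_rfl (by unfold u; grind)
    · exact (Y_sup (by grind)).mono le_rfl (by unfold u; grind)
    · exact (Y_sup (by grind)).mono le_rfl (by unfold u; grind)
  · exact (S.gJ_sup _).mono le_rfl (by unfold u; grind)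

noncomputable def xt (j : JJ q) : R ≃o R := S.xj γ j * (tcj ((20 : ℤ) • S.u) (S.xj γ j))⁻¹

theorem xt_sup (j : JJ q) : Sup (S.xt γ j) 0 ((29 : ℤ) • S.u) := by
  have h := S.xj_sup γ j
  have hu := S.u_pos
  refine (h.mono le_rfl (by grind)).mul ((h.tcj _).inv.mono (by grind) ?_)
  grind

/-- plain words with support in a window -/
def Mp (A B : ℤ) : Subgroup (R ≃o R) :=
  Subgroup.closure {k | ∃ (o : ℤ) (j : JJ q), A ≤ o ∧ o + 9 ≤ B ∧ k = tcj (o • S.u) (S.xj γ j)}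

theorem Mp_sup {A B : ℤ} {k : R ≃o R} (h : k ∈ S.Mp γ A B) : Sup k (A • S.u) (B • S.u) := by
  have : S.Mp γ A B ≤ KS (A • S.u) (B • S.u) := by
    rw [Mp, Subgroup.closure_le]
    rintro _ ⟨o, j, h1, h2, rfl⟩
    refine ((S.xj_sup γ j).tcj (o • S.u)).mono ?_ ?_
    · rw [zero_add]; exact zsm_le S.u_pos h1
    · rw [← add_zsmul]; exact zsm_le S.u_pos (by omega)
  exact this h

theorem xt_tele (j : JJ q) (o : ℤ) (k : ℕ) (A B : ℤ) (hA : A ≤ o) (hB : o + 9 + 20 * k ≤ B) :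
    tcj (o • S.u) (S.xj γ j) * (tcj ((o + 20 * k) • S.u) (S.xj γ j))⁻¹ ∈ At S.u (S.xt γ) A B := by
  induction k with
  | zero => simp
  | succ k ih =>
    have e : tcj (o • S.u) (S.xj γ j) * (tcj ((o + 20 * ((k + 1 : ℕ) : ℤ)) • S.u) (S.xj γ j))⁻¹ =
        (tcj (o • S.u) (S.xj γ j) * (tcj ((o + 20 * k) • S.u) (S.xj γ j))⁻¹) *
        tcj ((o + 20 * k) • S.u) (S.xt γ j) := by
      rw [xt, map_mul, map_inv, tcj_tcj, ← add_zsmul]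
      have : o + 20 * ((k + 1 : ℕ) : ℤ) = o + 20 * k + 20 := by push_cast; ring
      rw [this]; group
    rw [e]
    push_cast at hB
    refine Subgroup.mul_mem _ (ih (by omega)) (Subgroup.subset_closure ⟨_, j, ?_, ?_, rfl⟩)
    · omega
    · omega

/-- replacing plain words by differences -/
theorem tilde {A B : ℤ} (k : ℕ) (hk : B - A ≤ 20 * k) {m : R ≃o R} (hm : m ∈ S.Mp γ A B) :
    ∃ m' ∈ At S.u (S.xt γ) A (B + 20 * k), ∀ r, r ≤ (A + 20 * k) • S.u → m' r = m r := by
  have keep : ∀ {m : R ≃o R}, m ∈ S.Mp γ A B → ∀ r, r ≤ (A + 20 * (k : ℤ)) • S.u →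
      m r ≤ (A + 20 * (k : ℤ)) • S.u := by
    intro m hm r hr
    have h1 := (aut_le m).2 hr
    rwa [S.Mp_sup γ hm _ (Or.inr (zsm_le S.u_pos (by omega)))] at h1
  unfold Mp at hm
  induction hm using Subgroup.closure_induction with
  | mem x hx =>
    obtain ⟨o, j, h1, h2, rfl⟩ := hx
    refine ⟨_, S.xt_tele γ j o k A (B + 20 * k) h1 (by omega), fun r hr => ?_⟩
    rw [aut_mul, ((S.xj_sup γ j).tcj _).inv]
    left
    rw [zero_add]
    exact hr.trans (zsm_le S.u_pos (by omega))
  | one => exact ⟨1, Subgroup.one_mem _, fun _ _ => rfl⟩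
  | mul x y hx hy ihx ihy =>
    obtain ⟨x', hx1, hx2⟩ := ihx
    obtain ⟨y', hy1, hy2⟩ := ihy
    refine ⟨x' * y', Subgroup.mul_mem _ hx1 hy1, fun r hr => ?_⟩
    rw [aut_mul, aut_mul, hy2 r hr, hx2 _ (keep hy r hr)]
  | inv x hx ihx =>
    obtain ⟨x', hx1, hx2⟩ := ihx
    refine ⟨x'⁻¹, Subgroup.inv_mem _ hx1, fun r hr => ?_⟩
    have := keep (Subgroup.inv_mem _ hx) r hr
    rw [aut_inv_eq, hx2 _ this, aut_inv_apply]

end Scale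

namespace Scale

variable {R Γ : Type*} [AddCommGroup R] [LinearOrder R] [IsOrderedAddMonoid R] [Group Γ]
  (S : Scale R Γ) {q : ℕ} (γ : Fin q → Γ)

/-- the shift by `u` on a window -/
noncomputable def fw (a b : ℤ) : R ≃o R := S.Y (a • S.u) (b • S.u) S.one S.one_pos.le

theorem fw_mem {a b A B : ℤ} (h : a ≤ b) (hA : A ≤ a) (hB : b + 8 ≤ B) :
    S.fw a b ∈ S.Mp γ A B := by
  induction b, h using Int.le_induction with
  | base =>
    have : S.fw a a = 1 := by unfold fw Y; group
    rw [this]; exact Subgroup.one_mem _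
  | succ b hb ih =>
    have e : S.fw a (b + 1) = S.fw a b * tcj (b • S.u) (S.xj γ (Sum.inl 0)) := by
      have : S.xj γ (Sum.inl 0) = S.Y 0 S.u S.one S.one_pos.le := rfl
      rw [this, Y_tcj]
      unfold fw
      rw [zero_add, show S.u + b • S.u = (b + 1) • S.u by rw [add_zsmul, one_zsmul, add_comm],
        Y_mul]
    rw [e]
    exact Subgroup.mul_mem _ (ih (by omega))
      (Subgroup.subset_closure ⟨b, Sum.inl 0, by omega, by omega, rfl⟩)

theorem fw_apply {a b : ℤ} {r : R} (h : a • S.u + S.z ≤ r) (h' : r ≤ b • S.u) :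
    S.fw a b r = r + S.u := Y_3 h h'

theorem fw_pow {a b : ℤ} (n : ℕ) {r : R} (h : a • S.u + S.z ≤ r)
    (h' : r + (n : ℤ) • S.u ≤ (b + 1) • S.u) : (S.fw a b ^ n) r = r + (n : ℤ) • S.u := by
  have hu := S.u_pos
  induction n with
  | zero => simp [aut_one]
  | succ n ih =>
    push_cast at h' ⊢
    rw [add_zsmul, one_zsmul] at h' ⊢
    rw [add_zsmul, one_zsmul] at h'
    have hn : 0 ≤ (n : ℤ) • S.u := zsmul_nonneg hu.le (by omega)
    rw [pow_succ', aut_mul, ih (by rw [add_zsmul, one_zsmul]; grind), S.fw_apply (by grind) (by grind)]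
    abel

theorem shift_ex : ∃ s ∈ At S.u (S.xt γ) (-1) 100, ∀ r, 0 ≤ r → r ≤ (29 : ℤ) • S.u →
    s r = r + S.u := by
  have hu := S.u_pos
  obtain ⟨s, h1, h2⟩ := S.tilde γ (A := -1) (B := 40) 3 (by norm_num)
    (S.fw_mem γ (a := -1) (b := 29) (by norm_num) le_rfl (by norm_num))
  refine ⟨s, h1, fun r h3 h4 => ?_⟩
  have hz := S.z_pos
  have := S.zn_lt 5
  rw [h2 r (by push_cast; norm_num; grind), S.fw_apply]
  · unfold u; grind
  · exact h4

theorem perf_ex (j : JJ q) : ∃ α ∈ At S.u (S.xt γ) (-1) 100, ∃ β ∈ At S.u (S.xt γ) (-1) 100,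
    S.xt γ j = α * β * α⁻¹ * β⁻¹ := by
  have hu := S.u_pos
  have hz := S.z_pos
  have hz5 := S.zn_lt 5
  obtain ⟨s, h1, h2⟩ := S.tilde γ (A := -1) (B := 40) 3 (by norm_num)
    (Subgroup.pow_mem _
      (S.fw_mem γ (a := -1) (b := 29) (by norm_num) le_rfl (by norm_num)) 20)
  have hF := Subgroup.pow_mem _ (S.fw_mem γ (a := -1) (b := 29) (A := -1) (B := 37)
    (by norm_num) le_rfl (by norm_num)) 20
  have hsup := S.Mp_sup γ hF
  have e0 := S.xt_tele γ j 0 2 (-1) 100 (by norm_num) (by norm_num)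
  refine ⟨_, e0, s, h1, ?_⟩
  have hx := S.xj_sup γ j
  rw [zero_zsmul, tcj_zero, zero_add]
  norm_num
  have c1 : s * S.xj γ j * s⁻¹ = tcj ((20 : ℤ) • S.u) (S.xj γ j) := by
    rw [tcj_def]
    apply conj_eq hx
    intro r h3 h4
    rw [h2 r (by push_cast; norm_num; grind), S.fw_pow 20 _ _, tr_apply]
    · rfl
    · unfold u; grind
    · push_cast; norm_num; grind
  have c2 : s * tcj ((40 : ℤ) • S.u) (S.xj γ j) * s⁻¹ = tcj ((40 : ℤ) • S.u) (S.xj γ j) := by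
    apply conj_id (hx.tcj _)
    intro r h3 h4
    rw [h2 r (by push_cast; norm_num; grind), hsup r (Or.inr (by grind))]
  unfold xt
  generalize S.xj γ j = x at *
  generalize tcj ((40 : ℤ) • S.u) x = x40 at *
  generalize tcj ((20 : ℤ) • S.u) x = x20 at *
  have : s * (x40 * x⁻¹) * s⁻¹ = x40 * x20⁻¹ := by
    calc _ = (s * x40 * s⁻¹) * (s * x * s⁻¹)⁻¹ := by group
      _ = _ := by rw [c1, c2]
  calc x * x20⁻¹ = x * x40⁻¹ * (x40 * x20⁻¹) := by group
    _ = _ := by rw [← this]; group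

theorem gJ_mem (hγ : Subgroup.closure (Set.range γ) = ⊤) (g : Γ) : S.gJ g ∈ S.Mp γ (-10) 130 := by
  have : Subgroup.closure (Set.range γ) ≤ (S.Mp γ (-10) 130).comap S.gJh := by
    rw [Subgroup.closure_le]
    rintro _ ⟨i, rfl⟩
    refine Subgroup.subset_closure ⟨0, Sum.inr i, by norm_num, by norm_num, ?_⟩
    rw [zero_zsmul, tcj_zero]; rfl
  rw [hγ] at this
  exact this (Subgroup.mem_top g)

theorem xj_mem (j : JJ q) : S.xj γ j ∈ S.Mp γ (-10) 130 := by
  refine Subgroup.subset_closure ⟨0, j, by norm_num, by norm_num, ?_⟩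
  rw [zero_zsmul, tcj_zero]

/-- the available translations near `2` -/
def VV : AddSubgroup R where
  carrier := {v | v ∈ S.Inf ∧ ∃ m ∈ S.Mp γ (-10) 130, ∀ w ∈ S.Inf,
    m ((2 : ℤ) • S.one + w) = (2 : ℤ) • S.one + w + v}
  zero_mem' := ⟨S.Inf.zero_mem, 1, Subgroup.one_mem _, fun w _ => by rw [add_zero]; rfl⟩
  add_mem' := by
    rintro a b ⟨ha, m, hm, h⟩ ⟨hb, m', hm', h'⟩
    refine ⟨S.Inf.add_mem ha hb, m * m', Subgroup.mul_mem _ hm hm', fun w hw => ?_⟩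
    rw [aut_mul, h' w hw, add_assoc, h _ (S.Inf.add_mem hw hb)]
    abel
  neg_mem' := by
    rintro a ⟨ha, m, hm, h⟩
    refine ⟨S.Inf.neg_mem ha, m⁻¹, Subgroup.inv_mem _ hm, fun w hw => ?_⟩
    rw [aut_inv_eq, add_assoc, h _ (S.Inf.add_mem hw (S.Inf.neg_mem ha))]
    abel

theorem VV_z : S.z - S.Z S.z ∈ S.VV γ := by
  refine ⟨S.Inf.sub_mem S.z_inf (S.Z_inf _ S.z_inf), _, S.xj_mem γ (Sum.inl 2), fun w hw => ?_⟩
  have h1 := S.inf_lt _ hw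
  have h2 := S.inf_gt hw
  have h3 := S.inf_lt _ (S.Z_inf _ S.z_inf)
  exact Y_3 (a := 0) (b := (4 : ℤ) • S.one) (e := S.z) (by unfold z at *; grind) (by grind)

theorem VV_eta (hγ : Subgroup.closure (Set.range γ) = ⊤) (g : Γ) :
    S.act g S.eta - S.Z (S.act g S.eta) ∈ S.VV γ := by
  have hi := S.act_inf g _ S.eta_inf
  refine ⟨S.Inf.sub_mem hi (S.Z_inf _ hi), S.gJ g * S.xj γ (Sum.inl 3) * (S.gJ g)⁻¹,
    Subgroup.mul_mem _ (Subgroup.mul_mem _ (S.gJ_mem γ hγ g) (S.xj_mem γ _))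
      (Subgroup.inv_mem _ (S.gJ_mem γ hγ g)), fun w hw => ?_⟩
  have hw' := S.act_inf g⁻¹ _ hw
  have e1 : (S.gJ g)⁻¹ ((2 : ℤ) • S.one + w) = (2 : ℤ) • S.one + S.act g⁻¹ w := by
    have h1 := S.inf_lt _ hw'
    have h2 := S.inf_gt hw'
    rw [aut_inv_eq, S.gJ_2 g (by grind) (by grind), S.act_add, S.act_zsmul, S.act_one, map_inv,
      aut_inv_apply]
  have e2 : S.xj γ (Sum.inl 3) ((2 : ℤ) • S.one + S.act g⁻¹ w) =
      (2 : ℤ) • S.one + S.act g⁻¹ w + (S.eta - S.Z S.eta) := by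
    have h1 := S.inf_lt _ hw'
    have h2 := S.inf_gt hw'
    have h3 := S.inf_lt _ (S.Z_inf _ S.eta_inf)
    exact Y_3 (a := 0) (b := (4 : ℤ) • S.one) (e := S.eta) (by grind) (by grind)
  have hw2 := S.Inf.add_mem hw' (S.Inf.sub_mem S.eta_inf (S.Z_inf _ S.eta_inf))
  have h1 := S.inf_lt _ hw2
  have h2 := S.inf_gt hw2
  rw [aut_mul, aut_mul, e1, e2, S.gJ_2 g (by grind) (by grind), S.act_add, S.act_add, S.act_zsmul,
    S.act_one, S.act_sub, S.act_Z, map_inv, aut_inv_apply]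

theorem VV_dec (hγ : Subgroup.closure (Set.range γ) = ⊤) {w : R} (hw : w ∈ S.Inf) :
    ∃ v ∈ S.VV γ, ∃ w' ∈ S.Inf, w = v + S.Z w' := by
  obtain ⟨v, hv, w', hw', rfl⟩ := S.dec w hw
  have key : ∃ v' ∈ S.VV γ, ∃ w'' ∈ S.Inf, v = v' + S.Z w'' := by
    induction hv using AddSubgroup.closure_induction with
    | mem x hx =>
      rcases hx with hx | ⟨g, rfl⟩
      · rw [Set.mem_singleton_iff] at hx
        subst hx
        exact ⟨_, S.VV_z γ, _, S.z_inf, by unfold z; abel⟩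
      · exact ⟨_, S.VV_eta γ hγ g, _, S.act_inf g _ S.eta_inf, by simp only; abel⟩
    | zero => exact ⟨0, AddSubgroup.zero_mem _, 0, AddSubgroup.zero_mem _, by
        rw [S.Z_zero, add_zero]⟩
    | add x y _ _ hx hy =>
      by_cases hxI : x ∈ S.Inf
      · have hyI : y ∈ S.Inf := by
          have := S.Inf.sub_mem hw (S.Z_inf _ hw')
          rw [add_sub_cancel_right] at this
          have := S.Inf.sub_mem this hxI
          rwa [add_sub_cancel_left] at this
        obtain ⟨a, ha, b, hb, e⟩ := hx (S.Inf.add_mem hxI (S.Z_inf _ hw'))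
        obtain ⟨c, hc, d, hd, e'⟩ := hy (S.Inf.add_mem hyI (S.Z_inf _ hw'))
        refine ⟨a + c, AddSubgroup.add_mem _ ha hc, b + d, AddSubgroup.add_mem _ hb hd, ?_⟩
        rw [e, e', S.Z_add]; abel
      · exfalso
        apply hxI
        have : AddSubgroup.closure ({S.Z S.one} ∪ Set.range fun g => S.act g S.eta) ≤ S.Inf := by
          rw [AddSubgroup.closure_le]
          rintro _ (h | ⟨g, rfl⟩)
          · rw [Set.mem_singleton_iff] at h; rw [h]; exact S.z_inf
          · exact S.act_inf g _ S.eta_inf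
        apply this; assumption
    | neg x _ hx =>
      have hxI : x ∈ S.Inf := by
        have := S.Inf.sub_mem hw (S.Z_inf _ hw')
        rw [add_sub_cancel_right] at this
        simpa using this
      obtain ⟨a, ha, b, hb, e⟩ := hx (S.Inf.add_mem hxI (S.Z_inf _ hw'))
      refine ⟨-a, AddSubgroup.neg_mem _ ha, -b, AddSubgroup.neg_mem _ hb, ?_⟩
      rw [e, S.Z_neg]; abel
  obtain ⟨v', h1, w'', h2, rfl⟩ := key
  exact ⟨v', h1, w'' + w', S.Inf.add_mem h2 hw', by rw [S.Z_add]; abel⟩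

theorem Zpow_le (K : ℕ) : (S.Z ^ K) S.one ≤ S.one := by
  induction K with
  | zero => exact le_rfl
  | succ K ih =>
    rw [pow_succ', aut_mul]
    exact ((aut_le S.Z).2 ih).trans S.z_lt.le

theorem Zpow_pos (K : ℕ) : 0 < (S.Z ^ K) S.one := by
  induction K with
  | zero => exact S.one_pos
  | succ K ih =>
    rw [pow_succ', aut_mul]
    exact S.Z_pos ih

theorem claim (hγ : Subgroup.closure (Set.range γ) = ⊤) (K : ℕ) : ∀ w ∈ S.Inf,
    ∃ m ∈ S.Mp γ (-10) 130, ∃ w' ∈ S.Inf, ∀ δ, 0 ≤ δ → δ ≤ (3 : ℤ) • (S.Z ^ K) S.one →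
      m ((2 : ℤ) • S.one + w + δ) = (2 : ℤ) • S.one + w' + (S.Z⁻¹ ^ K) δ := by
  induction K with
  | zero => exact fun w hw => ⟨1, Subgroup.one_mem _, w, hw, fun δ _ _ => rfl⟩
  | succ K ih =>
    intro w hw
    obtain ⟨v, hv, w1, hw1, rfl⟩ := S.VV_dec γ hγ hw
    obtain ⟨hvI, m1, hm1, h1⟩ := (S.VV γ).neg_mem hv
    obtain ⟨m2, hm2, w', hw', h2⟩ := ih w1 hw1
    have hf := S.fw_mem γ (a := 0) (b := 4) (A := -10) (B := 130) (by norm_num) (by norm_num)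
      (by norm_num)
    refine ⟨m2 * (S.xj γ (Sum.inl 1) * ((S.fw 0 4 ^ 2)⁻¹ * m1)), Subgroup.mul_mem _ hm2
      (Subgroup.mul_mem _ (S.xj_mem γ _) (Subgroup.mul_mem _ (Subgroup.inv_mem _
        (Subgroup.pow_mem _ hf 2)) hm1)), w', hw', fun δ hδ hδ' => ?_⟩
    have b0 : δ ≤ (3 : ℤ) • S.z := by
      have := S.Zpow_le K
      have := (aut_le S.Z).2 this
      rw [pow_succ', aut_mul] at hδ'
      unfold z
      grind
    have hδI : δ ∈ S.Inf := S.inf_conv _ (S.Inf.zsmul_mem S.z_inf 3) _ hδ b0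
    have b1 : S.Z w1 < S.z := (aut_lt _).2 (S.inf_lt _ hw1)
    have b2 : - S.Z w1 < S.z := by
      rw [← S.Z_neg]; exact (aut_lt _).2 (S.inf_gt hw1)
    have hz := S.z_pos
    have hz5 := S.zn_lt 20
    have e1 : m1 ((2 : ℤ) • S.one + (v + S.Z w1) + δ) = (2 : ℤ) • S.one + S.Z w1 + δ := by
      rw [add_assoc ((2 : ℤ) • S.one), h1 _ (S.Inf.add_mem hw hδI)]; abel
    have e2 : (S.fw 0 4 ^ 2)⁻¹ ((2 : ℤ) • S.one + S.Z w1 + δ) = (2 : ℤ) • S.z + S.Z w1 + δ := by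
      rw [aut_inv_eq, S.fw_pow 2]
      · unfold u; push_cast; grind
      · rw [zero_zsmul]; grind
      · unfold u; push_cast; norm_num; grind
    have e3 : S.xj γ (Sum.inl 1) ((2 : ℤ) • S.z + S.Z w1 + δ) =
        (2 : ℤ) • S.one + w1 + S.Z⁻¹ δ := by
      have : S.xj γ (Sum.inl 1) = S.Y 0 ((6 : ℤ) • S.z) ((6 : ℤ) • S.one) S.six_nonneg := rfl
      have h6 : S.Z ((6 : ℤ) • S.one) = (6 : ℤ) • S.z := S.Z_zsmul 6 _
      rw [this, Y_2 (by rw [h6, zero_add]) (by grind) (by rw [h6]; grind), sub_zero, add_zero,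
        S.Zi_add, S.Zi_add, S.Zi_zsmul, aut_apply_inv]
      unfold z
      rw [aut_apply_inv]
    rw [aut_mul, aut_mul, aut_mul, e1, e2, e3, h2, pow_succ, aut_mul]
    · have := (aut_le S.Z⁻¹).2 hδ
      rwa [S.Zi_zero] at this
    · have := (aut_le S.Z⁻¹).2 hδ'
      rwa [S.Zi_zsmul, pow_succ', aut_mul, aut_apply_inv] at this

theorem Zipow_zero (K : ℕ) : (S.Z⁻¹ ^ K) 0 = 0 := by
  induction K with
  | zero => rfl
  | succ K ih => rw [pow_succ', aut_mul, ih, S.Zi_zero]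

theorem Zipow_three (K : ℕ) : (S.Z⁻¹ ^ K) ((3 : ℤ) • (S.Z ^ K) S.one) = (3 : ℤ) • S.one := by
  induction K with
  | zero => rfl
  | succ K ih =>
    rw [pow_succ, aut_mul, S.Zi_zsmul, pow_succ' S.Z, aut_mul, aut_apply_inv, ih]

theorem contr_ex (hγ : Subgroup.closure (Set.range γ) = ⊤) (r : R)
    (hr : ∃ m, inCell (la S.u) (lv S.u) m r) : ∃ i : ℤ, ∀ q', r < q' →
    ∃ c ∈ At S.u (S.xt γ) (-10) 300, ∀ x, (-1 : ℤ) • S.u ≤ x → x ≤ (100 : ℤ) • S.u →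
      r < c x + i • S.u ∧ c x + i • S.u < q' := by
  have hu := S.u_pos
  have hz := S.z_pos
  have hz5 := S.zn_lt 20
  have hbd : ∃ c : ℤ, r - c • S.one ∈ S.Inf := by
    obtain ⟨m, h1, h2⟩ := hr
    have hle : S.u ≤ S.one := by unfold u; grind
    unfold la lv at h1 h2
    rw [smul_smul, ← add_zsmul] at h1
    rw [smul_smul, ← add_zsmul, ← add_zsmul] at h2
    apply S.bdd r (310 * m.natAbs + 310)
    · refine le_trans ?_ h1
      refine le_trans ?_ (zsm_le hu (?_ : -((310 * m.natAbs + 310 : ℕ) : ℤ) ≤ _))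
      · rw [neg_zsmul, neg_zsmul]
        exact neg_le_neg (zsmul_le_zsmul_right (by omega) hle)
      · push_cast
        have := neg_abs_le m
        omega
    · refine h2.le.trans ?_
      refine le_trans (zsm_le hu (?_ : _ ≤ ((310 * m.natAbs + 310 : ℕ) : ℤ))) ?_
      · push_cast
        have := le_abs_self m
        omega
      · exact zsmul_le_zsmul_right (by omega) hle
  obtain ⟨c, hc⟩ := hbd
  refine ⟨c - 2, fun q' hq => ?_⟩
  have hw : (r - (c - 2) • S.u) - (2 : ℤ) • S.one ∈ S.Inf := by
    have e : (r - (c - 2) • S.u) - (2 : ℤ) • S.one = (r - c • S.one) + (c - 2) • S.z := by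
      unfold u
      rw [zsmul_sub, sub_zsmul, sub_zsmul]
      abel
    rw [e]
    exact S.Inf.add_mem hc (S.Inf.zsmul_mem S.z_inf _)
  obtain ⟨K, hK⟩ := S.approx (q' - r) (sub_pos.2 hq)
  obtain ⟨m, hm, w', hw', h⟩ := S.claim γ hγ K _ hw
  set p := r - (c - 2) • S.u with hp
  have ep : (2 : ℤ) • S.one + (p - (2 : ℤ) • S.one) = p := by abel
  rw [ep] at h
  have hm0 := h 0 le_rfl (zsmul_nonneg (S.Zpow_pos K).le (by norm_num))
  have hm3 := h _ (zsmul_nonneg (S.Zpow_pos K).le (by norm_num)) le_rfl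
  rw [S.Zipow_zero, add_zero, add_zero] at hm0
  rw [S.Zipow_three] at hm3
  have f1 := S.fw_mem γ (a := 3) (b := 110) (A := -10) (B := 130) (by norm_num) (by norm_num)
      (by norm_num)
  have f2 := S.fw_mem γ (a := -2) (b := 110) (A := -10) (B := 130) (by norm_num) (by norm_num)
      (by norm_num)
  obtain ⟨cc, hcc1, hcc2⟩ := S.tilde γ (A := -10) (B := 130) 7 (by norm_num)
    (Subgroup.mul_mem _ (Subgroup.inv_mem _ hm) (Subgroup.mul_mem _ (Subgroup.inv_mem _
        (Subgroup.pow_mem _ f1 102)) (Subgroup.pow_mem _ f2 6)))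
  refine ⟨cc, At_mono _ _ le_rfl (by norm_num) hcc1, fun x hx1 hx2 => ?_⟩
  rw [hcc2 x (by push_cast; norm_num; grind), aut_mul, aut_mul, S.fw_pow 6
    (by unfold u; unfold u at hx1; grind) (by push_cast; norm_num; grind)]
  push_cast
  have hF3 : (S.fw 3 110 ^ 102) ((3 : ℤ) • S.u) = (3 : ℤ) • S.u := by
    have h0 : ∀ n : ℕ, (S.fw 3 110 ^ n) ((3 : ℤ) • S.u) = (3 : ℤ) • S.u := by
      intro n
      induction n with
      | zero => rfl
      | succ n ih =>
        rw [pow_succ', aut_mul, ih]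
        exact Y_1 (zsm_le hu (by norm_num)) le_rfl
    exact h0 102
  have hF4 : (S.fw 3 110 ^ 102) ((3 : ℤ) • S.u + S.one) = (3 : ℤ) • S.u + S.one +
      (102 : ℤ) • S.u := by
    rw [S.fw_pow 102]
    · rfl
    · have := S.z_lt; grind
    · unfold u; push_cast; norm_num; grind
  generalize S.fw 3 110 ^ 102 = F at hF3 hF4 ⊢
  set y := F⁻¹ (x + (6 : ℤ) • S.u) with hy
  have hy' : F y = x + (6 : ℤ) • S.u := aut_inv_apply _ _
  have y1 : (3 : ℤ) • S.u < y := by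
    rw [← aut_lt F, hF3, hy']; grind
  have y2 : y ≤ (3 : ℤ) • S.u + S.one := by
    rw [← aut_le F, hF4, hy']
    have hle : S.u ≤ S.one := by unfold u; grind
    grind
  have i1 := S.inf_lt _ (S.Inf.add_mem hw' (S.Inf.zsmul_mem S.z_inf 3))
  have i2 := S.inf_gt hw'
  have hz' : S.Z S.one = S.z := rfl
  rw [hz'] at i1
  have q1 : p < m⁻¹ y := by
    rw [← aut_lt m, aut_inv_apply, hm0]
    unfold u at y1
    grind
  have q2 : m⁻¹ y < p + (3 : ℤ) • (S.Z ^ K) S.one := by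
    rw [← aut_lt m, aut_inv_apply, hm3]
    unfold u at y2
    grind
  constructor <;> grind

theorem core (hγ : Subgroup.closure (Set.range γ) = ⊤) : Core S.u (S.xt γ) where
  hu := S.u_pos
  sup := S.xt_sup γ
  perf := S.perf_ex γ
  shift := S.shift_ex γ
  contr := S.contr_ex γ hγ
  ne := by
    refine ⟨Sum.inl 0, fun h => ?_⟩
    have h1 : S.xt γ (Sum.inl 0) S.z = S.z := by rw [h]; rfl
    have hz := S.z_pos
    have hz5 := S.zn_lt 20
    unfold xt at h1
    rw [aut_mul, ((S.xj_sup γ _).tcj _).inv _ (Or.inl (by unfold u; grind))] at h1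
    have h2 : S.xj γ (Sum.inl 0) S.z = S.z + (S.one - S.Z S.one) :=
      Y_3 (by rw [zero_add]; rfl) (by unfold u; grind)
    rw [h2] at h1
    have := S.z_lt
    unfold z at *
    grind

end Scale

section LexF

variable {I : Type*} [LinearOrder I]

abbrev RI (I : Type*) := Lex (I →₀ ℤ)

noncomputable instance : IsOrderedAddMonoid (RI I) where
  add_le_add_left _ _ h c := add_le_add_left h c

/-- coefficient -/
def co (r : RI I) (i : I) : ℤ := ofLex r i

theorem co_ext {r s : RI I} (h : ∀ i, co r i = co s i) : r = s :=
  ofLex.injective (Finsupp.ext h)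

@[simp] theorem co_zero (i : I) : co (0 : RI I) i = 0 := rfl
@[simp] theorem co_add (r s : RI I) (i : I) : co (r + s) i = co r i + co s i := rfl
@[simp] theorem co_neg (r : RI I) (i : I) : co (-r) i = - co r i := rfl
@[simp] theorem co_sub (r s : RI I) (i : I) : co (r - s) i = co r i - co s i := rfl
@[simp] theorem co_zsmul (n : ℤ) (r : RI I) (i : I) : co (n • r) i = n * co r i := by
  let f : RI I →+ ℤ := ⟨⟨fun r => co r i, rfl⟩, fun _ _ => rfl⟩
  change f (n • r) = n * f r
  rw [map_zsmul, smul_eq_mul]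

theorem RI_lt {r s : RI I} : r < s ↔ ∃ i, (∀ j < i, co r j = co s j) ∧ co r i < co s i := Iff.rfl

/-- basis vector -/
noncomputable def eb (i : I) : RI I := toLex (Finsupp.single i 1)

theorem co_eb (i j : I) : co (eb i) j = if i = j then 1 else 0 := by
  classical
  exact Finsupp.single_apply

theorem eb_pos (i : I) : 0 < eb i := by
  rw [RI_lt]
  refine ⟨i, fun j hj => ?_, ?_⟩
  · rw [co_eb, if_neg hj.ne']; rfl
  · rw [co_eb, if_pos rfl]; exact one_pos

/-- relabelling -/
noncomputable def rlb (θ : I ≃o I) : RI I ≃o RI I where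
  toFun r := toLex (Finsupp.equivMapDomain θ.toEquiv (ofLex r))
  invFun r := toLex (Finsupp.equivMapDomain θ.symm.toEquiv (ofLex r))
  left_inv r := by
    apply co_ext; intro i
    simp [co, Finsupp.equivMapDomain_apply]
  right_inv r := by
    apply co_ext; intro i
    simp [co, Finsupp.equivMapDomain_apply]
  map_rel_iff' := by
    intro r s
    rw [← not_lt, ← not_lt, not_iff_not]
    constructor
    · rintro ⟨i, h1, h2⟩
      refine ⟨θ.symm i, fun j hj => ?_, h2⟩
      have := h1 (θ j) ((OrderIso.lt_symm_apply θ).1 hj)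
      simpa [co, Finsupp.equivMapDomain_apply] using this
    · rintro ⟨i, h1, h2⟩
      refine ⟨θ i, fun j hj => ?_, ?_⟩
      · exact h1 (θ.symm j) ((OrderIso.symm_apply_lt θ).2 hj)
      · simpa [co, Finsupp.equivMapDomain_apply] using h2

theorem co_rlb (θ : I ≃o I) (r : RI I) (i : I) : co (rlb θ r) i = co r (θ⁻¹ i) := rfl

theorem rlb_add (θ : I ≃o I) (r s : RI I) : rlb θ (r + s) = rlb θ r + rlb θ s := by
  apply co_ext; intro i
  simp [co_rlb]

theorem rlb_mul (θ η : I ≃o I) : rlb (θ * η) = rlb θ * rlb η := by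
  apply RelIso.ext; intro r
  apply co_ext; intro i
  rw [aut_mul, co_rlb, co_rlb, co_rlb, mul_inv_rev]; rfl

theorem rlb_eb (θ : I ≃o I) (i : I) : rlb θ (eb i) = eb (θ i) := by
  apply co_ext; intro j
  rw [co_rlb, co_eb, co_eb]
  have : i = θ⁻¹ j ↔ θ i = j := by rw [eq_comm, aut_inv_eq, eq_comm]
  simp only [this]

/-- elements supported after `i` -/
def small (i : I) : AddSubgroup (RI I) where
  carrier := {r | ∀ j ≤ i, co r j = 0}
  zero_mem' := fun _ _ => rfl
  add_mem' := by intro a b ha hb j hj; rw [co_add, ha j hj, hb j hj, add_zero]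
  neg_mem' := by intro a ha j hj; rw [co_neg, ha j hj, neg_zero]

theorem mem_small {i : I} {r : RI I} : r ∈ small i ↔ ∀ j ≤ i, co r j = 0 := Iff.rfl

theorem small_lt {i : I} {w : RI I} (h : w ∈ small i) : w < eb i := by
  rw [RI_lt]
  refine ⟨i, fun j hj => ?_, ?_⟩
  · rw [co_eb, if_neg hj.ne', h j hj.le]
  · rw [co_eb, if_pos rfl, h i le_rfl]; exact one_pos

theorem eb_small {i j : I} (h : i < j) : eb j ∈ small i := by
  intro k hk
  rw [co_eb, if_neg (fun e => (hk.trans_lt h).ne e.symm)]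

theorem small_conv {i : I} {a b : RI I} (ha : a ∈ small i) (h0 : 0 ≤ b) (hb : b ≤ a) :
    b ∈ small i := by
  rcases h0.eq_or_lt with h | h
  · rw [← h]; exact AddSubgroup.zero_mem _
  · obtain ⟨k, h1, h2⟩ := RI_lt.1 h
    rw [co_zero] at h2
    by_contra hcon
    have hk : k ≤ i := by
      by_contra hk
      apply hcon
      intro j hj
      exact (h1 j (hj.trans_lt (not_le.1 hk))).symm
    apply absurd hb
    rw [not_le, RI_lt]
    refine ⟨k, fun j hj => ?_, ?_⟩
    · rw [← h1 j hj, ha j (hj.le.trans hk)]; rfl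
    · rw [ha k hk]; exact h2

theorem eb_closure (D : AddSubgroup (RI I)) (r : RI I) (h : ∀ i, co r i ≠ 0 → eb i ∈ D) : r ∈ D := by
  have e : r = ∑ i ∈ (ofLex r).support, co r i • eb i := by
    apply co_ext; intro j
    have hf : ∀ (s : Finset I) (f : I → RI I), co (∑ i ∈ s, f i) j = ∑ i ∈ s, co (f i) j := by
      intro s f
      let g : RI I →+ ℤ := ⟨⟨fun r => co r j, rfl⟩, fun _ _ => rfl⟩
      exact map_sum g f s
    rw [hf]
    simp only [co_zsmul, co_eb, mul_ite, mul_one, mul_zero]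
    rw [Finset.sum_ite_eq']
    split_ifs with h
    · rfl
    · simpa [co] using h
  rw [e]
  refine AddSubgroup.sum_mem _ fun i hi => AddSubgroup.zsmul_mem _ (h i ?_) _
  simpa [co] using hi

theorem small_bdd {i : I} {r : RI I} {n : ℕ} (h1 : -(n : ℤ) • eb i ≤ r) (h2 : r ≤ (n : ℤ) • eb i) :
    r - co r i • eb i ∈ small i := by
  have key : ∀ r : RI I, 0 < r → r ≤ (n : ℤ) • eb i → ∀ j < i, co r j = 0 := by
    intro r h0 h2 j hj
    obtain ⟨k, h3, h4⟩ := RI_lt.1 h0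
    by_cases hk : k < i
    · exfalso
      apply absurd h2
      rw [not_le, RI_lt]
      refine ⟨k, fun j hj => ?_, ?_⟩
      · rw [co_zsmul, co_eb, if_neg (hj.trans hk).ne', mul_zero]; exact h3 j hj
      · rw [co_zsmul, co_eb, if_neg hk.ne', mul_zero]; exact h4
    · exact (h3 j (hj.trans_le (not_lt.1 hk))).symm
  have hz : ∀ j < i, co r j = 0 := by
    rcases lt_trichotomy r 0 with h | h | h
    · intro j hj
      have h1' : -r ≤ (n : ℤ) • eb i := by rw [neg_zsmul] at h1; exact neg_le.1 h1
      have := key (-r) (neg_pos.2 h) h1' j hj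
      rw [co_neg] at this; omega
    · intro j hj; rw [h]; rfl
    · exact key r h h2
  intro j hj
  rcases hj.eq_or_lt with rfl | h
  · rw [co_sub, co_zsmul, co_eb, if_pos rfl]; omega
  · rw [co_sub, co_zsmul, co_eb, if_neg h.ne', hz j h]; omega

end LexF

section Conc

variable (Γ : Type*) [Group Γ] [LinearOrder Γ] [MulLeftMono Γ]

abbrev SI := ℤ ×ₗ WithBot Γ

variable {Γ}

/-- shift of the level -/
def shL (k : ℤ) : SI Γ ≃o SI Γ where
  toFun s := toLex ((ofLex s).1 + k, (ofLex s).2)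
  invFun s := toLex ((ofLex s).1 - k, (ofLex s).2)
  left_inv s := by simp
  right_inv s := by simp
  map_rel_iff' := by
    intro a b
    simp [Prod.Lex.le_iff]

def botMap (g : Γ) : WithBot Γ → WithBot Γ := WithBot.map (g * ·)

theorem botMap_mul (g h : Γ) (b : WithBot Γ) : botMap (g * h) b = botMap g (botMap h b) := by
  induction b with
  | bot => rfl
  | coe b => simp [botMap, mul_assoc]

theorem botMap_one (b : WithBot Γ) : botMap 1 b = b := by
  induction b with
  | bot => rfl
  | coe b => simp [botMap]

theorem botMap_le (g : Γ) (b c : WithBot Γ) : botMap g b ≤ botMap g c ↔ b ≤ c := by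
  induction b with
  | bot => simp [botMap]
  | coe b =>
    induction c with
    | bot => simp [botMap]
    | coe c => simp [botMap]

theorem botMap_inj (g : Γ) {b c : WithBot Γ} (h : botMap g b = botMap g c) : b = c :=
  le_antisymm ((botMap_le g b c).1 h.le) ((botMap_le g c b).1 h.ge)

/-- left multiplication -/
def muL (g : Γ) : SI Γ ≃o SI Γ where
  toFun s := toLex ((ofLex s).1, botMap g (ofLex s).2)
  invFun s := toLex ((ofLex s).1, botMap g⁻¹ (ofLex s).2)
  left_inv s := by simp [← botMap_mul, botMap_one]
  right_inv s := by simp [← botMap_mul, botMap_one]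
  map_rel_iff' := by
    intro a b
    simp [Prod.Lex.le_iff, botMap_le]

def sx (k : ℤ) (b : WithBot Γ) : SI Γ := toLex (k, b)

theorem sx_lt {k l : ℤ} {b c : WithBot Γ} : sx k b < sx l c ↔ k < l ∨ k = l ∧ b < c := by
  simp [sx, Prod.Lex.lt_iff]

theorem sx_ex (s : SI Γ) : ∃ k b, s = sx k b := ⟨_, _, rfl⟩

theorem shL_sx (k l : ℤ) (b : WithBot Γ) : shL k (sx l b) = sx (l + k) b := rfl
theorem muL_sx (g : Γ) (l : ℤ) (b : WithBot Γ) : muL g (sx l b) = sx l (botMap g b) := rfl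

noncomputable def actR : Γ →* (RI (SI Γ) ≃o RI (SI Γ)) := MonoidHom.mk' (fun g => rlb (muL g)) (by
  intro g h
  rw [← rlb_mul]
  congr 1
  apply RelIso.ext; intro s
  obtain ⟨k, b, rfl⟩ := sx_ex s
  rw [aut_mul, muL_sx, muL_sx, muL_sx, botMap_mul])

theorem actR_eb (g : Γ) (l : ℤ) (b : WithBot Γ) : actR g (eb (sx l b)) = eb (sx l (botMap g b)) :=
  rlb_eb _ _

theorem shR_eb (k l : ℤ) (b : WithBot Γ) : rlb (shL k) (eb (sx l b)) = eb (sx (l + k) b) :=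
  rlb_eb _ _

theorem shR_pow (K : ℕ) (l : ℤ) (b : WithBot Γ) :
    (rlb (shL 1) ^ K) (eb (sx l b)) = eb (sx (l + K) b) := by
  induction K with
  | zero => simp [aut_one]
  | succ K ih => rw [pow_succ', aut_mul, ih, shR_eb]; push_cast; rw [add_assoc]

theorem sx_pred {s : SI Γ} (h : sx 0 ⊥ < s) : (∃ g : Γ, s = sx 0 g) ∨ s = sx 1 ⊥ ∨
    ∃ k b, s = sx (k + 1) b ∧ sx (0 : ℤ) (⊥ : WithBot Γ) < sx k b := by
  obtain ⟨k, b, rfl⟩ := sx_ex s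
  rw [sx_lt] at h
  rcases h with h | ⟨rfl, h⟩
  · by_cases h1 : k = 1
    · subst h1
      induction b with
      | bot => exact Or.inr (Or.inl rfl)
      | coe b => exact Or.inr (Or.inr ⟨0, b, rfl, by rw [sx_lt]; right; exact ⟨rfl, WithBot.bot_lt_coe b⟩⟩)
    · refine Or.inr (Or.inr ⟨k - 1, b, by rw [sub_add_cancel], ?_⟩)
      rw [sx_lt]; left; omega
  · induction b with
    | bot => exact absurd h (lt_irrefl _)
    | coe b => exact Or.inl ⟨b, rfl⟩

theorem rlb_small {θ : SI Γ ≃o SI Γ} {i : SI Γ} (h : i ≤ θ i) {w : RI (SI Γ)} (hw : w ∈ small i) :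
    rlb θ w ∈ small i := by
  intro j hj
  rw [co_rlb]
  apply hw
  have := (aut_le θ⁻¹).2 (hj.trans h)
  rwa [aut_apply_inv] at this

/-- the concrete scale structure -/
noncomputable def SC (Γ : Type*) [Group Γ] [LinearOrder Γ] [MulLeftMono Γ] :
    Scale (RI (SI Γ)) Γ where
  Z := rlb (shL 1)
  Z_add := rlb_add _
  act := actR
  act_add g := rlb_add _
  act_Z g a := by
    change rlb (muL g) (rlb (shL 1) a) = rlb (shL 1) (rlb (muL g) a)
    rw [← aut_mul, ← aut_mul, ← rlb_mul, ← rlb_mul]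
    congr 1
  one := eb (sx 0 ⊥)
  eta := eb (sx 0 (1 : Γ))
  one_pos := eb_pos _
  eta_pos := eb_pos _
  act_one g := actR_eb g 0 ⊥
  Inf := small (sx 0 ⊥)
  inf_lt w hw := small_lt hw
  eta_inf := eb_small (by rw [sx_lt]; right; exact ⟨rfl, WithBot.bot_lt_coe _⟩)
  z_inf := by rw [shR_eb]; exact eb_small (by rw [sx_lt]; left; norm_num)
  act_inf g w hw := rlb_small (by rw [muL_sx]; exact le_rfl) hw
  Z_inf w hw := rlb_small (by rw [shL_sx]; exact (by rw [sx_lt]; left; norm_num : _ < _).le) hw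
  inf_conv a ha b h0 hb := small_conv ha h0 hb
  dec w hw := by
    let D : AddSubgroup (RI (SI Γ)) :=
      AddSubgroup.closure ({rlb (shL 1) (eb (sx 0 ⊥))} ∪
        Set.range fun g : Γ => actR g (eb (sx 0 (1 : Γ)))) ⊔
      (small (sx 0 ⊥)).map (AddMonoidHom.mk' (rlb (shL 1)) (rlb_add _))
    have hD : w ∈ D := by
      apply eb_closure
      intro i hi
      have hlt : sx 0 ⊥ < i := by
        by_contra hcon
        exact hi (hw i (not_lt.1 hcon))
      rcases sx_pred hlt with ⟨g, rfl⟩ | rfl | ⟨k, b, rfl, hk⟩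
      · apply AddSubgroup.mem_sup_left
        apply AddSubgroup.subset_closure
        right
        refine ⟨g, ?_⟩
        simp only
        rw [actR_eb]
        simp [botMap]
      · apply AddSubgroup.mem_sup_left
        apply AddSubgroup.subset_closure
        left
        rw [Set.mem_singleton_iff, shR_eb]; rfl
      · apply AddSubgroup.mem_sup_right
        exact ⟨eb (sx k b), eb_small hk, shR_eb 1 k b⟩
    obtain ⟨v, hv, _, ⟨w', hw', rfl⟩, e⟩ := AddSubgroup.mem_sup.1 hD
    exact ⟨v, hv, w', hw', e.symm⟩
  approx d hd := by
    obtain ⟨i, h1, h2⟩ := RI_lt.1 hd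
    obtain ⟨k, b, rfl⟩ := sx_ex i
    refine ⟨(k + 1).toNat, le_of_lt ?_⟩
    rw [shR_pow, RI_lt]
    have hlt : sx k b < sx (0 + ((k + 1).toNat : ℤ)) ⊥ := by rw [sx_lt]; left; omega
    refine ⟨sx k b, fun j hj => ?_, ?_⟩
    · rw [co_zsmul, co_eb, if_neg (hj.trans hlt).ne', mul_zero]; exact h1 j hj
    · rw [co_zsmul, co_eb, if_neg hlt.ne', mul_zero]; exact h2
  bdd r n h1 h2 := ⟨_, small_bdd h1 h2⟩

end Conc

section Aff

variable {Γ : Type*} [Group Γ] [LinearOrder Γ] [MulLeftMono Γ]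

/-- the linear maps -/
noncomputable def lin (k : ℤ) (g : Γ) : RI (SI Γ) ≃o RI (SI Γ) := rlb (shL k * muL g)

theorem lin_eb (k : ℤ) (g : Γ) (l : ℤ) (b : WithBot Γ) :
    lin k g (eb (sx l b)) = eb (sx (l + k) (botMap g b)) := rlb_eb _ _

theorem lin_mul (k l : ℤ) (g h : Γ) : lin k g * lin l h = lin (k + l) (g * h) := by
  unfold lin
  rw [← rlb_mul]
  congr 1
  apply RelIso.ext; intro s
  obtain ⟨j, b, rfl⟩ := sx_ex s
  simp only [aut_mul, muL_sx, shL_sx, botMap_mul]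
  congr 1; ring

theorem lin_zero : lin 0 (1 : Γ) = 1 := by
  have h := lin_mul 0 0 (1 : Γ) 1
  rw [add_zero, mul_one] at h
  exact mul_eq_left.1 h

theorem lin_inv (k : ℤ) (g : Γ) : (lin k g)⁻¹ = lin (-k) g⁻¹ := by
  rw [inv_eq_iff_mul_eq_one, lin_mul, add_neg_cancel, mul_inv_cancel, lin_zero]

theorem lin_add (k : ℤ) (g : Γ) (r s : RI (SI Γ)) : lin k g (r + s) = lin k g r + lin k g s :=
  rlb_add _ _ _

theorem lin_sub (k : ℤ) (g : Γ) (r s : RI (SI Γ)) : lin k g (r - s) = lin k g r - lin k g s :=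
  map_sub (AddMonoidHom.mk' (lin k g) (lin_add k g)) r s

theorem SC_Z : (SC Γ).Z = lin 1 1 := by
  change rlb _ = rlb _
  congr 1
  apply RelIso.ext; intro s
  obtain ⟨j, b, rfl⟩ := sx_ex s
  rw [aut_mul, muL_sx, botMap_one]

theorem SC_Zi : (SC Γ).Z⁻¹ = lin (-1) 1 := by rw [SC_Z, lin_inv, inv_one]

theorem SC_act (g : Γ) : (SC Γ).act g = lin 0 g := by
  change rlb _ = rlb _
  congr 1
  apply RelIso.ext; intro s
  obtain ⟨j, b, rfl⟩ := sx_ex s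
  rw [aut_mul, muL_sx, shL_sx, add_zero]

def Sim (T : Set (RI (SI Γ))) (r s : RI (SI Γ)) : Prop := ∀ t ∈ T, t ≤ r ↔ t ≤ s

theorem Sim.symm {T : Set (RI (SI Γ))} {r s : RI (SI Γ)} (h : Sim T r s) : Sim T s r :=
  fun t ht => (h t ht).symm

def Aff (T : Set (RI (SI Γ))) (f : RI (SI Γ) ≃o RI (SI Γ)) : Prop :=
  ∀ r, ∃ k g, ∀ s, Sim T r s → f s - f r = lin k g (s - r)

theorem Aff.mono {S T : Set (RI (SI Γ))} {f : RI (SI Γ) ≃o RI (SI Γ)} (h : Aff S f) (hST : S ⊆ T) :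
    Aff T f := by
  intro r
  obtain ⟨k, g, hk⟩ := h r
  exact ⟨k, g, fun s hs => hk s fun t ht => hs t (hST ht)⟩

theorem Aff.one (T : Set (RI (SI Γ))) : Aff T 1 :=
  fun r => ⟨0, 1, fun s _ => by rw [lin_zero]; rfl⟩

theorem Aff.mul {S T : Set (RI (SI Γ))} {f g : RI (SI Γ) ≃o RI (SI Γ)} (hf : Aff S f) (hg : Aff T g) :
    Aff (T ∪ g ⁻¹' S) (f * g) := by
  intro r
  obtain ⟨k, a, hk⟩ := hg r
  obtain ⟨l, b, hl⟩ := hf (g r)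
  refine ⟨l + k, b * a, fun s hs => ?_⟩
  have h1 := hk s fun t ht => hs t (Or.inl ht)
  have h2 := hl (g s) fun t ht => by
    have := hs (g⁻¹ t) (Or.inr (by rw [Set.mem_preimage, aut_inv_apply]; exact ht))
    rwa [← aut_le g, ← aut_le g (s := s), aut_inv_apply] at this
  rw [aut_mul, aut_mul, h2, h1, ← lin_mul, aut_mul]

theorem Aff.inv {T : Set (RI (SI Γ))} {f : RI (SI Γ) ≃o RI (SI Γ)} (hf : Aff T f) :
    Aff ((f⁻¹ : RI (SI Γ) ≃o RI (SI Γ)) ⁻¹' T) f⁻¹ := by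
  intro r
  obtain ⟨k, a, hk⟩ := hf (f⁻¹ r)
  refine ⟨-k, a⁻¹, fun s hs => ?_⟩
  have h2 := hk (f⁻¹ s) fun t ht => by
    have := hs (f t) (by rw [Set.mem_preimage, aut_apply_inv]; exact ht)
    rwa [← aut_le f⁻¹, ← aut_le f⁻¹ (s := s), aut_apply_inv] at this
  rw [aut_inv_apply, aut_inv_apply] at h2
  rw [h2, ← aut_mul, ← lin_inv, inv_mul_cancel, aut_one]

/-- piecewise affine maps with finitely many breakpoints -/
noncomputable def PLs (Γ : Type*) [Group Γ] [LinearOrder Γ] [MulLeftMono Γ] :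
    Subgroup (RI (SI Γ) ≃o RI (SI Γ)) where
  carrier := {f | ∃ T : Set (RI (SI Γ)), T.Finite ∧ Aff T f}
  one_mem' := ⟨∅, Set.finite_empty, Aff.one _⟩
  mul_mem' := by
    rintro f g ⟨S, hS, hf⟩ ⟨T, hT, hg⟩
    exact ⟨_, hT.union (hS.preimage g.injective.injOn), hf.mul hg⟩
  inv_mem' := by
    rintro f ⟨S, hS, hf⟩
    exact ⟨_, hS.preimage (f⁻¹).injective.injOn, hf.inv⟩

theorem tr_PLs (c : RI (SI Γ)) : tr c ∈ PLs Γ := by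
  refine ⟨∅, Set.finite_empty, fun r => ⟨0, 1, fun s _ => ?_⟩⟩
  rw [lin_zero, aut_one, tr_apply, tr_apply]; abel

theorem X_PLs (a e : RI (SI Γ)) (he : 0 ≤ e) : (SC Γ).X a e he ∈ PLs Γ := by
  refine ⟨{a, a + (SC Γ).Z e}, by simp, fun r => ?_⟩
  have hz := (SC Γ).Z_nonneg he
  have ht : ∀ s, Sim {a, a + (SC Γ).Z e} r s → (a ≤ r ↔ a ≤ s) ∧
      (a + (SC Γ).Z e ≤ r ↔ a + (SC Γ).Z e ≤ s) := fun s hs => ⟨hs _ (by simp), hs _ (by simp)⟩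
  by_cases h1 : a ≤ r
  · by_cases h2 : a + (SC Γ).Z e ≤ r
    · refine ⟨0, 1, fun s hs => ?_⟩
      rw [lin_zero, aut_one, (SC Γ).X_3 he h2, (SC Γ).X_3 he ((ht s hs).2.1 h2)]; abel
    · refine ⟨-1, 1, fun s hs => ?_⟩
      rw [(SC Γ).X_2 he h1 (le_of_not_ge h2), (SC Γ).X_2 he ((ht s hs).1.1 h1)
        (le_of_not_ge (mt (ht s hs).2.2 h2)), SC_Zi, lin_sub, lin_sub, lin_sub]; abel
  · refine ⟨0, 1, fun s hs => ?_⟩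
    rw [lin_zero, aut_one, (SC Γ).X_1 he (le_of_not_ge h1),
      (SC Γ).X_1 he (le_of_not_ge (mt (ht s hs).1.2 h1))]

theorem gJ_PLs (g : Γ) : (SC Γ).gJ g ∈ PLs Γ := by
  refine ⟨{0, (8 : ℤ) • (SC Γ).one}, by simp, fun r => ?_⟩
  have ht : ∀ s, Sim {0, (8 : ℤ) • (SC Γ).one} r s → (0 ≤ r ↔ 0 ≤ s) ∧
      ((8 : ℤ) • (SC Γ).one ≤ r ↔ (8 : ℤ) • (SC Γ).one ≤ s) :=
    fun s hs => ⟨hs _ (by simp), hs _ (by simp)⟩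
  by_cases h1 : 0 ≤ r
  · by_cases h2 : (8 : ℤ) • (SC Γ).one ≤ r
    · refine ⟨0, 1, fun s hs => ?_⟩
      rw [lin_zero, aut_one, (SC Γ).gJ_3 g h2, (SC Γ).gJ_3 g ((ht s hs).2.1 h2)]
    · refine ⟨0, g, fun s hs => ?_⟩
      rw [(SC Γ).gJ_2 g h1 (le_of_not_ge h2), (SC Γ).gJ_2 g ((ht s hs).1.1 h1)
        (le_of_not_ge (mt (ht s hs).2.2 h2)), SC_act, lin_sub]
  · refine ⟨0, 1, fun s hs => ?_⟩
    rw [lin_zero, aut_one, (SC Γ).gJ_1 g (le_of_not_ge h1),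
      (SC Γ).gJ_1 g (le_of_not_ge (mt (ht s hs).1.2 h1))]

/-- elements with levels at most `n` -/
def Lev (Γ : Type*) [Group Γ] [LinearOrder Γ] [MulLeftMono Γ] (n : ℕ) : AddSubgroup (RI (SI Γ)) where
  carrier := {r | ∀ k b, (n : ℤ) < k → co r (sx k b) = 0}
  zero_mem' := fun _ _ _ => rfl
  add_mem' := by intro a b ha hb j c hj; rw [co_add, ha j c hj, hb j c hj, add_zero]
  neg_mem' := by intro a ha j c hj; rw [co_neg, ha j c hj, neg_zero]

theorem Lev_mono {m n : ℕ} (h : m ≤ n) {r : RI (SI Γ)} (hr : r ∈ Lev Γ m) : r ∈ Lev Γ n :=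
  fun k b hk => hr k b (by omega)

theorem Lev_ex (r : RI (SI Γ)) : ∃ n, r ∈ Lev Γ n := by
  let D : AddSubgroup (RI (SI Γ)) := 
    { carrier := {r | ∃ n, r ∈ Lev Γ n}
      zero_mem' := ⟨0, zero_mem _⟩
      add_mem' := by
        rintro a b ⟨m, hm⟩ ⟨n, hn⟩
        exact ⟨max m n, add_mem (Lev_mono (le_max_left _ _) hm) (Lev_mono (le_max_right _ _) hn)⟩
      neg_mem' := by rintro a ⟨m, hm⟩; exact ⟨m, neg_mem hm⟩ }
  apply eb_closure D r
  intro i _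
  obtain ⟨j, b, rfl⟩ := sx_ex i
  refine ⟨j.toNat, fun k c hk => ?_⟩
  rw [co_eb, if_neg]
  intro h
  have : j = k := congrArg (fun s => (ofLex s).1) h
  omega

theorem lin_Lev {k : ℤ} {g : Γ} {n m : ℕ} (h : (n : ℤ) + k ≤ m) {r : RI (SI Γ)} (hr : r ∈ Lev Γ n) :
    lin k g r ∈ Lev Γ m := by
  intro l b hl
  rw [lin, co_rlb]
  have : (shL k * muL g : SI Γ ≃o SI Γ)⁻¹ (sx l b) = sx (l - k) (botMap g⁻¹ b) := by
    rw [aut_inv_eq, aut_mul, muL_sx, shL_sx, ← botMap_mul, mul_inv_cancel, botMap_one,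
      sub_add_cancel]
  rw [this]
  exact hr _ _ (by omega)

/-- maps which distort levels boundedly -/
noncomputable def LVs (Γ : Type*) [Group Γ] [LinearOrder Γ] [MulLeftMono Γ] :
    Subgroup (RI (SI Γ) ≃o RI (SI Γ)) where
  carrier := {f | ∃ D : ℕ, ∀ n : ℕ, ∀ r ∈ Lev Γ n, f r ∈ Lev Γ (n + D) ∧ f⁻¹ r ∈ Lev Γ (n + D)}
  one_mem' := ⟨0, fun n r hr => ⟨hr, by rw [inv_one]; exact hr⟩⟩
  mul_mem' := by
    rintro f g ⟨S, hf⟩ ⟨T, hg⟩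
    refine ⟨S + T, fun n r hr => ⟨?_, ?_⟩⟩
    · rw [aut_mul]
      have := (hf _ _ (hg _ _ hr).1).1
      rwa [add_assoc, add_comm T] at this
    · rw [mul_inv_rev, aut_mul]
      have := (hg _ _ (hf _ _ hr).2).2
      rwa [add_assoc] at this
  inv_mem' := by
    rintro f ⟨S, hf⟩
    exact ⟨S, fun n r hr => ⟨(hf n r hr).2, by rw [inv_inv]; exact (hf n r hr).1⟩⟩

theorem tr_LVs (c : RI (SI Γ)) : tr c ∈ LVs Γ := by
  obtain ⟨D, hD⟩ := Lev_ex c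
  refine ⟨D, fun n r hr => ?_⟩
  have h1 := Lev_mono (Nat.le_add_left D n) hD
  have h2 := Lev_mono (Nat.le_add_right n D) hr
  constructor
  · rw [tr_apply]; exact add_mem h2 h1
  · have : (tr c)⁻¹ r = r - c := by rw [aut_inv_eq, tr_apply, sub_add_cancel]
    rw [this]; exact sub_mem h2 h1

theorem X_LVs (a e : RI (SI Γ)) (he : 0 ≤ e) : (SC Γ).X a e he ∈ LVs Γ := by
  obtain ⟨D, hD⟩ := Lev_ex a
  obtain ⟨E, hE⟩ := Lev_ex e
  have hz := (SC Γ).Z_nonneg he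
  have hZ : ∀ {n m : ℕ}, n + 1 ≤ m → ∀ {r}, r ∈ Lev Γ n → (SC Γ).Z r ∈ Lev Γ m := by
    intro n m h r hr
    rw [SC_Z]; exact lin_Lev (by omega) hr
  have hZi : ∀ {n m : ℕ}, n + 1 ≤ m → ∀ {r}, r ∈ Lev Γ n → (SC Γ).Z⁻¹ r ∈ Lev Γ m := by
    intro n m h r hr
    rw [SC_Zi]; exact lin_Lev (by omega) hr
  refine ⟨D + E + 1, fun n r hr => ?_⟩
  have a0 := Lev_mono (show D ≤ n + D + E by omega) hD
  have e0 := Lev_mono (show E ≤ n + D + E by omega) hE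
  have r0 := Lev_mono (show n ≤ n + D + E by omega) hr
  have hh : n + D + E ≤ n + (D + E + 1) := by omega
  have hh' : n + D + E + 1 ≤ n + (D + E + 1) := by omega
  constructor
  · rcases le_total r a with h1 | h1
    · rw [(SC Γ).X_1 he h1]; exact Lev_mono hh r0
    · rcases le_total r (a + (SC Γ).Z e) with h2 | h2
      · rw [(SC Γ).X_2 he h1 h2]
        exact add_mem (hZi hh' (sub_mem r0 a0)) (Lev_mono hh a0)
      · rw [(SC Γ).X_3 he h2]
        exact add_mem (Lev_mono hh r0) (sub_mem (Lev_mono hh e0) (hZ hh' e0))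
  · rcases le_total r a with h1 | h1
    · rw [(SC Γ).Xi_1 he h1]; exact Lev_mono hh r0
    · rcases le_total r (a + e) with h2 | h2
      · rw [(SC Γ).Xi_2 he h1 h2]
        exact add_mem (hZ hh' (sub_mem r0 a0)) (Lev_mono hh a0)
      · rw [(SC Γ).Xi_3 he h2]
        exact sub_mem (Lev_mono hh r0) (sub_mem (Lev_mono hh e0) (hZ hh' e0))

theorem gJ_LVs (g : Γ) : (SC Γ).gJ g ∈ LVs Γ := by
  have key : ∀ g : Γ, ∀ n, ∀ r ∈ Lev Γ n, (SC Γ).gJ g r ∈ Lev Γ n := by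
    intro g n r hr
    rcases le_total r 0 with h1 | h1
    · rw [(SC Γ).gJ_1 g h1]; exact hr
    · rcases le_total r ((8 : ℤ) • (SC Γ).one) with h2 | h2
      · rw [(SC Γ).gJ_2 g h1 h2, SC_act]; exact lin_Lev (by omega) hr
      · rw [(SC Γ).gJ_3 g h2]; exact hr
  refine ⟨0, fun n r hr => ⟨key g n r hr, ?_⟩⟩
  have : ((SC Γ).gJ g)⁻¹ = (SC Γ).gJ g⁻¹ := (map_inv (SC Γ).gJh g).symm
  rw [this]; exact key _ n r hr

/-- any subgroup containing the basic maps contains the family -/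
theorem xt_mem (N : Subgroup (RI (SI Γ) ≃o RI (SI Γ))) (hT : ∀ c, tr c ∈ N)
    (hX : ∀ a e he, (SC Γ).X a e he ∈ N) (hG : ∀ g, (SC Γ).gJ g ∈ N) {q : ℕ} (γ : Fin q → Γ)
    (j : Scale.JJ q) : (SC Γ).xt γ j ∈ N := by
  have hY : ∀ a b e he, (SC Γ).Y a b e he ∈ N := fun a b e he => N.mul_mem (hX _ _ _) (N.inv_mem (hX _ _ _))
  have hx : (SC Γ).xj γ j ∈ N := by
    rcases j with j | j
    · fin_cases j <;> exact hY _ _ _ _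
    · exact hG _
  unfold Scale.xt
  rw [tcj_def]
  exact N.mul_mem hx (N.inv_mem (N.mul_mem (N.mul_mem (hT _) hx) (N.inv_mem (hT _))))

theorem xt_PLs {q : ℕ} (γ : Fin q → Γ) (j : Scale.JJ q) : (SC Γ).xt γ j ∈ PLs Γ :=
  xt_mem _ tr_PLs X_PLs gJ_PLs γ j

theorem xt_LVs {q : ℕ} (γ : Fin q → Γ) (j : Scale.JJ q) : (SC Γ).xt γ j ∈ LVs Γ :=
  xt_mem _ tr_LVs X_LVs gJ_LVs γ j

end Aff

section WP

variable {Γ : Type*} [Group Γ] [LinearOrder Γ] [MulLeftMono Γ]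

noncomputable abbrev uu (Γ : Type*) [Group Γ] [LinearOrder Γ] [MulLeftMono Γ] : RI (SI Γ) := (SC Γ).u
noncomputable abbrev cv (Γ : Type*) [Group Γ] [LinearOrder Γ] [MulLeftMono Γ] : RI (SI Γ) := lv (uu Γ)

theorem cv_pos : 0 < cv Γ := lv_pos (SC Γ).u_pos

def cell (m : ℤ) (r : RI (SI Γ)) : Prop := inCell (la (uu Γ)) (cv Γ) m r

theorem cell_shift {m : ℤ} {r : RI (SI Γ)} (d : ℤ) : cell (m + d) (r + d • cv Γ) ↔ cell m r :=
  inCell_shift d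

theorem cell_add {m : ℤ} {r x : RI (SI Γ)} (h : cell m r) (h0 : 0 ≤ x) (h1 : x ≤ cv Γ) :
    cell m (r + x) ∨ cell (m + 1) (r + x) := by
  by_cases hh : r + x < la (uu Γ) + m • cv Γ + cv Γ
  · left; exact ⟨h.1.trans (le_add_of_nonneg_right h0), hh⟩
  · right
    have e : (m + 1) • cv Γ = m • cv Γ + cv Γ := by rw [add_zsmul, one_zsmul]
    refine ⟨?_, ?_⟩
    · rw [e, ← add_assoc]; exact not_lt.1 hh
    · rw [e, ← add_assoc]; exact add_lt_add_of_lt_of_le h.2 h1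

theorem cell_sub {m : ℤ} {r x : RI (SI Γ)} (h : cell m r) (h0 : 0 ≤ x) (h1 : x ≤ cv Γ) :
    cell m (r - x) ∨ cell (m - 1) (r - x) := by
  have := cell_add h (sub_nonneg.2 h1) (sub_le_self _ h0)
  have e : r + (cv Γ - x) = r - x + (1 : ℤ) • cv Γ := by rw [one_zsmul]; abel
  rw [e] at this
  rcases this with h | h
  · right; rwa [← cell_shift 1, sub_add_cancel]
  · left; rwa [cell_shift 1] at h

theorem nu_bd {n : ℕ} (hn : n < 310) : 0 ≤ (n : ℤ) • uu Γ ∧ (n : ℤ) • uu Γ ≤ cv Γ :=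
  ⟨zsmul_nonneg (SC Γ).u_pos.le (by omega), zsm_le (SC Γ).u_pos (by omega)⟩

/-- letters -/
def IsL (f : RI (SI Γ) ≃o RI (SI Γ)) : Prop :=
  ∃ (n : ℕ) (C : ℤ → Bool) (k : KC (uu Γ)), n < 310 ∧ (C = chi ∨ C = fun _ => true) ∧ k.1 ∈ PLs Γ ∧
    k.1 ∈ LVs Γ ∧ f = tcj ((n : ℤ) • uu Γ) (PP cv_pos C k)

theorem IsL.inv {f : RI (SI Γ) ≃o RI (SI Γ)} (h : IsL f) : IsL f⁻¹ := by
  obtain ⟨n, C, k, hn, hC, h1, h2, rfl⟩ := h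
  refine ⟨n, C, k⁻¹, hn, hC, inv_mem h1, inv_mem h2, ?_⟩
  rw [map_inv, map_inv]

theorem IsL.out {f : RI (SI Γ) ≃o RI (SI Γ)} (h : IsL f) {r : RI (SI Γ)} (hr : ¬ ∃ m, cell m r) :
    f r = r := by
  obtain ⟨n, C, k, hn, hC, h1, h2, rfl⟩ := h
  rw [tcj_apply, PP_out, sub_add_cancel]
  rintro ⟨m, hm⟩
  have h := cell_add hm (nu_bd (Γ := Γ) hn).1 (nu_bd hn).2
  rw [sub_add_cancel] at h
  rcases h with h | h
  · exact hr ⟨_, h⟩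
  · exact hr ⟨_, h⟩

theorem IsL.eqv {f : RI (SI Γ) ≃o RI (SI Γ)} (h : IsL f) {r : RI (SI Γ)} {m d : ℤ} (hr : cell m r)
    (hd : ∀ i : ℤ, |i| ≤ 1 → chi (m + d + i) = chi (m + i)) :
    f (r + d • cv Γ) = f r + d • cv Γ ∧ ∃ m', |m' - m| ≤ 1 ∧ cell m' (f r) := by
  obtain ⟨n, C, k, hn, hC, h1, h2, rfl⟩ := h
  have h0 : ∃ m0, (m0 = m ∨ m0 = m - 1) ∧ cell m0 (r - (n : ℤ) • uu Γ) := by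
    rcases cell_sub hr (nu_bd (Γ := Γ) hn).1 (nu_bd hn).2 with h | h
    · exact ⟨_, Or.inl rfl, h⟩
    · exact ⟨_, Or.inr rfl, h⟩
  obtain ⟨m0, hm0, hc⟩ := h0
  have hCd : C (m0 + d) = C m0 := by
    rcases hC with rfl | rfl
    · rcases hm0 with rfl | rfl
      · have := hd 0 (by norm_num)
        simpa using this
      · have := hd (-1) (by norm_num)
        rw [show m - 1 + d = m + d + -1 by ring, this]; rfl
    · rfl
  have e : r + d • cv Γ - (n : ℤ) • uu Γ = r - (n : ℤ) • uu Γ + d • cv Γ := by abel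
  have hc' : cell (m0 + d) (r - (n : ℤ) • uu Γ + d • cv Γ) := (cell_shift d).2 hc
  rw [tcj_apply, tcj_apply, e]
  constructor
  · cases hb : C m0
    · rw [PP_off C k hc hb, PP_off C k hc' (hCd.trans hb)]; abel
    · rw [PP_in C k hc hb, PP_in C k hc' (hCd.trans hb), add_zsmul]
      rw [show r - (n : ℤ) • uu Γ + d • cv Γ - (m0 • cv Γ + d • cv Γ) = r - (n : ℤ) • uu Γ - m0 • cv Γ by
        abel]
      abel
  · have h3 : cell m0 (PP cv_pos C k (r - (n : ℤ) • uu Γ)) := inCell_PP C k hc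
    rcases cell_add h3 (nu_bd (Γ := Γ) hn).1 (nu_bd hn).2 with h | h
    · exact ⟨_, by rcases hm0 with rfl | rfl <;> simp, h⟩
    · exact ⟨_, by rcases hm0 with rfl | rfl <;> simp, h⟩

theorem uu_Lev : uu Γ ∈ Lev Γ 1 := by
  have h1 : (SC Γ).one ∈ Lev Γ 1 := by
    intro k b hk
    change co (eb _) _ = 0
    rw [co_eb, if_neg]
    intro h
    have : (0 : ℤ) = k := congrArg (fun s => (ofLex s).1) h
    push_cast at hk; omega
  have h0 : (SC Γ).one ∈ Lev Γ 0 := by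
    intro k b hk
    change co (eb _) _ = 0
    rw [co_eb, if_neg]
    intro h
    have : (0 : ℤ) = k := congrArg (fun s => (ofLex s).1) h
    push_cast at hk; omega
  refine sub_mem h1 ?_
  change (SC Γ).Z (SC Γ).one ∈ _
  rw [SC_Z]
  exact lin_Lev (by norm_num) h0

theorem cv_Lev : cv Γ ∈ Lev Γ 1 := zsmul_mem uu_Lev _

theorem IsL.lev {f : RI (SI Γ) ≃o RI (SI Γ)} (h : IsL f) :
    ∃ D : ℕ, ∀ n : ℕ, ∀ r ∈ Lev Γ n, f r ∈ Lev Γ (n + D) := by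
  obtain ⟨n, C, k, hn, hC, h1, ⟨D, h2⟩, rfl⟩ := h
  refine ⟨D + 1, fun l r hr => ?_⟩
  rw [tcj_apply]
  have hu : (n : ℤ) • uu Γ ∈ Lev Γ (l + 1) := zsmul_mem (Lev_mono (by omega) uu_Lev) _
  have hr' : r - (n : ℤ) • uu Γ ∈ Lev Γ (l + 1) := sub_mem (Lev_mono (by omega) hr) hu
  refine add_mem ?_ (Lev_mono (by omega) hu)
  by_cases hc : ∃ m, cell m (r - (n : ℤ) • uu Γ)
  · obtain ⟨m, hm⟩ := hc
    have hmv : m • cv Γ ∈ Lev Γ (l + 1) := zsmul_mem (Lev_mono (by omega) cv_Lev) _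
    cases hb : C m
    · rw [PP_off C k hm hb]; exact Lev_mono (by omega) hr'
    · rw [PP_in C k hm hb]
      refine add_mem ?_ (Lev_mono (by omega) hmv)
      have := (h2 _ _ (sub_mem hr' hmv)).1
      exact Lev_mono (by omega) this
  · rw [PP_out C k hc]; exact Lev_mono (by omega) hr'

/-- all translates of a set of breakpoints -/
def TB (B : Set (RI (SI Γ))) : Set (RI (SI Γ)) := {t | ∃ β ∈ B, ∃ m : ℤ, t = β + m • cv Γ}

theorem IsL.aff {f : RI (SI Γ) ≃o RI (SI Γ)} (h : IsL f) : ∃ B : Set (RI (SI Γ)), B.Finite ∧ B.Nonempty ∧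
    (∀ β ∈ B, ∃ c : ℤ, |c| ≤ 1 ∧ cell c β) ∧ Aff (TB B) f := by
  obtain ⟨n, C, k, hn, hC, ⟨B0, hB0, hA⟩, h2, rfl⟩ := h
  have hc0 : cell 0 (la (uu Γ)) := ⟨by simp, by simpa using cv_pos⟩
  let B1 : Set (RI (SI Γ)) := insert (la (uu Γ)) (B0 ∩ {β | cell 0 β})
  refine ⟨(fun β => β + (n : ℤ) • uu Γ) '' B1, ?_, ?_, ?_, ?_⟩
  · exact ((hB0.inter_of_left _).insert _).image _
  · exact ⟨_, _, Or.inl rfl, rfl⟩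
  · rintro _ ⟨β, hβ, rfl⟩
    have hc : cell 0 β := by
      rcases hβ with rfl | hβ
      · exact hc0
      · exact hβ.2
    rcases cell_add hc (nu_bd (Γ := Γ) hn).1 (nu_bd hn).2 with h | h
    · exact ⟨_, by norm_num, h⟩
    · exact ⟨_, by norm_num, h⟩
  · intro r
    set r' := r - (n : ℤ) • uu Γ with hr'
    have hS : ∀ s, Sim (TB ((fun β => β + (n : ℤ) • uu Γ) '' B1)) r s →
        ∀ β ∈ B1, ∀ m : ℤ, β + m • cv Γ ≤ r' ↔ β + m • cv Γ ≤ s - (n : ℤ) • uu Γ := by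
      intro s hs β hβ m
      have := hs (β + (n : ℤ) • uu Γ + m • cv Γ) ⟨_, ⟨β, hβ, rfl⟩, m, rfl⟩
      rw [hr', le_sub_iff_add_le, le_sub_iff_add_le, add_right_comm]
      exact this
    have hcell : ∀ s, Sim (TB ((fun β => β + (n : ℤ) • uu Γ) '' B1)) r s →
        ∀ m, cell m r' ↔ cell m (s - (n : ℤ) • uu Γ) := by
      intro s hs m
      have h1 := hS s hs _ (Or.inl rfl) m
      have h2 := hS s hs _ (Or.inl rfl) (m + 1)
      rw [add_zsmul, one_zsmul, ← add_assoc, ← not_lt, ← not_lt, not_iff_not] at h2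
      exact and_congr h1 h2
    have hid : (∀ s, Sim (TB ((fun β => β + (n : ℤ) • uu Γ) '' B1)) r s →
        PP cv_pos C k (s - (n : ℤ) • uu Γ) = s - (n : ℤ) • uu Γ) →
        ∃ k' g, ∀ s, Sim (TB ((fun β => β + (n : ℤ) • uu Γ) '' B1)) r s →
          tcj ((n : ℤ) • uu Γ) (PP cv_pos C k) s - tcj ((n : ℤ) • uu Γ) (PP cv_pos C k) r
          = lin k' g (s - r) := by
      intro h
      refine ⟨0, 1, fun s hs => ?_⟩
      rw [tcj_apply, tcj_apply, h s hs, h r (fun _ _ => Iff.rfl), lin_zero, aut_one]; abel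
    by_cases hc : ∃ m, cell m r'
    · obtain ⟨m, hm⟩ := hc
      cases hb : C m
      · exact hid fun s hs => PP_off C k ((hcell s hs m).1 hm) hb
      · obtain ⟨k', g, hk⟩ := hA (r' - m • cv Γ)
        refine ⟨k', g, fun s hs => ?_⟩
        have hms := (hcell s hs m).1 hm
        have := hk (s - (n : ℤ) • uu Γ - m • cv Γ) (by
          intro t ht
          by_cases htc : cell 0 t
          · exact (le_sub_iff_add_le.trans (hS s hs t (Or.inr ⟨ht, htc⟩) m)).trans
              le_sub_iff_add_le.symm
          · have e : (0 : ℤ) • cv Γ = 0 := zero_zsmul _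
            unfold cell inCell at htc
            rw [e, add_zero, not_and_or, not_le, not_lt] at htc
            have h1 := hm.1
            have h2 := hm.2
            have h3 := hms.1
            have h4 := hms.2
            rcases htc with htc | htc
            · constructor
              · intro _; grind
              · intro _; grind
            · constructor
              · intro _; exfalso; grind
              · intro _; exfalso; grind)
        rw [tcj_apply, tcj_apply, PP_in C k hm hb, PP_in C k hms hb]
        rw [show s - (n : ℤ) • uu Γ - m • cv Γ - (r' - m • cv Γ) = s - r by rw [hr']; abel] at this
        rw [← this]; abel
    · refine hid fun s hs => PP_out C k ?_
      rintro ⟨m, hm⟩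
      exact hc ⟨m, (hcell s hs m).2 hm⟩

end WP

section WP2

variable {Γ : Type*} [Group Γ] [LinearOrder Γ] [MulLeftMono Γ]

/-- products of letters -/
theorem prod_eqv (l : List (RI (SI Γ) ≃o RI (SI Γ))) (hl : ∀ f ∈ l, IsL f) {r : RI (SI Γ)} {m d : ℤ}
    (hr : cell m r) (ρ : ℕ) (hρ : l.length ≤ ρ)
    (hd : ∀ i : ℤ, |i| ≤ ρ → chi (m + d + i) = chi (m + i)) :
    l.prod (r + d • cv Γ) = l.prod r + d • cv Γ ∧ ∃ m', |m' - m| ≤ l.length ∧ cell m' (l.prod r) := by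
  induction l with
  | nil => exact ⟨rfl, m, by simp, hr⟩
  | cons f l ih =>
    rw [List.length_cons] at hρ
    obtain ⟨h1, m', h2, h3⟩ := ih (fun g hg => hl g (List.mem_cons_of_mem _ hg)) (by omega)
    rw [abs_le] at h2
    obtain ⟨h4, m'', h5, h6⟩ := (hl f List.mem_cons_self).eqv (d := d) h3 (by
      intro i hi
      rw [abs_le] at hi
      have := hd (m' - m + i) (by rw [abs_le]; constructor <;> omega)
      rw [show m' + d + i = m + d + (m' - m + i) by ring, this]; congr 1; ring)
    rw [abs_le] at h5
    rw [List.prod_cons, aut_mul, aut_mul, h1]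
    refine ⟨h4, m'', ?_, h6⟩
    rw [List.length_cons, abs_le]; push_cast; constructor <;> omega

theorem prod_inv_ex (l : List (RI (SI Γ) ≃o RI (SI Γ))) (hl : ∀ f ∈ l, IsL f) :
    ∃ l' : List (RI (SI Γ) ≃o RI (SI Γ)), (∀ f ∈ l', IsL f) ∧ l'.length = l.length ∧
      l.prod⁻¹ = l'.prod := by
  refine ⟨(l.map fun f => f⁻¹).reverse, ?_, by simp, List.prod_inv_reverse l⟩
  intro f hf
  rw [List.mem_reverse, List.mem_map] at hf
  obtain ⟨g, hg, rfl⟩ := hf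
  exact (hl g hg).inv

theorem prod_out (l : List (RI (SI Γ) ≃o RI (SI Γ))) (hl : ∀ f ∈ l, IsL f) {r : RI (SI Γ)}
    (hr : ¬ ∃ m, cell m r) : l.prod r = r := by
  induction l with
  | nil => rfl
  | cons f l ih =>
    rw [List.prod_cons, aut_mul, ih (fun g hg => hl g (List.mem_cons_of_mem _ hg)),
      (hl f List.mem_cons_self).out hr]

/-- breakpoints of a product -/
def TT (B : Set (RI (SI Γ))) : List (RI (SI Γ) ≃o RI (SI Γ)) → Set (RI (SI Γ))
  | [] => ∅
  | _ :: l => TT B l ∪ l.prod ⁻¹' TB B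

theorem TT_aff (B : Set (RI (SI Γ))) (l : List (RI (SI Γ) ≃o RI (SI Γ)))
    (hl : ∀ f ∈ l, Aff (TB B) f) : Aff (TT B l) l.prod := by
  induction l with
  | nil => exact Aff.one _
  | cons f l ih =>
    rw [List.prod_cons]
    exact (hl f List.mem_cons_self).mul (ih fun g hg => hl g (List.mem_cons_of_mem _ hg))

theorem TT_ex (B : Set (RI (SI Γ))) (l : List (RI (SI Γ) ≃o RI (SI Γ))) {t : RI (SI Γ)}
    (ht : t ∈ TT B l) : ∃ s, s <:+ l ∧ s.prod t ∈ TB B := by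
  induction l with
  | nil => exact absurd ht (Set.notMem_empty _)
  | cons f l ih =>
    rcases ht with ht | ht
    · obtain ⟨s, h1, h2⟩ := ih ht
      exact ⟨s, h1.trans (List.suffix_cons f l), h2⟩
    · exact ⟨l, List.suffix_cons f l, ht⟩

theorem TB_max {B : Set (RI (SI Γ))} (hB : B.Finite) (hne : B.Nonempty)
    (hc : ∀ β ∈ B, ∃ c : ℤ, |c| ≤ 1 ∧ cell c β) {r : RI (SI Γ)} (hr : ∃ m, cell m r) :
    ∃ p ∈ TB B, p ≤ r ∧ ∀ t ∈ TB B, t ≤ r → t ≤ p := by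
  obtain ⟨m, hm⟩ := hr
  have key : ∀ β ∈ B, ∃ j : ℤ, β + j • cv Γ ≤ r ∧ ∀ i : ℤ, β + i • cv Γ ≤ r → β + i • cv Γ ≤ β + j • cv Γ := by
    intro β hβ
    obtain ⟨c, -, hc⟩ := hc β hβ
    have hv := cv_pos (Γ := Γ)
    have h1 := hm.1
    have h2 := hm.2
    have h3 := hc.1
    have h4 := hc.2
    have e1 : (m - c) • cv Γ = m • cv Γ - c • cv Γ := by
      rw [sub_zsmul]; abel
    have e2 : (m - c - 1) • cv Γ = m • cv Γ - c • cv Γ - cv Γ := by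
      rw [sub_zsmul, sub_zsmul, one_zsmul]; abel
    have e3 : (m - c + 1) • cv Γ = m • cv Γ - c • cv Γ + cv Γ := by
      rw [add_zsmul, sub_zsmul, one_zsmul]; abel
    have hlt : ∀ i : ℤ, β + i • cv Γ ≤ r → i ≤ m - c := by
      intro i hi
      by_contra hcon
      have : (m - c + 1) • cv Γ ≤ i • cv Γ := zsm_le hv (by omega)
      grind
    by_cases hh : β + (m - c) • cv Γ ≤ r
    · exact ⟨m - c, hh, fun i hi => add_le_add_right (zsm_le hv (hlt i hi)) _⟩
    · refine ⟨m - c - 1, by grind, fun i hi => add_le_add_right (zsm_le hv ?_) _⟩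
      have := hlt i hi
      by_contra hcon
      have : i = m - c := by omega
      subst this
      exact hh hi
  choose! j hj1 hj2 using key
  obtain ⟨β, hβ, hmax⟩ := Set.exists_max_image B (fun β => β + j β • cv Γ) hB hne
  refine ⟨_, ⟨β, hβ, j β, rfl⟩, hj1 β hβ, ?_⟩
  rintro _ ⟨β', hβ', i, rfl⟩ hi
  exact (hj2 β' hβ' i hi).trans (hmax β' hβ')

theorem TT_max {B : Set (RI (SI Γ))} (hB : B.Finite) (hne : B.Nonempty)
    (hc : ∀ β ∈ B, ∃ c : ℤ, |c| ≤ 1 ∧ cell c β) {r : RI (SI Γ)} (hr : ∃ m, cell m r)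
    (l : List (RI (SI Γ) ≃o RI (SI Γ))) (hl : ∀ f ∈ l, IsL f) (hl0 : l ≠ []) :
    ∃ p ∈ TT B l, p ≤ r ∧ ∀ t ∈ TT B l, t ≤ r → t ≤ p := by
  induction l with
  | nil => exact absurd rfl hl0
  | cons f l ih =>
    have hl' : ∀ f ∈ l, IsL f := fun g hg => hl g (List.mem_cons_of_mem _ hg)
    have hr' : ∃ m, cell m (l.prod r) := by
      obtain ⟨m, hm⟩ := hr
      obtain ⟨_, m', _, h⟩ := prod_eqv l hl' (d := 0) hm l.length le_rfl (by simp)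
      exact ⟨m', h⟩
    obtain ⟨b, hb, hbr, hbm⟩ := TB_max hB hne hc hr'
    have h1 : l.prod⁻¹ b ∈ TT B (f :: l) := Or.inr (by rw [Set.mem_preimage, aut_inv_apply]; exact hb)
    have h2 : l.prod⁻¹ b ≤ r := by rw [← aut_le l.prod, aut_inv_apply]; exact hbr
    have h3 : ∀ t, l.prod t ∈ TB B → t ≤ r → t ≤ l.prod⁻¹ b := by
      intro t ht htr
      rw [← aut_le l.prod, aut_inv_apply]
      exact hbm _ ht ((aut_le _).2 htr)
    by_cases h0 : l = []
    · refine ⟨_, h1, h2, ?_⟩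
      rintro t (ht | ht) htr
      · rw [h0] at ht; exact absurd ht (Set.notMem_empty _)
      · exact h3 t ht htr
    · obtain ⟨p, hp, hpr, hpm⟩ := ih hl' h0
      rcases le_total p (l.prod⁻¹ b) with h | h
      · refine ⟨_, h1, h2, ?_⟩
        rintro t (ht | ht) htr
        · exact (hpm t ht htr).trans h
        · exact h3 t ht htr
      · refine ⟨_, Or.inl hp, hpr, ?_⟩
        rintro t (ht | ht) htr
        · exact hpm t ht htr
        · exact (h3 t ht htr).trans h

theorem Lev_gap {n : ℕ} {t : RI (SI Γ)} (ht : t ∈ Lev Γ n) (h0 : 0 < t) (K : ℤ) (hK : (n : ℤ) < K) :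
    eb (sx K ((1 : Γ) : WithBot Γ)) < t := by
  obtain ⟨i, h1, h2⟩ := RI_lt.1 h0
  obtain ⟨j, b, rfl⟩ := sx_ex i
  have hj : j ≤ n := by
    by_contra hcon
    rw [ht j b (by omega)] at h2
    exact lt_irrefl _ h2
  have hne : ∀ s ≤ sx j b, sx K ((1 : Γ) : WithBot Γ) ≠ s := by
    rintro s hs rfl
    have : sx j b < sx K ((1 : Γ) : WithBot Γ) := by rw [sx_lt]; left; omega
    exact absurd hs (not_le.2 this)
  rw [RI_lt]
  refine ⟨sx j b, fun s hs => ?_, ?_⟩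
  · rw [co_eb, if_neg (hne s hs.le)]; exact h1 s hs
  · rw [co_eb, if_neg (hne _ le_rfl)]; exact h2

theorem lin_fix {k : ℤ} {g : Γ} {K : ℤ} (h : lin k g (eb (sx K ((1 : Γ) : WithBot Γ))) = eb (sx K ((1 : Γ) : WithBot Γ))) :
    lin k g = 1 := by
  rw [lin_eb] at h
  have h1 := congrArg (fun r => co r (sx K ((1 : Γ) : WithBot Γ))) h
  simp only [co_eb, if_true] at h1
  have h2 : sx (K + k) (botMap g ((1 : Γ) : WithBot Γ)) = sx K ((1 : Γ) : WithBot Γ) := by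
    by_contra hcon
    rw [if_neg hcon] at h1
    exact absurd h1 (by norm_num)
  have h3 : K + k = K := congrArg (fun s => (ofLex s).1) h2
  have h4 : botMap g ((1 : Γ) : WithBot Γ) = ((1 : Γ) : WithBot Γ) := congrArg (fun s => (ofLex s).2) h2
  have h5 : g = 1 := by
    change ((g * 1 : Γ) : WithBot Γ) = _ at h4
    rw [mul_one] at h4
    exact WithBot.coe_injective h4
  have h6 : k = 0 := by omega
  rw [h5, h6, lin_zero]

theorem prod_lev (D : ℕ) (l : List (RI (SI Γ) ≃o RI (SI Γ)))
    (hl : ∀ f ∈ l, ∀ n : ℕ, ∀ r ∈ Lev Γ n, f⁻¹ r ∈ Lev Γ (n + D)) :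
    ∀ n : ℕ, ∀ r ∈ Lev Γ n, l.prod⁻¹ r ∈ Lev Γ (n + D * l.length) := by
  induction l with
  | nil => intro n r hr; simpa using hr
  | cons f l ih =>
    intro n r hr
    rw [List.prod_cons, mul_inv_rev, aut_mul]
    have := ih (fun g hg => hl g (List.mem_cons_of_mem _ hg)) _ _ (hl f List.mem_cons_self n r hr)
    refine Lev_mono ?_ this
    rw [List.length_cons, mul_add, mul_one]; omega

theorem one_Lev : eb (sx (0 : ℤ) (⊥ : WithBot Γ)) ∈ Lev Γ 0 := by
  intro k b hk
  rw [co_eb, if_neg]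
  intro h
  have : (0 : ℤ) = k := congrArg (fun s => (ofLex s).1) h
  push_cast at hk; omega

theorem wp_aux {B : Set (RI (SI Γ))} (hB : B.Finite) (hne : B.Nonempty)
    (hc : ∀ β ∈ B, ∃ c : ℤ, |c| ≤ 1 ∧ cell c β) (D n0 : ℕ) (hn0 : ∀ β ∈ B, β ∈ Lev Γ (n0 + 1))
    (l : List (RI (SI Γ) ≃o RI (SI Γ))) (hl : ∀ f ∈ l, IsL f)
    (hA : ∀ f ∈ l, Aff (TB B) f)
    (hD : ∀ f ∈ l, ∀ n : ℕ, ∀ r ∈ Lev Γ n, f⁻¹ r ∈ Lev Γ (n + D)) (K : ℕ)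
    (hK : n0 + 1 + D * l.length < K) (ρ : ℕ) (hρ : 2 * l.length + 3 ≤ ρ)
    (test : ∀ s, s <:+ l → ∀ β ∈ B, ∀ m : ℤ, 0 ≤ m → m < 2 ^ (2 * ρ + 3) →
      l.prod (s.prod⁻¹ (β + m • cv Γ)) = s.prod⁻¹ (β + m • cv Γ) ∧
      l.prod (s.prod⁻¹ (β + m • cv Γ) + eb (sx (K : ℤ) ((1 : Γ) : WithBot Γ))) =
        s.prod⁻¹ (β + m • cv Γ) + eb (sx (K : ℤ) ((1 : Γ) : WithBot Γ))) : l.prod = 1 := by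
  apply RelIso.ext; intro r
  rw [aut_one]
  by_cases hr : ∃ m, cell m r
  swap
  · exact prod_out l hl hr
  by_cases hl0 : l = []
  · rw [hl0]; rfl
  obtain ⟨p, hp, hpr, hpm⟩ := TT_max hB hne hc hr l hl hl0
  set e := eb (sx (K : ℤ) ((1 : Γ) : WithBot Γ)) with he
  have he0 : 0 < e := eb_pos _
  have hlev : ∀ t ∈ TT B l, t ∈ Lev Γ (n0 + 1 + D * l.length) := by
    intro t ht
    obtain ⟨s, hs, β, hβ, m, hm⟩ := TT_ex B l ht
    have e1 : t = s.prod⁻¹ (β + m • cv Γ) := by rw [← hm, aut_apply_inv]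
    rw [e1]
    refine Lev_mono ?_ (prod_lev D s (fun f hf => hD f (hs.subset hf)) (n0 + 1) _
      (add_mem (hn0 β hβ) (zsmul_mem (Lev_mono (by omega) cv_Lev) _)))
    have := Nat.mul_le_mul_left D hs.length_le
    omega
  have hfix : l.prod p = p ∧ l.prod (p + e) = p + e := by
    obtain ⟨s, hs, β, hβ, m, hm⟩ := TT_ex B l hp
    have e1 : p = s.prod⁻¹ (β + m • cv Γ) := by rw [← hm, aut_apply_inv]
    have hsl := hs.length_le
    obtain ⟨m', h1, h2, h3⟩ := chi_window ρ m
    obtain ⟨t1, t2⟩ := test s hs β hβ m' h1 h2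
    obtain ⟨c, hc1, hc2⟩ := hc β hβ
    obtain ⟨s', hs', hlen, hprod⟩ := prod_inv_ex s (fun f hf => hl f (hs.subset hf))
    rw [abs_le] at hc1
    have win : ∀ x : ℤ, |x - m| ≤ s.length + 2 → ∀ i : ℤ, |i| ≤ l.length →
        chi (x + (m' - m) + i) = chi (x + i) := by
      intro x hx i hi
      rw [abs_le] at hx hi
      have := h3 (x - m + i) (by rw [abs_le]; constructor <;> omega)
      rw [show x + (m' - m) + i = m' + (x - m + i) by ring, this]; congr 1; ring
    have hcm : cell (c + m) (β + m • cv Γ) := (cell_shift m).2 hc2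
    obtain ⟨q1, x, q2, q3⟩ := prod_eqv s' hs' (d := m' - m) hcm l.length (by omega)
      (win (c + m) (by rw [abs_le]; constructor <;> omega))
    rw [← hprod] at q1 q3
    rw [← e1] at q1 q3
    rw [show β + m • cv Γ + (m' - m) • cv Γ = β + m' • cv Γ by rw [sub_zsmul]; abel] at q1
    rw [q1] at t1 t2
    rw [abs_le] at q2
    have hev : e < cv Γ := Lev_gap cv_Lev cv_pos _ (by push_cast; omega)
    constructor
    · obtain ⟨y1, -⟩ := prod_eqv l hl (d := m' - m) q3 l.length le_rfl
        (win x (by rw [abs_le]; constructor <;> omega))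
      rw [t1] at y1
      exact (add_right_cancel y1).symm
    · have hx : ∃ x', |x' - m| ≤ s.length + 2 ∧ cell x' (p + e) := by
        rcases cell_add q3 he0.le hev.le with h | h
        · exact ⟨_, by rw [abs_le]; constructor <;> omega, h⟩
        · exact ⟨_, by rw [abs_le]; constructor <;> omega, h⟩
      obtain ⟨x', hx1, hx2⟩ := hx
      obtain ⟨y1, -⟩ := prod_eqv l hl (d := m' - m) hx2 l.length le_rfl (win x' hx1)
      rw [show p + e + (m' - m) • cv Γ = p + (m' - m) • cv Γ + e by abel, t2] at y1
      rw [show p + (m' - m) • cv Γ + e = p + e + (m' - m) • cv Γ by abel] at y1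
      exact (add_right_cancel y1).symm
  obtain ⟨k, g, hkg⟩ := TT_aff B l hA p
  have s1 := hkg (p + e) (by
    intro t ht
    constructor
    · intro h; exact h.trans (le_add_of_nonneg_right he0.le)
    · intro h
      by_contra hcon
      have := Lev_gap (sub_mem (hlev t ht) (hlev p hp)) (sub_pos.2 (not_le.1 hcon)) K
        (by exact_mod_cast hK)
      rw [← he] at this
      exact absurd (lt_sub_iff_add_lt'.1 this) (not_lt.2 h))
  have s2 := hkg r (fun t ht => ⟨fun h => h.trans hpr, fun h => hpm t ht h⟩)
  rw [hfix.1, hfix.2, add_sub_cancel_left] at s1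
  rw [lin_fix s1.symm, aut_one, hfix.1] at s2
  exact sub_left_injective s2

/-- the word problem test -/
theorem wp {ι : Type*} [Finite ι] [Nonempty ι] (F : ι → (RI (SI Γ) ≃o RI (SI Γ))) (hF : ∀ i, IsL (F i)) :
    ∃ (B : List (RI (SI Γ))) (D n0 : ℕ), ∀ w : List ι,
      (∀ s, s <:+ w → ∀ β ∈ B, ∀ m : ℕ, m < 2 ^ (4 * w.length + 9) →
        (w.map F).prod ((s.map F).prod⁻¹ (β + (m : ℤ) • cv Γ)) = (s.map F).prod⁻¹ (β + (m : ℤ) • cv Γ) ∧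
        (w.map F).prod ((s.map F).prod⁻¹ (β + (m : ℤ) • cv Γ) +
          eb (sx ((n0 + D * w.length : ℕ) : ℤ) ((1 : Γ) : WithBot Γ))) =
        (s.map F).prod⁻¹ (β + (m : ℤ) • cv Γ) +
          eb (sx ((n0 + D * w.length : ℕ) : ℤ) ((1 : Γ) : WithBot Γ))) → (w.map F).prod = 1 := by
  have hA := fun i => (hF i).aff
  choose B0 hfin hne hc hA using hA
  have hD := fun i => (hF i).inv.lev
  choose D0 hD using hD
  let B : Set (RI (SI Γ)) := ⋃ i, B0 i
  have hBfin : B.Finite := Set.finite_iUnion hfin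
  have hcB : ∀ β ∈ B, ∃ c : ℤ, |c| ≤ 1 ∧ cell c β := by
    intro β hβ
    obtain ⟨i, hi⟩ := Set.mem_iUnion.1 hβ
    exact hc i β hi
  obtain ⟨D, hDm⟩ : ∃ D, ∀ i, D0 i ≤ D := by
    obtain ⟨D, hD⟩ := (Set.finite_range D0).bddAbove
    exact ⟨D, fun i => hD ⟨i, rfl⟩⟩
  obtain ⟨n0, hn0⟩ : ∃ n, ∀ β ∈ B, β ∈ Lev Γ (n + 1) := by
    choose f hf using fun β : RI (SI Γ) => Lev_ex β
    obtain ⟨D, hD⟩ := (hBfin.image f).bddAbove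
    exact ⟨D, fun β hβ => Lev_mono ((hD ⟨β, hβ, rfl⟩).trans (Nat.le_succ D)) (hf β)⟩
  refine ⟨hBfin.toFinset.toList, D, n0 + 2, fun w test => ?_⟩
  refine wp_aux (B := B) hBfin ?_ hcB D n0 hn0 (w.map F) ?_ ?_ ?_ (n0 + 2 + D * w.length) ?_
    (2 * w.length + 3) ?_ ?_
  · obtain ⟨i⟩ := (inferInstance : Nonempty ι)
    obtain ⟨β, hβ⟩ := hne i
    exact ⟨β, Set.mem_iUnion.2 ⟨i, hβ⟩⟩
  · intro f hf
    obtain ⟨i, _, rfl⟩ := List.mem_map.1 hf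
    exact hF i
  · intro f hf
    obtain ⟨i, _, rfl⟩ := List.mem_map.1 hf
    refine (hA i).mono ?_
    rintro _ ⟨β, hβ, m, rfl⟩
    exact ⟨β, Set.mem_iUnion.2 ⟨i, hβ⟩, m, rfl⟩
  · intro f hf n r hr
    obtain ⟨i, _, rfl⟩ := List.mem_map.1 hf
    exact Lev_mono (Nat.add_le_add_left (hDm i) n) (hD i n r hr)
  · rw [List.length_map]; omega
  · rw [List.length_map]
  · intro s hs β hβ m hm0 hm
    obtain ⟨s0, hs0, rfl⟩ : ∃ s0, s0 <:+ w ∧ s = s0.map F := by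
      obtain ⟨t, ht⟩ := hs
      obtain ⟨t1, s1, e, rfl, rfl⟩ := List.append_eq_map_iff.1 ht
      exact ⟨s1, ⟨t1, e.symm⟩, rfl⟩
    obtain ⟨n, rfl⟩ := Int.eq_ofNat_of_zero_le hm0
    refine test s0 hs0 β (by simpa using hβ) n ?_
    rw [show 2 * (2 * w.length + 3) + 3 = 4 * w.length + 9 by ring] at hm
    exact_mod_cast hm

end WP2

section RCode

variable {I Ci α : Type*} [LinearOrder I] [Primcodable Ci] [Primcodable α] (K : CO I Ci)

/-- value of a signed term -/
noncomputable def tev (t : Ci × Bool) : RI I := cond t.2 (eb (K.ev t.1)) (-eb (K.ev t.1))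

/-- value of a code -/
noncomputable def rev (c : List (Ci × Bool)) : RI I := (c.map (tev K)).sum

def rneg (c : List (Ci × Bool)) : List (Ci × Bool) := c.map fun t => (t.1, !t.2)

theorem rev_nil : rev K [] = 0 := rfl

theorem rev_cons (t : Ci × Bool) (c : List (Ci × Bool)) : rev K (t :: c) = tev K t + rev K c := by
  unfold rev; rw [List.map_cons, List.sum_cons]

theorem rev_append (c d : List (Ci × Bool)) : rev K (c ++ d) = rev K c + rev K d := by
  unfold rev; rw [List.map_append, List.sum_append]

theorem rev_neg (c : List (Ci × Bool)) : rev K (rneg c) = - rev K c := by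
  induction c with
  | nil => simp [rneg, rev_nil]
  | cons t c ih =>
    have : rneg (t :: c) = (t.1, !t.2) :: rneg c := rfl
    rw [this, rev_cons, rev_cons, ih, neg_add]
    congr 1
    obtain ⟨a, b⟩ := t
    cases b <;> simp [tev]

theorem comp_rneg {f : α → List (Ci × Bool)} (hf : Computable f) :
    Computable fun a => rneg (f a) :=
  CT.list_map hf (Computable.pair (Computable.fst.comp Computable.snd)
    (CT.bnot (Computable.snd.comp Computable.snd)))

/-- net coefficient -/
def ncf (c : List (Ci × Bool)) (i : Ci) : ℤ :=
  ((c.countP fun t => K.eqb t.1 i && t.2 : ℕ) : ℤ) - (c.countP fun t => K.eqb t.1 i && !t.2 : ℕ)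

theorem ncf_spec (c : List (Ci × Bool)) (i : Ci) : ncf K c i = co (rev K c) (K.ev i) := by
  induction c with
  | nil => simp [ncf, rev_nil]
  | cons t c ih =>
    rw [rev_cons, co_add, ← ih]
    unfold ncf
    rw [List.countP_cons, List.countP_cons]
    obtain ⟨a, b⟩ := t
    have h := K.eqb_iff a i
    by_cases hh : K.ev a = K.ev i
    · rw [h.2 hh]
      cases b <;> simp [tev, co_eb, hh] <;> ring
    · have h' : K.eqb a i = false := by rw [← Bool.not_eq_true, h]; exact hh
      rw [h']
      cases b <;> simp [tev, co_eb, hh]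

theorem comp_ncf {f : α → List (Ci × Bool)} {g : α → Ci} (hf : Computable f) (hg : Computable g) :
    Computable fun a => ncf K (f a) (g a) := by
  have h1 : Computable fun p : α × (Ci × Bool) => K.eqb p.2.1 (g p.1) :=
    K.comp_eq (Computable.fst.comp Computable.snd) (hg.comp Computable.fst)
  have h2 : Computable fun p : α × (Ci × Bool) => p.2.2 := Computable.snd.comp Computable.snd
  exact CT.intSub (CT.natCast (CT.list_countP hf (CT.band h1 h2)))
    (CT.natCast (CT.list_countP hf (CT.band h1 (CT.bnot h2))))

theorem ncf_bd (c : List (Ci × Bool)) (i : Ci) : |ncf K c i| ≤ c.length := by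
  have h1 := List.countP_le_length (p := fun t : Ci × Bool => K.eqb t.1 i && t.2) (l := c)
  have h2 := List.countP_le_length (p := fun t : Ci × Bool => K.eqb t.1 i && !t.2) (l := c)
  unfold ncf
  rw [abs_le]
  constructor <;> omega

theorem co_ne (c : List (Ci × Bool)) (j : I) (h : co (rev K c) j ≠ 0) : ∃ t ∈ c, K.ev t.1 = j := by
  by_contra hh
  apply h
  induction c with
  | nil => rfl
  | cons t c ih =>
    push Not at hh
    have h1 : co (rev K c) j = 0 := by
      by_contra h2
      exact h2 (ih h2 fun ⟨t, ht, e⟩ => hh t (List.mem_cons_of_mem _ ht) e)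
    have h3 := hh t List.mem_cons_self
    rw [rev_cons, co_add, h1, add_zero]
    obtain ⟨a, b⟩ := t
    cases b <;> simp [tev, co_eb, h3]

def rpos (e : List (Ci × Bool)) : Bool :=
  e.any fun t => decide (0 < ncf K e t.1) && e.all fun s => !K.ltb s.1 t.1 || decide (ncf K e s.1 = 0)

theorem rpos_spec (e : List (Ci × Bool)) : rpos K e = true ↔ 0 < rev K e := by
  unfold rpos
  rw [List.any_eq_true, RI_lt]
  constructor
  · rintro ⟨t, ht, h⟩
    rw [Bool.and_eq_true, decide_eq_true_iff, ncf_spec, List.all_eq_true] at h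
    refine ⟨K.ev t.1, fun j hj => ?_, h.1⟩
    rw [co_zero]
    by_contra hne
    obtain ⟨s, hs, rfl⟩ := co_ne K e j (Ne.symm hne)
    have := h.2 s hs
    rw [(K.spec _ _).2 hj, ncf_spec] at this
    simp only [Bool.not_true, Bool.false_or, decide_eq_true_iff] at this
    exact hne this.symm
  · rintro ⟨i, h1, h2⟩
    obtain ⟨t, ht, rfl⟩ := co_ne K e i (by rw [co_zero] at h2; exact h2.ne')
    refine ⟨t, ht, ?_⟩
    rw [Bool.and_eq_true, decide_eq_true_iff, ncf_spec, List.all_eq_true]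
    refine ⟨h2, fun s _ => ?_⟩
    by_cases h3 : K.ltb s.1 t.1 = true
    · have := h1 _ ((K.spec _ _).1 h3)
      rw [co_zero] at this
      rw [ncf_spec, ← this]; simp
    · simp [h3]

theorem comp_rpos {f : α → List (Ci × Bool)} (hf : Computable f) :
    Computable fun a => rpos K (f a) := by
  refine CT.list_any hf (CT.band (CT.intLt (Computable.const 0) (comp_ncf K (hf.comp Computable.fst)
    (Computable.fst.comp Computable.snd))) ?_)
  refine CT.list_all (hf.comp Computable.fst) (CT.bor (CT.bnot (K.comp_lt ?_ ?_)) (CT.intEq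
    (comp_ncf K (hf.comp (Computable.fst.comp Computable.fst)) ?_) (Computable.const 0)))
  · exact Computable.fst.comp Computable.snd
  · exact Computable.fst.comp (Computable.snd.comp Computable.fst)
  · exact Computable.fst.comp Computable.snd

noncomputable def coR : CO (RI I) (List (Ci × Bool)) where
  ev := rev K
  surj r := by
    let D : AddSubgroup (RI I) :=
      { carrier := Set.range (rev K)
        zero_mem' := ⟨[], rfl⟩
        add_mem' := by
          rintro _ _ ⟨c, rfl⟩ ⟨d, rfl⟩
          exact ⟨c ++ d, rev_append K c d⟩
        neg_mem' := by
          rintro _ ⟨c, rfl⟩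
          exact ⟨rneg c, rev_neg K c⟩ }
    refine eb_closure D r fun i _ => ?_
    obtain ⟨c, rfl⟩ := K.surj i
    exact ⟨[(c, true)], by simp [rev, tev]⟩
  ltb c d := rpos K (d ++ rneg c)
  comp := comp_rpos K (Computable.list_append.comp Computable.snd (comp_rneg Computable.fst))
  spec c d := by
    rw [rpos_spec, rev_append, rev_neg, ← sub_eq_add_neg, sub_pos]

/-- integer multiples -/
def rsm (m : ℤ) (c : List (Ci × Bool)) : List (Ci × Bool) :=
  if 0 ≤ m then (List.range m.toNat).flatMap fun _ => c
  else (List.range (-m).toNat).flatMap fun _ => rneg c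

theorem rev_range (n : ℕ) (c : List (Ci × Bool)) :
    rev K ((List.range n).flatMap fun _ => c) = (n : ℤ) • rev K c := by
  induction n with
  | zero => simp [rev_nil]
  | succ n ih =>
    rw [List.range_succ, List.flatMap_append, rev_append, ih]
    simp [add_zsmul]

theorem rev_rsm (m : ℤ) (c : List (Ci × Bool)) : rev K (rsm m c) = m • rev K c := by
  unfold rsm
  split_ifs with h
  · rw [rev_range, Int.toNat_of_nonneg h]
  · rw [rev_range, Int.toNat_of_nonneg (by omega), rev_neg, neg_zsmul, zsmul_neg, neg_neg]

theorem comp_rsm {f : α → ℤ} {g : α → List (Ci × Bool)} (hf : Computable f) (hg : Computable g) :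
    Computable fun a => rsm (f a) (g a) :=
  CT.ite_bool (CT.intLe (Computable.const 0) hf)
    (CT.list_flatMap (CT.list_range (CT.intToNat hf)) (hg.comp Computable.fst))
    (CT.list_flatMap (CT.list_range (CT.intToNatNeg hf)) (comp_rneg (hg.comp Computable.fst)))

end RCode

theorem comp_chi : Computable chi := by
  have h3 : Computable fun n : ℤ => 3 * n + 1 :=
    (CT.intAdd (CT.intAdd Computable.id (CT.intAdd Computable.id Computable.id))
      (Computable.const 1)).of_eq fun n => by simp only [id]; ring
  have ha : Computable fun n : ℤ => (3 * n + 1).natAbs :=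
    (CT.natAdd (CT.intToNat h3) (CT.intToNatNeg h3)).of_eq fun n => by omega
  have hmod : ∀ {β : Type} [Primcodable β] {f g : β → ℕ}, Computable f → Computable g →
      Computable fun b => f b % g b := fun hf hg => (Primrec.nat_mod.to_comp).comp hf hg
  have hk : Computable fun p : ℤ × ℕ => p.2 := Computable.snd
  have hb : Computable fun p : ℤ × ℕ => (3 * p.1 + 1).natAbs := ha.comp Computable.fst
  refine CT.list_any (CT.list_range (CT.natAdd ha (Computable.const 1)))
    (CT.band (CT.natEq (hmod hk (Computable.const 2)) (Computable.const 0))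
      (CT.band (CT.natEq (hmod hb (CT.natPow (Computable.const 2) hk)) (Computable.const 0))
      (CT.bnot (CT.natEq (hmod hb (CT.natPow (Computable.const 2)
        (CT.natAdd hk (Computable.const 1)))) (Computable.const 0)))))

section Real

variable {Γ : Type} [Group Γ] [LinearOrder Γ] [MulLeftMono Γ] {q : ℕ}

abbrev WC (q : ℕ) := List (Fin q × Bool)
abbrev IC (q : ℕ) := ℤ × Option (WC q)
abbrev RC (q : ℕ) := List (IC q × Bool)

variable (KW : CO Γ (WC q))

noncomputable def KI : CO (SI Γ) (IC q) := coLex coInt (coBot KW)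

theorem KI_none (k : ℤ) : (KI KW).ev (k, none) = sx k ⊥ := rfl
theorem KI_some (k : ℤ) (w : WC q) : (KI KW).ev (k, some w) = sx k ((KW.ev w : Γ) : WithBot Γ) := rfl

noncomputable def KR : CO (RI (SI Γ)) (RC q) := coR (KI KW)

theorem KR_ev (c : RC q) : (KR KW).ev c = rev (KI KW) c := rfl

/-- computably realized functions -/
def CRf (f : RI (SI Γ) → RI (SI Γ)) : Prop :=
  ∃ F : RC q → RC q, Computable F ∧ ∀ c, (KR KW).ev (F c) = f ((KR KW).ev c)

theorem CRf.comp {f g : RI (SI Γ) → RI (SI Γ)} (hf : CRf KW f) (hg : CRf KW g) :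
    CRf KW (fun r => f (g r)) := by
  obtain ⟨F, hF, hF'⟩ := hf
  obtain ⟨G, hG, hG'⟩ := hg
  exact ⟨fun c => F (G c), hF.comp hG, fun c => by rw [hF', hG']⟩

theorem CRf.id : CRf KW (fun r => r) := ⟨fun c => c, Computable.id, fun _ => rfl⟩

theorem CRf.const (s : RI (SI Γ)) : CRf KW (fun _ => s) := by
  obtain ⟨c, hc⟩ := (KR KW).surj s
  exact ⟨fun _ => c, Computable.const c, fun _ => hc⟩

theorem CRf.add {f g : RI (SI Γ) → RI (SI Γ)} (hf : CRf KW f) (hg : CRf KW g) :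
    CRf KW (fun r => f r + g r) := by
  obtain ⟨F, hF, hF'⟩ := hf
  obtain ⟨G, hG, hG'⟩ := hg
  refine ⟨fun c => F c ++ G c, Computable.list_append.comp hF hG, fun c => ?_⟩
  beta_reduce
  rw [← hF', ← hG', KR_ev, rev_append]; rfl

theorem CRf.neg {f : RI (SI Γ) → RI (SI Γ)} (hf : CRf KW f) : CRf KW (fun r => - f r) := by
  obtain ⟨F, hF, hF'⟩ := hf
  refine ⟨fun c => rneg (F c), comp_rneg hF, fun c => ?_⟩
  beta_reduce
  rw [← hF', KR_ev, rev_neg]; rfl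

theorem CRf.sub {f g : RI (SI Γ) → RI (SI Γ)} (hf : CRf KW f) (hg : CRf KW g) :
    CRf KW (fun r => f r - g r) := by
  simp_rw [sub_eq_add_neg]
  exact hf.add KW (hg.neg KW)

theorem CRf.ite {f g : RI (SI Γ) → RI (SI Γ)} (s : RI (SI Γ)) (hf : CRf KW f) (hg : CRf KW g) :
    CRf KW (fun r => if r ≤ s then f r else g r) := by
  obtain ⟨F, hF, hF'⟩ := hf
  obtain ⟨G, hG, hG'⟩ := hg
  obtain ⟨d, rfl⟩ := (KR KW).surj s
  refine ⟨fun c => cond ((KR KW).leb c d) (F c) (G c),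
    Computable.cond ((KR KW).comp_le Computable.id (Computable.const d)) hF hG, fun c => ?_⟩
  have h := (KR KW).leb_iff c d
  beta_reduce
  by_cases h1 : (KR KW).ev c ≤ (KR KW).ev d
  · rw [h.2 h1, if_pos h1]; exact hF' c
  · rw [if_neg h1, Bool.eq_false_iff.2 (fun h2 => h1 (h.1 h2))]; exact hG' c

theorem CRf.lin (happ : ∀ v w, KW.ev (v ++ w) = KW.ev v * KW.ev w) (k : ℤ) (g : Γ) :
    CRf KW (lin k g) := by
  obtain ⟨v, rfl⟩ := KW.surj g
  refine ⟨fun c => c.map fun t => ((t.1.1 + k, t.1.2.map fun w => v ++ w), t.2), ?_, fun c => ?_⟩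
  · have h1 : Computable fun p : RC q × (IC q × Bool) => p.2.1 := Computable.fst.comp Computable.snd
    exact CT.list_map Computable.id (Computable.pair (Computable.pair
      (CT.intAdd (Computable.fst.comp h1) (Computable.const k))
      (Computable.option_map (Computable.snd.comp h1)
        (Computable.list_append.comp (Computable.const v) Computable.snd)))
      (Computable.snd.comp Computable.snd))
  · beta_reduce
    rw [KR_ev, KR_ev]
    have hz : _root_.lin k (KW.ev v) 0 = 0 := by
      have := lin_sub k (KW.ev v) 0 0
      simpa using this
    induction c with
    | nil => rw [List.map_nil, rev_nil, hz]
    | cons t c ih =>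
      rw [List.map_cons, rev_cons, rev_cons, lin_add, ih]
      congr 1
      obtain ⟨⟨l, o⟩, b⟩ := t
      have h0 : _root_.lin k (KW.ev v) (eb ((KI KW).ev (l, o))) =
          eb ((KI KW).ev (l + k, o.map fun w => v ++ w)) := by
        cases o with
        | none => rw [KI_none, lin_eb]; rfl
        | some w =>
          rw [KI_some, lin_eb, Option.map_some, KI_some, happ]; rfl
      cases b
      · have h1 := lin_sub k (KW.ev v) 0 (eb ((KI KW).ev (l, o)))
        rw [zero_sub, hz, zero_sub, h0] at h1
        exact h1.symm
      · exact h0.symm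

/-- computably realized automorphisms -/
def CRs : Subgroup (RI (SI Γ) ≃o RI (SI Γ)) where
  carrier := {f | CRf KW f ∧ CRf KW (f⁻¹ : RI (SI Γ) ≃o RI (SI Γ))}
  one_mem' := ⟨CRf.id KW, CRf.id KW⟩
  mul_mem' := by
    rintro f g ⟨h1, h2⟩ ⟨h3, h4⟩
    refine ⟨h1.comp KW h3, ?_⟩
    rw [mul_inv_rev]
    exact h4.comp KW h2
  inv_mem' := by
    rintro f ⟨h1, h2⟩
    refine ⟨h2, ?_⟩
    rw [inv_inv]; exact h1

theorem mem_CRs {f : RI (SI Γ) ≃o RI (SI Γ)} :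
    f ∈ CRs KW ↔ CRf KW f ∧ CRf KW (f⁻¹ : RI (SI Γ) ≃o RI (SI Γ)) := Iff.rfl

theorem tr_CRs (c : RI (SI Γ)) : tr c ∈ CRs KW := by
  refine ⟨(CRf.id KW).add KW (CRf.const KW c), ?_⟩
  have : ((tr c)⁻¹ : RI (SI Γ) ≃o RI (SI Γ)) = fun r => r - c := by
    funext r; rw [tr_inv_apply]
  rw [this]
  exact (CRf.id KW).sub KW (CRf.const KW c)

theorem tcj_CRs (c : RI (SI Γ)) {f : RI (SI Γ) ≃o RI (SI Γ)} (hf : f ∈ CRs KW) :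
    tcj c f ∈ CRs KW := by
  rw [tcj_def]
  exact mul_mem (mul_mem (tr_CRs KW c) hf) (inv_mem (tr_CRs KW c))

theorem X_CRs (happ : ∀ v w, KW.ev (v ++ w) = KW.ev v * KW.ev w) (a e : RI (SI Γ)) (he : 0 ≤ e) :
    (SC Γ).X a e he ∈ CRs KW := by
  have hZ : CRf KW (SC Γ).Z := by rw [SC_Z]; exact CRf.lin KW happ _ _
  have hZi : CRf KW ((SC Γ).Z⁻¹ : RI (SI Γ) ≃o RI (SI Γ)) := by rw [SC_Zi]; exact CRf.lin KW happ _ _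
  have hI := CRf.id KW
  have hc := CRf.const KW
  constructor
  · have : ((SC Γ).X a e he : RI (SI Γ) → RI (SI Γ)) = fun r => if r ≤ a then r else
        if r ≤ a + (SC Γ).Z e then (SC Γ).Z⁻¹ (r - a) + a else r + (e - (SC Γ).Z e) := by
      funext r
      split_ifs with h1 h2
      · exact (SC Γ).X_1 he h1
      · exact (SC Γ).X_2 he (not_le.1 h1).le h2
      · exact (SC Γ).X_3 he (not_le.1 h2).le
    rw [this]
    exact CRf.ite KW _ hI (CRf.ite KW _ ((hZi.comp KW (hI.sub KW (hc a))).add KW (hc a))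
      (hI.add KW (hc _)))
  · have : (((SC Γ).X a e he)⁻¹ : RI (SI Γ) ≃o RI (SI Γ)) = fun r => if r ≤ a then r else
        if r ≤ a + e then (SC Γ).Z (r - a) + a else r - (e - (SC Γ).Z e) := by
      funext r
      split_ifs with h1 h2
      · exact (SC Γ).Xi_1 he h1
      · exact (SC Γ).Xi_2 he (not_le.1 h1).le h2
      · exact (SC Γ).Xi_3 he (not_le.1 h2).le
    rw [this]
    exact CRf.ite KW _ hI (CRf.ite KW _ ((hZ.comp KW (hI.sub KW (hc a))).add KW (hc a))
      (hI.sub KW (hc _)))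

theorem Y_CRs (happ : ∀ v w, KW.ev (v ++ w) = KW.ev v * KW.ev w) (a b e : RI (SI Γ)) (he : 0 ≤ e) :
    (SC Γ).Y a b e he ∈ CRs KW :=
  mul_mem (X_CRs KW happ _ _ _) (inv_mem (X_CRs KW happ _ _ _))

theorem gJ_CRs (happ : ∀ v w, KW.ev (v ++ w) = KW.ev v * KW.ev w) (g : Γ) :
    (SC Γ).gJ g ∈ CRs KW := by
  have key : ∀ g : Γ, CRf KW ((SC Γ).gJ g) := by
    intro g
    have : ((SC Γ).gJ g : RI (SI Γ) → RI (SI Γ)) = fun r => if r ≤ 0 then r else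
        if r ≤ (8 : ℤ) • (SC Γ).one then (SC Γ).act g r else r := by
      funext r
      split_ifs with h1 h2
      · exact (SC Γ).gJ_1 g h1
      · exact (SC Γ).gJ_2 g (not_le.1 h1).le h2
      · exact (SC Γ).gJ_3 g (not_le.1 h2).le
    rw [this]
    refine CRf.ite KW _ (CRf.id KW) (CRf.ite KW _ ?_ (CRf.id KW))
    rw [SC_act]; exact CRf.lin KW happ _ _
  refine ⟨key g, ?_⟩
  have : ((SC Γ).gJ g)⁻¹ = (SC Γ).gJ g⁻¹ := ((SC Γ).gJh.map_inv g).symm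
  rw [this]; exact key _

theorem xt_CRs (happ : ∀ v w, KW.ev (v ++ w) = KW.ev v * KW.ev w) {p : ℕ} (γ : Fin p → Γ)
    (j : Scale.JJ p) : (SC Γ).xt γ j ∈ CRs KW := by
  have key : (SC Γ).xj γ j ∈ CRs KW := by
    rcases j with j | j
    · fin_cases j
      · exact Y_CRs KW happ _ _ _ _
      · exact Y_CRs KW happ _ _ _ _
      · exact Y_CRs KW happ _ _ _ _
      · exact Y_CRs KW happ _ _ _ _
    · exact gJ_CRs KW happ _
  exact mul_mem key (inv_mem (tcj_CRs KW _ key))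

theorem SC_one : (SC Γ).one = eb (sx 0 ⊥) := rfl

theorem SC_z : (SC Γ).z = eb (sx 1 ⊥) := by
  unfold Scale.z
  rw [SC_Z, SC_one, lin_eb]
  rfl

theorem SC_u : uu Γ = eb (sx 0 ⊥) - eb (sx 1 ⊥) := by
  unfold uu Scale.u
  rw [SC_z, SC_one]

theorem co_u : co (uu Γ) (sx 0 ⊥) = 1 := by
  rw [SC_u, co_sub, co_eb, co_eb, if_pos rfl, if_neg, sub_zero]
  intro h
  have : (1 : ℤ) = 0 := congrArg (fun s => (ofLex s).1) h
  omega

theorem u_le : uu Γ ≤ eb (sx 0 ⊥) := by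
  rw [SC_u]
  exact sub_le_self _ (eb_pos _).le

theorem co_mono {i : SI Γ} {r s : RI (SI Γ)} (h : r ≤ s) (hlow : ∀ j < i, co r j = co s j) :
    co r i ≤ co s i := by
  by_contra h1
  exact absurd h (not_le.2 (RI_lt.2 ⟨i, fun j hj => (hlow j hj).symm, not_le.1 h1⟩))

theorem small_low {r : RI (SI Γ)} {n : ℕ} (h1 : -(n : ℤ) • uu Γ ≤ r) (h2 : r ≤ (n : ℤ) • uu Γ) :
    ∀ j < (sx 0 ⊥ : SI Γ), co r j = 0 := by
  have hn : (n : ℤ) • uu Γ ≤ (n : ℤ) • eb (sx 0 ⊥) := zsmul_le_zsmul_right (by omega) u_le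
  have h3 := small_bdd (i := (sx 0 ⊥ : SI Γ)) (n := n) (r := r) (by
    rw [neg_zsmul] at h1 ⊢
    exact (neg_le_neg hn).trans h1) (h2.trans hn)
  intro j hj
  have := h3 j hj.le
  rw [co_sub, co_zsmul, co_eb, if_neg hj.ne', mul_zero, sub_zero] at this
  exact this

theorem cell_bd {m : ℤ} {r : RI (SI Γ)} (h : cell m r) : |m| ≤ |co r (sx 0 ⊥)| + 1 := by
  have hu := (SC Γ).u_pos
  obtain ⟨h1, h2⟩ := h
  have e1 : la (uu Γ) + m • cv Γ = (-10 + m * 310) • uu Γ := by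
    unfold la cv lv; rw [add_zsmul, mul_zsmul]
  have e2 : la (uu Γ) + m • cv Γ + cv Γ = (300 + m * 310) • uu Γ := by
    rw [e1]; unfold cv lv; rw [← add_zsmul]; congr 1; ring
  rw [e1] at h1
  rw [e2] at h2
  have hr := small_low (n := (310 + 310 * |m|).toNat) (h1.trans' (by
    apply zsm_le hu
    rw [Int.toNat_of_nonneg (by positivity)]
    cases abs_cases m <;> omega)) (h2.le.trans (by
    apply zsm_le hu
    rw [Int.toNat_of_nonneg (by positivity)]
    cases abs_cases m <;> omega))
  have hs : ∀ n : ℤ, ∀ j < (sx 0 ⊥ : SI Γ), co (n • uu Γ) j = 0 := by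
    intro n
    apply small_low (n := |n|.toNat)
    · apply zsm_le hu
      rw [Int.toNat_of_nonneg (by positivity)]
      exact neg_abs_le n
    · apply zsm_le hu
      rw [Int.toNat_of_nonneg (by positivity)]
      exact le_abs_self n
  have h3 := co_mono h1 fun j hj => by rw [hr j hj, hs _ j hj]
  have h4 := co_mono h2.le fun j hj => by rw [hr j hj, hs _ j hj]
  rw [co_zsmul, co_u] at h3 h4
  cases abs_cases m <;> cases abs_cases (co r (sx 0 ⊥)) <;> omega

theorem foldr_find {l : List ℤ} (P : ℤ → Bool) (a : ℤ) {m : ℤ} (hm : m ∈ l) (hP : P m = true)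
    (hu : ∀ n, P n = true → n = m) : l.foldr (fun n b => cond (P n) n b) a = m := by
  induction l with
  | nil => cases hm
  | cons n l ih =>
    rw [List.foldr_cons]
    by_cases h : P n = true
    · rw [h]; exact hu n h
    · rw [Bool.eq_false_iff.2 h]
      rcases List.mem_cons.1 hm with rfl | h'
      · exact absurd hP h
      · exact ih h'

theorem PP_CRf (C : ℤ → Bool) (hC : Computable C) (k : KC (uu Γ)) (hk : CRf KW k.1) :
    CRf KW (PP cv_pos C k) := by
  obtain ⟨F, hF, hF'⟩ := hk
  obtain ⟨a, ha⟩ := (KR KW).surj (la (uu Γ))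
  obtain ⟨v, hv⟩ := (KR KW).surj (cv Γ)
  let P : ℤ → RC q → Bool := fun m c =>
    (KR KW).leb (a ++ rsm m v) c && (KR KW).ltb c (a ++ rsm m v ++ v)
  have hP : ∀ m c, P m c = true ↔ cell m ((KR KW).ev c) := by
    intro m c
    change (_ && _) = true ↔ _
    rw [Bool.and_eq_true, CO.leb_iff, CO.spec]
    simp only [KR_ev, rev_append, rev_rsm] at ha hv ⊢
    rw [ha, hv]; rfl
  have cP : ∀ {β : Type} [Primcodable β] {f : β → ℤ} {g : β → RC q}, Computable f → Computable g →
      Computable fun b => P (f b) (g b) := by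
    intro β _ f g hf hg
    have h1 := Computable.list_append.comp (Computable.const a) (comp_rsm hf (Computable.const v))
    exact CT.band ((KR KW).comp_le h1 hg) ((KR KW).comp_lt hg
      (Computable.list_append.comp h1 (Computable.const v)))
  let M : RC q → ℤ := fun c => (CT.irange (c.length + 1)).foldr (fun n b => cond (P n c) n b) 0
  have cM : Computable M := by
    refine CT.list_foldr (h := fun c p => cond (P p.1 c) p.1 p.2) (CT.comp_irange (CT.natAdd Computable.list_length (Computable.const 1)))
      (Computable.const 0) ?_
    have h1 : Computable fun p : RC q × (ℤ × ℤ) => p.2.1 := Computable.fst.comp Computable.snd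
    exact Computable.cond (cP h1 Computable.fst) h1 (Computable.snd.comp Computable.snd)
  have hM : ∀ c m, cell m ((KR KW).ev c) → M c = m := by
    intro c m hm
    refine foldr_find (fun n => P n c) 0 ?_ ((hP m c).2 hm)
      fun n hn => inCell_unique cv_pos ((hP n c).1 hn) hm
    have h1 := cell_bd hm
    have h2 := ncf_bd (KI KW) c (0, none)
    rw [ncf_spec, KI_none] at h2
    rw [KR_ev] at h1
    rw [CT.mem_irange]
    push_cast
    rw [← abs_le]
    omega
  refine ⟨fun c => cond (P (M c) c && C (M c)) (F (c ++ rneg (rsm (M c) v)) ++ rsm (M c) v) c,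
    ?_, fun c => ?_⟩
  · have hr := comp_rsm cM (Computable.const v)
    exact Computable.cond (CT.band (cP cM Computable.id) (hC.comp cM))
      (Computable.list_append.comp (hF.comp (Computable.list_append.comp Computable.id
        (comp_rneg hr))) hr) Computable.id
  · beta_reduce
    by_cases h : ∃ m, cell m ((KR KW).ev c)
    · obtain ⟨m, hm⟩ := h
      rw [hM c m hm, (hP m c).2 hm, Bool.true_and]
      cases hCm : C m
      · rw [PP_off C k hm hCm]; rfl
      · rw [PP_in C k hm hCm]
        simp only [cond_true]
        rw [KR_ev, rev_append, ← KR_ev, hF', KR_ev, rev_append, rev_neg, rev_rsm]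
        rw [KR_ev] at hv
        rw [hv, ← sub_eq_add_neg, KR_ev]
    · have : P (M c) c = false := by
        rw [Bool.eq_false_iff, Ne, hP]
        exact fun h1 => h ⟨_, h1⟩
      rw [this, PP_out C k h]; rfl

theorem PP_CRs (C : ℤ → Bool) (hC : Computable C) (k : KC (uu Γ)) (hk : k.1 ∈ CRs KW) :
    PP cv_pos C k ∈ CRs KW := by
  refine ⟨PP_CRf KW C hC k hk.1, ?_⟩
  rw [← map_inv]
  exact PP_CRf KW C hC _ hk.2

end Real

theorem comp_finite {ι C D : Type*} [Primcodable ι] [Primcodable C] [Primcodable D]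
    [DecidableEq ι] [Fintype ι] (f : ι → C → D) (hf : ∀ i, Computable (f i)) : Computable₂ f := by
  rcases isEmpty_or_nonempty ι with h | ⟨⟨i0⟩⟩
  · exact Computable.option_some_iff.1 ((Computable.const (α := ι × C) (none : Option D)).of_eq
      fun p => isEmptyElim p.1)
  have key : ∀ l : List ι, Computable fun p : ι × C =>
      l.foldr (fun i r => if p.1 = i then f i p.2 else r) (f i0 p.2) := by
    intro l
    induction l with
    | nil => exact (hf i0).comp Computable.snd
    | cons i l ih =>
      refine CT.ite_bool (p := fun p : ι × C => p.1 = i) ?_ ((hf i).comp Computable.snd) ih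
      exact ((Primrec.eq (α := ι)).decide.to_comp).comp Computable.fst (Computable.const i)
  refine (key Finset.univ.toList).of_eq fun p => ?_
  have : ∀ l : List ι, p.1 ∈ l →
      l.foldr (fun i r => if p.1 = i then f i p.2 else r) (f i0 p.2) = f p.1 p.2 := by
    intro l
    induction l with
    | nil => intro h; cases h
    | cons i l ih =>
      intro h
      rw [List.foldr_cons]
      by_cases hi : p.1 = i
      · rw [if_pos hi, ← hi]
      · rw [if_neg hi]
        exact ih ((List.mem_cons.1 h).resolve_left hi)
  exact this _ (Finset.mem_toList.2 (Finset.mem_univ _))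

theorem map_letr_prod {m : ℕ} {Q : Type*} [Group Q] (gen : Fin m → Q) (w : List (Fin m × Bool)) :
    (w.map (letr gen)).prod = FreeGroup.lift gen (FreeGroup.mk w) := by
  induction w with
  | nil => simp [← FreeGroup.one_eq_mk]
  | cons p w ih => rw [List.map_cons, List.prod_cons, ih, lift_mk_cons]

section Letters

variable {Γ : Type} [Group Γ] [LinearOrder Γ] [MulLeftMono Γ] {q : ℕ} (KW : CO Γ (WC q))

theorem letters (happ : ∀ v w, KW.ev (v ++ w) = KW.ev v * KW.ev w) {m : ℕ} [Nonempty (Fin m)]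
    (gen : Fin m → (RI (SI Γ) ≃o RI (SI Γ))) (hL : ∀ i, IsL (gen i)) (hR : ∀ i, gen i ∈ CRs KW) :
    ∃ act1 : Fin m × Bool → RC q → RC q, Computable₂ act1 ∧
      (∀ p c, (KR KW).ev (act1 p c) = letr gen p ((KR KW).ev c)) ∧
      ∃ triv : List (Fin m × Bool) → Bool, Computable triv ∧
        ∀ w, triv w = true ↔ FreeGroup.lift gen (FreeGroup.mk w) = 1 := by
  have hex : ∀ p : Fin m × Bool, CRf KW (fun r => letr gen p r) := by
    rintro ⟨i, b⟩
    cases b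
    · exact (hR i).2
    · exact (hR i).1
  choose act1 hc hact using hex
  have hc2 : Computable₂ act1 := comp_finite act1 hc
  refine ⟨act1, hc2, hact, ?_⟩
  have hLp : ∀ p : Fin m × Bool, IsL (letr gen p) := by
    rintro ⟨i, b⟩
    cases b
    · exact (hL i).inv
    · exact hL i
  obtain ⟨B, D, n0, hwp⟩ := wp (letr gen) hLp
  have hB : ∃ Bc : List (RC q), Bc.map (KR KW).ev = B := by
    choose g hg using (KR KW).surj
    refine ⟨B.map g, ?_⟩
    rw [List.map_map]
    conv_rhs => rw [← List.map_id B]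
    exact List.map_congr_left fun b _ => hg b
  obtain ⟨Bc, hBc⟩ := hB
  obtain ⟨v, hv⟩ := (KR KW).surj (cv Γ)
  have h1 : KW.ev [] = 1 := by
    have := happ [] []
    rw [List.append_nil] at this
    exact (left_eq_mul.1 this)
  let pt : (List (Fin m × Bool) × ℕ) × RC q → ℕ → RC q := fun a k =>
    actW act1 (CT.winv (a.1.1.drop a.1.2)) (a.2 ++ rsm (k : ℤ) v)
  let ex : List (Fin m × Bool) → RC q := fun w => [((((n0 + D * w.length : ℕ) : ℤ), some []), true)]
  let tst : List (Fin m × Bool) → RC q → Bool := fun w p =>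
    (KR KW).eqb (actW act1 w p) p
  let triv : List (Fin m × Bool) → Bool := fun w =>
    (List.range (w.length + 1)).all fun n => Bc.all fun β =>
      (List.range (2 ^ (4 * w.length + 9))).all fun k =>
        tst w (pt ((w, n), β) k) && tst w (pt ((w, n), β) k ++ ex w)
  have hpt : Computable₂ pt := by
    refine comp_actW hc2 (CT.comp_winv ?_) (Computable.list_append.comp ?_ (comp_rsm ?_ ?_))
    · exact (Primrec.list_drop.to_comp).comp (Computable.snd.comp (Computable.fst.comp Computable.fst))
        (Computable.fst.comp (Computable.fst.comp Computable.fst))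
    · exact Computable.snd.comp Computable.fst
    · exact CT.natCast Computable.snd
    · exact Computable.const v
  have hexc : Computable ex := by
    have : Computable fun w : List (Fin m × Bool) =>
        ((((n0 + D * w.length : ℕ) : ℤ), (some [] : Option (WC q))), true) := by
      refine Computable.pair (Computable.pair (CT.natCast ?_) (Computable.const _)) (Computable.const _)
      exact CT.natAdd (Computable.const _) (CT.natMul (Computable.const _) Computable.list_length)
    exact Computable.list_cons.comp this (Computable.const [])
  have htst : Computable₂ tst := (KR KW).comp_eq (comp_actW hc2 Computable.fst Computable.snd) Computable.snd
  have htriv : Computable triv := by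
    refine CT.list_all (g := fun w n => Bc.all fun β =>
      (List.range (2 ^ (4 * w.length + 9))).all fun k =>
        tst w (pt ((w, n), β) k) && tst w (pt ((w, n), β) k ++ ex w)) ?_ ?_
    · exact CT.list_range (CT.natAdd Computable.list_length (Computable.const 1))
    · refine CT.list_all (f := fun _ => Bc) (g := fun (a : List (Fin m × Bool) × ℕ) β =>
        (List.range (2 ^ (4 * a.1.length + 9))).all fun k =>
        tst a.1 (pt (a, β) k) && tst a.1 (pt (a, β) k ++ ex a.1)) (Computable.const Bc) ?_
      refine CT.list_all (f := fun (b : (List (Fin m × Bool) × ℕ) × RC q) =>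
        List.range (2 ^ (4 * b.1.1.length + 9)))
        (g := fun (b : (List (Fin m × Bool) × ℕ) × RC q) k =>
        tst b.1.1 (pt b k) && tst b.1.1 (pt b k ++ ex b.1.1)) ?_ ?_
      · refine CT.list_range (CT.natPow (Computable.const 2) (CT.natAdd (CT.natMul (Computable.const 4)
          ?_) (Computable.const 9)))
        exact Computable.list_length.comp (Computable.fst.comp Computable.fst)
      · have hw : Computable fun c : ((List (Fin m × Bool) × ℕ) × RC q) × ℕ => c.1.1.1 :=
          Computable.fst.comp (Computable.fst.comp Computable.fst)
        have hp : Computable fun c : ((List (Fin m × Bool) × ℕ) × RC q) × ℕ => pt c.1 c.2 :=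
          hpt.comp Computable.fst Computable.snd
        exact CT.band (htst.comp hw hp) (htst.comp hw (Computable.list_append.comp hp (hexc.comp hw)))
  refine ⟨triv, htriv, fun w => ⟨fun h => ?_, fun h => ?_⟩⟩
  · rw [← map_letr_prod]
    apply hwp
    intro s hs β hβ k hk
    rw [← hBc, List.mem_map] at hβ
    obtain ⟨b, hb, rfl⟩ := hβ
    obtain ⟨t, ht⟩ := hs
    have h2 := List.all_eq_true.1 (List.all_eq_true.1 (List.all_eq_true.1 h t.length
      (List.mem_range.2 (by rw [← ht, List.length_append]; omega))) b hb) k (List.mem_range.2 hk)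
    rw [Bool.and_eq_true] at h2
    have hsd : w.drop t.length = s := by rw [← ht]; simp
    have hptv : (KR KW).ev (pt ((w, t.length), b) k) =
        ((s.map (letr gen)).prod)⁻¹ ((KR KW).ev b + (k : ℤ) • cv Γ) := by
      simp only [pt]
      rw [actW_spec _ gen act1 hact, hsd, lift_mk_winv, map_letr_prod]
      congr 1
      rw [KR_ev, rev_append, rev_rsm, ← hv]; rfl
    have hexv : (KR KW).ev (pt ((w, t.length), b) k ++ ex w) =
        ((s.map (letr gen)).prod)⁻¹ ((KR KW).ev b + (k : ℤ) • cv Γ) +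
          eb (sx ((n0 + D * w.length : ℕ) : ℤ) ((1 : Γ) : WithBot Γ)) := by
      rw [← hptv, KR_ev, rev_append]
      congr 1
      simp only [ex]
      rw [rev_cons, rev_nil, add_zero, tev, cond_true, KI_some, h1]
    have h3 := ((KR KW).eqb_iff _ _).1 h2.1
    have h4 := ((KR KW).eqb_iff _ _).1 h2.2
    rw [actW_spec _ gen act1 hact, ← map_letr_prod] at h3 h4
    rw [hptv] at h3
    rw [hexv] at h4
    exact ⟨h3, h4⟩
  · refine List.all_eq_true.2 fun n _ => List.all_eq_true.2 fun b _ => List.all_eq_true.2 fun k _ => ?_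
    have : ∀ p, tst w p = true := by
      intro p
      refine ((KR KW).eqb_iff _ _).2 ?_
      rw [actW_spec _ gen act1 hact, h, aut_one]
    rw [this, this]; rfl

end Letters

section Emb

variable {Γ : Type} [Group Γ] [LinearOrder Γ] [MulLeftMono Γ]

theorem gJ_sup9 (g : Γ) : Sup ((SC Γ).gJ g) 0 ((9 : ℤ) • uu Γ) :=
  (SC Γ).xj_sup (fun _ : Fin 1 => g) (Sum.inr 0)

theorem zsm_sup {k : RI (SI Γ) ≃o RI (SI Γ)} {A B : ℤ} (h : Sup k (A • uu Γ) (B • uu Γ)) (c : ℤ) :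
    Sup (tcj (c • uu Γ) k) ((A + c) • uu Γ) ((B + c) • uu Γ) := by
  have := h.tcj (c • uu Γ)
  rwa [← add_zsmul, ← add_zsmul] at this

theorem sup_KC {k : RI (SI Γ) ≃o RI (SI Γ)} {A B : ℤ} (h : Sup k (A • uu Γ) (B • uu Γ))
    (hA : -10 ≤ A) (hB : B ≤ 300) : k ∈ KC (uu Γ) := by
  refine h.mono (zsm_le (SC Γ).u_pos hA) ?_
  rw [la_lv]; exact zsm_le (SC Γ).u_pos hB

theorem gJ_sup9' (g : Γ) : Sup ((SC Γ).gJ g) ((0 : ℤ) • uu Γ) ((9 : ℤ) • uu Γ) := by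
  rw [zero_zsmul]; exact gJ_sup9 g

noncomputable def gJk : Γ →* KC (uu Γ) :=
  (SC Γ).gJh.codRestrict _ fun g => sup_KC (gJ_sup9' g) (by norm_num) (by norm_num)

theorem gJk_val (g : Γ) : (gJk g).1 = (SC Γ).gJ g := rfl

/-- the embedding of `Γ` -/
noncomputable def Phi : Γ →* (RI (SI Γ) ≃o RI (SI Γ)) := (PP cv_pos (fun _ => true)).comp gJk

theorem Phi_eta (g : Γ) : Phi g (eb (sx 0 ((1 : Γ) : WithBot Γ))) = eb (sx 0 (g : WithBot Γ)) := by
  have h0 : (0 : RI (SI Γ)) ≤ eb (sx 0 ((1 : Γ) : WithBot Γ)) := (SC Γ).eta_pos.le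
  have h1 : eb (sx 0 ((1 : Γ) : WithBot Γ)) < (SC Γ).one := (SC Γ).inf_lt _ (SC Γ).eta_inf
  have h8 : (SC Γ).one ≤ (8 : ℤ) • (SC Γ).one := by
    have := zsm_le (SC Γ).one_pos (show (1 : ℤ) ≤ 8 by norm_num)
    rwa [one_zsmul] at this
  have hu : (SC Γ).one ≤ (300 : ℤ) • uu Γ := by
    have h2 : (2 : ℤ) • (SC Γ).z < (SC Γ).one := (SC Γ).zn_lt 2
    have h3 : (SC Γ).one ≤ (2 : ℤ) • uu Γ := by
      have e : (2 : ℤ) • uu Γ = (SC Γ).one + ((SC Γ).one - (2 : ℤ) • (SC Γ).z) := by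
        change (2 : ℤ) • ((SC Γ).one - (SC Γ).z) = _
        rw [zsmul_sub, two_zsmul]; abel
      rw [e]
      exact le_add_of_nonneg_right (sub_nonneg.2 h2.le)
    exact h3.trans (zsm_le (SC Γ).u_pos (by norm_num))
  have hcell : inCell (la (uu Γ)) (cv Γ) 0 (eb (sx 0 ((1 : Γ) : WithBot Γ))) := by
    refine ⟨?_, ?_⟩
    · rw [zero_zsmul, add_zero]
      refine le_trans ?_ h0
      have := zsm_le (SC Γ).u_pos (show (-10 : ℤ) ≤ 0 by norm_num)
      rwa [zero_zsmul] at this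
    · rw [zero_zsmul, add_zero, la_lv]
      exact h1.trans_le hu
  rw [Phi, MonoidHom.comp_apply, PP_in _ _ hcell rfl, zero_zsmul, sub_zero, add_zero, gJk_val,
    (SC Γ).gJ_2 g h0 (h1.le.trans h8)]
  change actR g _ = _
  rw [actR_eb]
  simp [botMap]

theorem eb_inj {I : Type*} [LinearOrder I] {i j : I} (h : eb i = eb j) : i = j := by
  by_contra hij
  have := congrArg (fun r => co r i) h
  simp only [co_eb, if_pos] at this
  rw [if_neg (fun e => hij e.symm)] at this
  exact one_ne_zero this

theorem sx_inj {k : ℤ} {g h : Γ} (e : sx k (g : WithBot Γ) = sx k (h : WithBot Γ)) : g = h := by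
  have := congrArg (fun s => (ofLex s).2) e
  exact WithBot.coe_injective this

theorem Phi_inj : Function.Injective (Phi : Γ →* (RI (SI Γ) ≃o RI (SI Γ))) := by
  intro g h e
  have h1 := Phi_eta g
  rw [e, Phi_eta] at h1
  exact (sx_inj (eb_inj h1)).symm

theorem comm4 {Q : Type*} [Group Q] (a b q r : Q) (h1 : q * b = b * q) (h2 : q * r = r * q)
    (h3 : a * r = r * a) :
    (a * q) * (b * r) * (a * q)⁻¹ * (b * r)⁻¹ = a * b * a⁻¹ * b⁻¹ := by
  have e1 : (a * q) * (b * r) = a * b * r * q := by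
    calc (a * q) * (b * r) = a * (q * b) * r := by group
      _ = a * b * (q * r) := by rw [h1]; group
      _ = a * b * r * q := by rw [h2]; group
  have e2 : a⁻¹ * r⁻¹ = r⁻¹ * a⁻¹ := by
    rw [← mul_inv_rev, ← mul_inv_rev, h3]
  calc (a * q) * (b * r) * (a * q)⁻¹ * (b * r)⁻¹ = a * b * r * (a⁻¹ * r⁻¹) * b⁻¹ := by
        rw [e1]; group
    _ = a * b * a⁻¹ * b⁻¹ := by rw [e2]; group

variable (γ : Fin 3 → Γ)

theorem gJ_inv (g : Γ) : (SC Γ).gJ g⁻¹ = ((SC Γ).gJ g)⁻¹ := map_inv (SC Γ).gJh g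
theorem gJ_one' : (SC Γ).gJ (1 : Γ) = 1 := map_one (SC Γ).gJh

theorem split_word (c : List (Fin 3 × Bool)) :
    ∃ q, Sup q ((20 : ℤ) • uu Γ) ((29 : ℤ) • uu Γ) ∧
      FreeGroup.lift (fun j => (SC Γ).xt γ (Sum.inr j)) (FreeGroup.mk c) =
        (SC Γ).gJ (FreeGroup.lift γ (FreeGroup.mk c)) * q := by
  induction c with
  | nil =>
    refine ⟨1, Sup.one _ _, ?_⟩
    rw [← FreeGroup.one_eq_mk, map_one, map_one, gJ_one', one_mul]
  | cons p c ih =>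
    obtain ⟨q, hq, e⟩ := ih
    obtain ⟨j, b⟩ := p
    let t := tcj ((20 : ℤ) • uu Γ) ((SC Γ).gJ (γ j))
    have ht : Sup t ((20 : ℤ) • uu Γ) ((29 : ℤ) • uu Γ) := zsm_sup (gJ_sup9' (γ j)) 20
    have hx : (SC Γ).xt γ (Sum.inr j) = (SC Γ).gJ (γ j) * t⁻¹ := rfl
    have h920 : (9 : ℤ) • uu Γ ≤ (20 : ℤ) • uu Γ := zsm_le (SC Γ).u_pos (by norm_num)
    have hcm : ∀ (g : Γ) s, Sup s ((20 : ℤ) • uu Γ) ((29 : ℤ) • uu Γ) →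
      (SC Γ).gJ g * s = s * (SC Γ).gJ g := fun g s hs => (gJ_sup9' g).comm hs h920
    rw [lift_mk_cons, lift_mk_cons, e]
    cases b
    · refine ⟨t * q, ht.mul hq, ?_⟩
      simp only [letr, cond_false]
      rw [hx, mul_inv_rev, inv_inv, (SC Γ).gJ_mul, gJ_inv, ← gJ_inv, ← hcm _ t ht]
      simp only [mul_assoc]
      rw [← mul_assoc t, ← hcm _ t ht]
      simp only [mul_assoc]
    · refine ⟨t⁻¹ * q, ht.inv.mul hq, ?_⟩
      simp only [letr, cond_true]
      rw [hx, (SC Γ).gJ_mul]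
      simp only [mul_assoc]
      rw [← mul_assoc t⁻¹, ← hcm _ _ ht.inv]
      simp only [mul_assoc]

variable (hγ : Subgroup.closure (Set.range γ) = ⊤)

abbrev PI := Fin 310 × Scale.JJ 3 × Bool

noncomputable def eP : Fin (Fintype.card PI) ≃ PI := (Fintype.equivFin PI).symm

noncomputable def genP (i : Fin (Fintype.card PI)) : RI (SI Γ) ≃o RI (SI Γ) :=
  ((SC Γ).core γ hγ).hg (eP i)

theorem genP_L (i : Fin (Fintype.card PI)) : IsL (genP γ hγ i) := by
  refine ⟨_, _, ((SC Γ).core γ hγ).xk (eP i).2.1, (eP i).1.2, ?_, xt_PLs γ _, xt_LVs γ _, rfl⟩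
  split_ifs <;> simp

theorem genP_R (KW : CO Γ (WC 3)) (happ : ∀ v w, KW.ev (v ++ w) = KW.ev v * KW.ev w)
    (i : Fin (Fintype.card PI)) : genP γ hγ i ∈ CRs KW := by
  refine tcj_CRs KW _ (PP_CRs KW _ ?_ _ (xt_CRs KW happ γ _))
  split_ifs
  · exact comp_chi
  · exact Computable.const true

theorem genP_range : (FreeGroup.lift (genP γ hγ)).range = ((SC Γ).core γ hγ).Hs := by
  rw [FreeGroup.range_lift_eq_closure, Core.Hs]
  congr 1
  exact eP.surjective.range_comp _

noncomputable def io (j : Fin 3) : Fin (Fintype.card PI) := eP.symm (0, Sum.inr j, false)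
noncomputable def i20 : Fin (Fintype.card PI) := eP.symm (20, Sum.inr 2, false)

theorem genP_io (j : Fin 3) : genP γ hγ (io j) =
    PP cv_pos (fun _ => true) (((SC Γ).core γ hγ).xk (Sum.inr j)) := by
  rw [genP, io, Equiv.apply_symm_apply, Core.hg]
  simp [tcj_zero]

theorem xt_sup' (j : Scale.JJ 3) : Sup ((SC Γ).xt γ j) ((0 : ℤ) • uu Γ) ((29 : ℤ) • uu Γ) := by
  rw [zero_zsmul]; exact (SC Γ).xt_sup γ j

noncomputable def k20 : KC (uu Γ) := ⟨tcj ((20 : ℤ) • uu Γ) ((SC Γ).xt γ (Sum.inr 2)),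
  sup_KC (zsm_sup (xt_sup' γ _) 20) (by norm_num) (by norm_num)⟩

theorem genP_i20 : genP γ hγ i20 = PP cv_pos (fun _ => true) (k20 γ) := by
  rw [genP, i20, Equiv.apply_symm_apply, Core.hg]
  symm
  have hu := (SC Γ).u_pos
  refine (PP_tcj (hv := cv_pos) (fun _ => true) (((SC Γ).core γ hγ).xk (Sum.inr 2)) (k20 γ)
    ((20 : ℤ) • uu Γ) _ _ (xt_sup' γ (Sum.inr 2)) (zsm_le hu (by norm_num)) ?_ ?_ ?_ rfl).trans ?_
  · rw [la_lv]; exact zsm_le hu (by norm_num)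
  · rw [← add_zsmul]; exact zsm_le hu (by norm_num)
  · rw [← add_zsmul, la_lv]; exact zsm_le hu (by norm_num)
  · rfl

theorem lift_map_hom {Q Q' : Type*} [Group Q] [Group Q'] {m n : ℕ} (f : Q →* Q') (ι : Fin n → Fin m)
    (gen : Fin m → Q') (g : Fin n → Q) (h : ∀ j, gen (ι j) = f (g j)) (c : List (Fin n × Bool)) :
    FreeGroup.lift gen (FreeGroup.mk (c.map fun p => (ι p.1, p.2))) =
      f (FreeGroup.lift g (FreeGroup.mk c)) := by
  induction c with
  | nil => rw [List.map_nil, ← FreeGroup.one_eq_mk, map_one, ← FreeGroup.one_eq_mk, map_one, map_one]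
  | cons p c ih =>
    rw [List.map_cons, lift_mk_cons, lift_mk_cons, ih, map_mul]
    congr 1
    rcases p with ⟨j, b⟩
    cases b
    · simp only [letr, cond_false, h, map_inv]
    · simp only [letr, cond_true, h]

noncomputable def wordP (c : List (Fin 3 × Bool)) : List (Fin (Fintype.card PI) × Bool) :=
  (c.map fun p => (io p.1, p.2)) ++ [(io 2, true), (i20, true)] ++
    CT.winv (c.map fun p => (io p.1, p.2)) ++ CT.winv [(io 2, true), (i20, true)]

theorem comp_wordP : Computable wordP := by
  have h1 : Computable fun c : List (Fin 3 × Bool) => c.map fun p => (io p.1, p.2) := by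
    refine CT.list_map (g := fun _ (p : Fin 3 × Bool) => (io p.1, p.2)) Computable.id ?_
    refine Computable.pair ?_ (Computable.snd.comp Computable.snd)
    exact (Primrec.dom_finite io).to_comp.comp (Computable.fst.comp Computable.snd)
  exact Computable.list_append.comp (Computable.list_append.comp (Computable.list_append.comp h1
    (Computable.const _)) (CT.comp_winv h1)) (Computable.const _)

theorem wordP_spec (c : List (Fin 3 × Bool)) :
    FreeGroup.lift (genP γ hγ) (FreeGroup.mk (wordP c)) =
      Phi (FreeGroup.lift γ (FreeGroup.mk c) * γ 2 * (FreeGroup.lift γ (FreeGroup.mk c))⁻¹ * (γ 2)⁻¹) := by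
  have hs : FreeGroup.lift (genP γ hγ) (FreeGroup.mk [(io 2, true), (i20, true)]) =
      PP cv_pos (fun _ => true) (((SC Γ).core γ hγ).xk (Sum.inr 2) * k20 γ) := by
    rw [lift_mk_cons, lift_mk_single, genP_i20, map_mul, ← genP_io γ hγ]; rfl
  rw [wordP, lift_mk_append, lift_mk_append, lift_mk_append, lift_mk_winv, lift_mk_winv, hs,
    lift_map_hom (PP cv_pos (fun _ => true)) io (genP γ hγ) _ (genP_io γ hγ), Phi,
    MonoidHom.comp_apply]
  generalize hA : FreeGroup.lift (fun j => ((SC Γ).core γ hγ).xk (Sum.inr j)) (FreeGroup.mk c) = A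
  generalize hB : ((SC Γ).core γ hγ).xk (Sum.inr 2) * k20 γ = B
  rw [← map_inv, ← map_inv, ← map_mul, ← map_mul, ← map_mul]
  subst hA hB
  congr 1
  apply Subtype.ext
  obtain ⟨q, hq, e⟩ := split_word γ c
  have e' : (FreeGroup.lift (fun j => ((SC Γ).core γ hγ).xk (Sum.inr j)) (FreeGroup.mk c)).1 =
      (SC Γ).gJ (FreeGroup.lift γ (FreeGroup.mk c)) * q := by
    rw [← e]
    have := lift_map_hom (KC (uu Γ)).subtype id (fun j => (SC Γ).xt γ (Sum.inr j))
      (fun j => ((SC Γ).core γ hγ).xk (Sum.inr j)) (fun j => rfl) c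
    simp only [id, Prod.mk.eta, List.map_id'] at this
    exact this.symm
  let r : RI (SI Γ) ≃o RI (SI Γ) := (tcj ((40 : ℤ) • uu Γ) ((SC Γ).gJ (γ 2)))⁻¹
  have hr : Sup r ((40 : ℤ) • uu Γ) ((49 : ℤ) • uu Γ) := (zsm_sup (gJ_sup9' (γ 2)) 40).inv
  have es : (((SC Γ).core γ hγ).xk (Sum.inr 2) * k20 γ).1 = (SC Γ).gJ (γ 2) * r := by
    change (SC Γ).gJ (γ 2) * (tcj ((20 : ℤ) • uu Γ) ((SC Γ).gJ (γ 2)))⁻¹ *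
      tcj ((20 : ℤ) • uu Γ) ((SC Γ).gJ (γ 2) * (tcj ((20 : ℤ) • uu Γ) ((SC Γ).gJ (γ 2)))⁻¹) = _
    rw [map_mul, map_inv, tcj_tcj, ← add_zsmul, mul_assoc, inv_mul_cancel_left]; rfl
  rw [gJk_val, Subgroup.coe_mul, Subgroup.coe_mul, Subgroup.coe_mul, Subgroup.coe_inv, Subgroup.coe_inv,
    es, e', (SC Γ).gJ_mul, (SC Γ).gJ_mul, (SC Γ).gJ_mul, gJ_inv, gJ_inv]
  have hu := (SC Γ).u_pos
  apply comm4
  · exact ((gJ_sup9' (γ 2)).comm hq (zsm_le hu (by norm_num))).symm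
  · exact hq.comm hr (zsm_le hu (by norm_num))
  · exact (gJ_sup9' _).comm hr (zsm_le hu (by norm_num))

end Emb

theorem forward_direction (G : Type) [Group G] (x : ℕ → G)
    (hx : Subgroup.closure (Set.range x) = ⊤) (hc : ComputableLeftOrderWrt x) :
    ∃ (H : Type) (_ : Group H) (m : ℕ) (π : FreeGroup (Fin m) →* H) (φ : G →* H),
        Function.Surjective π ∧ IsSimpleGroup H ∧ ComputableLeftOrderVia π ∧
        Function.Injective φ ∧ DecidableMembership π φ := by
  classical
  obtain ⟨Γ, _, γ, ψ, hs, ⟨l, hl, ho⟩, hψ, ⟨C, hC, hCx⟩, e, he, hex⟩ := stepA G x hx hc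
  letI := l
  haveI : MulLeftMono Γ := ⟨fun a b c h => hl a b c h⟩
  let KW : CO Γ (WC 3) := coWord (fun w => FreeGroup.lift γ (FreeGroup.mk w))
    (fun g => by
      obtain ⟨f, hf⟩ := hs g
      exact ⟨f.toWord, by beta_reduce; rw [FreeGroup.mk_toWord, hf]⟩)
    (lift_mk_append γ) (lift_mk_winv γ) ho
  have hev : ∀ w, KW.ev w = FreeGroup.lift γ (FreeGroup.mk w) := fun _ => rfl
  have happ : ∀ v w, KW.ev (v ++ w) = KW.ev v * KW.ev w := lift_mk_append γ
  have hγ : Subgroup.closure (Set.range γ) = ⊤ := by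
    rw [← FreeGroup.range_lift_eq_closure]
    exact MonoidHom.range_eq_top.2 hs
  haveI : Nonempty (Fin (Fintype.card PI)) := ⟨io 0⟩
  obtain ⟨act1, hac, hact, triv, htc, ht⟩ := letters KW happ (genP γ hγ) (genP_L γ hγ)
    (genP_R γ hγ KW happ)
  set π := (FreeGroup.lift (genP γ hγ)).rangeRestrict with hπ
  have hW : ∀ i, FreeGroup.lift (genP γ hγ) (FreeGroup.mk (wordP (C i))) = (Phi.comp ψ) (x i) := by
    intro i
    rw [wordP_spec, ← hCx]; rfl
  have hsub := subst_word (FreeGroup.lift (genP γ hγ)) (Phi.comp ψ) x (fun i => wordP (C i)) hW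
  have hmem : ∀ g, (Phi.comp ψ) g ∈ (FreeGroup.lift (genP γ hγ)).range := by
    intro g
    obtain ⟨v, rfl⟩ := evalWord_surj x hx g
    exact ⟨_, hsub v⟩
  let φ : G →* (FreeGroup.lift (genP γ hγ)).range := (Phi.comp ψ).codRestrict _ hmem
  have hφ : ∀ g, (φ g).1 = Phi (ψ g) := fun _ => rfl
  refine ⟨_, inferInstance, _, π, φ, MonoidHom.rangeRestrict_surjective _, ?_,
    genOrder (KR KW) _ act1 hac hact triv htc ht, ?_, ?_⟩
  · rw [genP_range]; exact ((SC Γ).core γ hγ).simple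
  · intro a b h
    exact hψ (Phi_inj (congrArg Subtype.val h))
  · let wd : WC 3 → List (Fin (Fintype.card PI) × Bool) := fun v =>
      (e v).flatMap fun p => cond p.2 (wordP (C p.1)) (CT.winv (wordP (C p.1)))
    have hwd : Computable wd :=
      (comp_subst_word (fun i => wordP (C i)) (comp_wordP.comp hC)).comp he
    let mt : List (Fin (Fintype.card PI) × Bool) → Bool := fun w =>
      (actW act1 w ([((0, some []), true)] : RC 3)).any fun t => triv (w ++ CT.winv (wd (t.1.2.getD [])))
    have hmt : Computable mt := by
      refine CT.list_any (g := fun w (t : IC 3 × Bool) => triv (w ++ CT.winv (wd (t.1.2.getD []))))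
        (comp_actW hac Computable.id (Computable.const _)) ?_
      refine htc.comp (Computable.list_append.comp Computable.fst (CT.comp_winv (hwd.comp ?_)))
      exact Computable.option_getD (Computable.snd.comp (Computable.fst.comp Computable.snd))
        (Computable.const [])
    have key : ∀ w, mt w = true ↔ π (FreeGroup.mk w) ∈ φ.range := by
      intro w
      have hπv : (π (FreeGroup.mk w)).1 = FreeGroup.lift (genP γ hγ) (FreeGroup.mk w) := rfl
      constructor
      · intro h
        obtain ⟨t, _, h2⟩ := List.any_eq_true.1 h
        rw [ht, lift_mk_append, lift_mk_winv, mul_inv_eq_one, hsub] at h2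
        exact ⟨_, Subtype.ext (h2.symm)⟩
      · rintro ⟨g, hg⟩
        have hg' : FreeGroup.lift (genP γ hγ) (FreeGroup.mk w) = Phi (ψ g) := by
          rw [← hπv, ← hg]; rfl
        have h3 := actW_spec (KR KW) (genP γ hγ) act1 hact w [((0, some []), true)]
        have h4 : (KR KW).ev [((0, some []), true)] = eb (sx 0 ((1 : Γ) : WithBot Γ)) := by
          have h1 : KW.ev [] = 1 := by rw [hev, ← FreeGroup.one_eq_mk, map_one]
          rw [KR_ev, rev_cons, rev_nil, add_zero, tev, cond_true, KI_some, h1]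
        rw [h4, hg', Phi_eta, KR_ev] at h3
        obtain ⟨t, htm, htv⟩ := co_ne (KI KW) _ (sx 0 ((ψ g : Γ) : WithBot Γ)) (by
          rw [h3, co_eb, if_pos rfl]; exact one_ne_zero)
        refine List.any_eq_true.2 ⟨t, htm, ?_⟩
        rcases t with ⟨⟨k, o⟩, b⟩
        cases o with
        | none =>
          exfalso
          have := congrArg (fun s => (ofLex s).2) htv
          exact WithBot.bot_ne_coe this
        | some v =>
          have h5 : ((KW.ev v : Γ) : WithBot Γ) = ((ψ g : Γ) : WithBot Γ) :=
            congrArg (fun s => (ofLex s).2) htv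
          have h6 : FreeGroup.lift γ (FreeGroup.mk v) = ψ g := WithBot.coe_injective h5
          rw [ht, lift_mk_append, lift_mk_winv, mul_inv_eq_one, hg']
          simp only [Option.getD_some, wd]
          rw [hsub, hex v g h6]; rfl
    refine ⟨fun w => Classical.dec _, hmt.of_eq fun w => ?_⟩
    rw [Bool.eq_iff_iff, key]; simp


theorem computable_left_order_iff_embedding_with_decidable_membership
    (G : Type) [Group G] [Countable G] :
    (∃ x : ℕ → G, Subgroup.closure (Set.range x) = ⊤ ∧ ComputableLeftOrderWrt x) ↔
      ∃ (H : Type) (_ : Group H) (m : ℕ) (π : FreeGroup (Fin m) →* H) (φ : G →* H),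
        Function.Surjective π ∧ IsSimpleGroup H ∧ ComputableLeftOrderVia π ∧
        Function.Injective φ ∧ DecidableMembership π φ := by
  constructor
  · rintro ⟨x, hx, hc⟩
    exact forward_direction G x hx hc
  · rintro ⟨H, _, m, π, φ, hπ, _, hord, hφ, hmem⟩
    exact reverse_direction G H m π φ hπ hord hφ hmem
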